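/- arXiv:2009.05659 — 7 statements merged into one kernel-verified Lean document; each statement's English description precedes it below -/
import Mathlib

section
/- There exists a function l : ℝ → ℝ which belongs to C^{0,α}(ℝ) for every α ∈ [0,1) and is C^∞ on ℝ∖{0}, satisfying 1/2 ≤ l(t) ≤ 3/2 for all t ∈ ℝ and, for every ε > 0, |l'(t)| ≤ C_ε |t|^{−(1+ε)} for all t ≠ 0 and some constant C_ε > 0, and there exist functions u, b₁, b₂, c ∈ C^∞_b(ℝ_t × ℝ²_x) (smooth with all derivatives bounded) with supp u = {(t, x₁, x₂) : t ≥ 0}, such that ∂_t u + ∂²_{x₁} u + l(t)·∂²_{x₂} u + b₁·∂_{x₁} u + b₂·∂_{x₂} u + c·u = 0 everywhere on ℝ_t × ℝ²_x. In particular, the backward parabolic operator ∂_t + ∂²_{x₁} + l(t)∂²_{x₂} + b₁∂_{x₁} + b₂∂_{x₂} + c does not have the uniqueness property from t = 0. -/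
/-- A function `ℝ_t × ℝ²_x → ℝ` (in curried form) belongs to `C^∞_b` if its uncurried
version is smooth and all its iterated derivatives are bounded. -/
def CinftyB (f : ℝ → ℝ → ℝ → ℝ) : Prop :=
  ContDiff ℝ (⊤ : ℕ∞) (fun p : ℝ × ℝ × ℝ => f p.1 p.2.1 p.2.2) ∧
  ∀ k : ℕ, ∃ M : ℝ, ∀ p : ℝ × ℝ × ℝ,
    ‖iteratedFDeriv ℝ k (fun q : ℝ × ℝ × ℝ => f q.1 q.2.1 q.2.2) p‖ ≤ M

section
namespace BP

open Real Filter Topology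

/-! ### Basic smooth profile functions -/

/-- All derivatives of order at least `m₀` of `f` are bounded. -/
def DB (m₀ : ℕ) (f : ℝ → ℝ) : Prop :=
  ∀ m, m₀ ≤ m → ∃ C : ℝ, ∀ x, ‖iteratedFDeriv ℝ m f x‖ ≤ C

lemma db_of_const_outside {f : ℝ → ℝ} (hf : ContDiff ℝ (⊤ : ℕ∞) f) (A B c₀ c₁ : ℝ)
    (h0 : ∀ x, x < A → f x = c₀) (h1 : ∀ x, B < x → f x = c₁) : DB 0 f := by
  intro m _
  obtain ⟨C, hC⟩ := (isCompact_Icc (a := A) (b := B)).exists_bound_of_continuousOn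
    (f := fun x => iteratedFDeriv ℝ m f x)
    (hf.continuous_iteratedFDeriv (by exact_mod_cast le_top)).continuousOn
  have key : ∀ (c x : ℝ), (∀ᶠ y in 𝓝 x, f y = c) → ‖iteratedFDeriv ℝ m f x‖ ≤ |c| := by
    intro c x hx
    have h2 : f =ᶠ[𝓝 x] fun _ => c := hx
    rw [(h2.iteratedFDeriv ℝ m).eq_of_nhds]
    rcases Nat.eq_zero_or_pos m with rfl | hm
    · simp
    · rw [iteratedFDeriv_const_of_ne hm.ne']; simp
  refine ⟨max C (max |c₀| |c₁|), fun x => ?_⟩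
  by_cases hA : x < A
  · refine (key c₀ x ?_).trans ((le_max_left _ _).trans (le_max_right _ _))
    filter_upwards [Iio_mem_nhds hA] with y hy using h0 y hy
  by_cases hB : B < x
  · refine (key c₁ x ?_).trans ((le_max_right _ _).trans (le_max_right _ _))
    filter_upwards [Ioi_mem_nhds hB] with y hy using h1 y hy
  · exact (hC x ⟨not_lt.1 hA, not_lt.1 hB⟩).trans (le_max_left _ _)

lemma sT_smooth : ContDiff ℝ (⊤ : ℕ∞) smoothTransition := smoothTransition.contDiff

lemma sT_db : DB 0 smoothTransition :=
  db_of_const_outside sT_smooth 0 1 0 1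
    (fun _ hx => smoothTransition.zero_of_nonpos hx.le)
    (fun _ hx => smoothTransition.one_of_one_le hx.le)

lemma dsT_smooth : ContDiff ℝ (⊤ : ℕ∞) (deriv smoothTransition) :=
  (contDiff_infty_iff_deriv.1 sT_smooth).2

lemma dsT_zero_of_le {x : ℝ} (hx : x ≤ 0) : deriv smoothTransition x = 0 := by
  have h : HasDerivAt smoothTransition (deriv smoothTransition x) x :=
    (sT_smooth.differentiable (by simp) x).hasDerivAt
  have h2 : HasDerivWithinAt smoothTransition 0 (Set.Iic x) x := by
    refine (hasDerivWithinAt_const x (Set.Iic x) (0:ℝ)).congr ?_ ?_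
    · intro y hy; exact smoothTransition.zero_of_nonpos (le_trans hy hx)
    · exact smoothTransition.zero_of_nonpos hx
  exact (uniqueDiffWithinAt_Iic x).eq_deriv _ h.hasDerivWithinAt h2

lemma dsT_zero_of_ge {x : ℝ} (hx : 1 ≤ x) : deriv smoothTransition x = 0 := by
  have h : HasDerivAt smoothTransition (deriv smoothTransition x) x :=
    (sT_smooth.differentiable (by simp) x).hasDerivAt
  have h2 : HasDerivWithinAt smoothTransition 0 (Set.Ici x) x := by
    refine (hasDerivWithinAt_const x (Set.Ici x) (1:ℝ)).congr ?_ ?_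
    · intro y hy; exact smoothTransition.one_of_one_le (le_trans hx hy)
    · exact smoothTransition.one_of_one_le hx
  exact (uniqueDiffWithinAt_Ici x).eq_deriv _ h.hasDerivWithinAt h2

lemma dsT_db : DB 0 (deriv smoothTransition) :=
  db_of_const_outside dsT_smooth 0 1 0 0
    (fun _ hx => dsT_zero_of_le hx.le) (fun _ hx => dsT_zero_of_ge hx.le)

/-- Antiderivative of the smooth transition. -/
noncomputable def T (t : ℝ) : ℝ := ∫ x in (0:ℝ)..t, smoothTransition x

lemma T_hasDerivAt (t : ℝ) : HasDerivAt T (smoothTransition t) t :=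
  intervalIntegral.integral_hasDerivAt_right
    (smoothTransition.continuous.intervalIntegrable _ _)
    (smoothTransition.continuous.stronglyMeasurableAtFilter _ _)
    smoothTransition.continuous.continuousAt

lemma T_deriv : deriv T = smoothTransition := funext fun t => (T_hasDerivAt t).deriv

lemma T_smooth : ContDiff ℝ (⊤ : ℕ∞) T :=
  contDiff_infty_iff_deriv.2 ⟨fun t => (T_hasDerivAt t).differentiableAt, by
    rw [T_deriv]; exact sT_smooth⟩

lemma T_db : DB 1 T := by
  intro m hm
  obtain ⟨m, rfl⟩ : ∃ k, m = k + 1 := ⟨m - 1, by omega⟩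
  obtain ⟨C, hC⟩ := sT_db m (Nat.zero_le _)
  refine ⟨C, fun x => ?_⟩
  have := hC x
  rw [norm_iteratedFDeriv_eq_norm_iteratedDeriv] at this ⊢
  rwa [iteratedDeriv_succ', T_deriv]

lemma T_of_nonpos {t : ℝ} (ht : t ≤ 0) : T t = 0 := by
  unfold T
  rw [intervalIntegral.integral_congr (g := fun _ => (0:ℝ))]
  · simp
  · intro x hx
    rw [Set.uIcc_of_ge ht] at hx
    exact smoothTransition.zero_of_nonpos hx.2

lemma T_of_one_le {t : ℝ} (ht : 1 ≤ t) : T t = T 1 + (t - 1) := by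
  unfold T
  rw [← intervalIntegral.integral_add_adjacent_intervals (b := 1)
    (smoothTransition.continuous.intervalIntegrable _ _)
    (smoothTransition.continuous.intervalIntegrable _ _)]
  congr 1
  rw [intervalIntegral.integral_congr (g := fun _ => (1:ℝ))]
  · simp
  · intro x hx
    rw [Set.uIcc_of_le ht] at hx
    exact smoothTransition.one_of_one_le hx.1

/-- `0` for `s ≤ 1/5`, `1` for `s ≥ 2/5`. -/
noncomputable def phi (s : ℝ) : ℝ := smoothTransition (5 * s - 1)
noncomputable def phi' (s : ℝ) : ℝ := 5 * deriv smoothTransition (5 * s - 1)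

lemma phi_hasDerivAt (s : ℝ) : HasDerivAt phi (phi' s) s := by
  have h : HasDerivAt smoothTransition (deriv smoothTransition (5 * s - 1)) (5 * s - 1) :=
    (sT_smooth.differentiable (by simp) _).hasDerivAt
  have h2 : HasDerivAt (fun s : ℝ => 5 * s - 1) 5 s := by
    simpa using ((hasDerivAt_id s).const_mul 5).sub_const 1
  have := h.comp s h2
  rw [mul_comm] at this
  exact this

lemma phi_zero {s : ℝ} (h : s ≤ 1/5) : phi s = 0 :=
  smoothTransition.zero_of_nonpos (by linarith)
lemma phi_one {s : ℝ} (h : 2/5 ≤ s) : phi s = 1 :=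
  smoothTransition.one_of_one_le (by linarith)
lemma phi_nonneg (s : ℝ) : 0 ≤ phi s := smoothTransition.nonneg _
lemma phi_le_one (s : ℝ) : phi s ≤ 1 := smoothTransition.le_one _
lemma phi_pos {s : ℝ} (h : 1/5 < s) : 0 < phi s :=
  smoothTransition.pos_of_pos (by linarith)
lemma phi'_zero_left {s : ℝ} (h : s ≤ 1/5) : phi' s = 0 := by
  unfold phi'; rw [dsT_zero_of_le (by linarith), mul_zero]
lemma phi'_zero_right {s : ℝ} (h : 2/5 ≤ s) : phi' s = 0 := by
  unfold phi'; rw [dsT_zero_of_ge (by linarith), mul_zero]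
lemma phi_smooth : ContDiff ℝ (⊤ : ℕ∞) phi :=
  sT_smooth.comp ((contDiff_const.mul contDiff_id).sub contDiff_const)
lemma phi'_smooth : ContDiff ℝ (⊤ : ℕ∞) phi' :=
  contDiff_const.mul (dsT_smooth.comp ((contDiff_const.mul contDiff_id).sub contDiff_const))
lemma phi_db : DB 0 phi := db_of_const_outside phi_smooth 0 1 0 1
  (fun _ hx => phi_zero (by linarith)) (fun _ hx => phi_one (by linarith))
lemma phi'_db : DB 0 phi' := db_of_const_outside phi'_smooth 0 1 0 0
  (fun _ hx => phi'_zero_left (by linarith)) (fun _ hx => phi'_zero_right (by linarith))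

/-- Bump equal to `1` on `[1/5,4/5]`, supported in `[0,1]`. -/
noncomputable def chi (s : ℝ) : ℝ := smoothTransition (5 * s) - smoothTransition (5 * s - 4)
/-- Antiderivative of `chi`. -/
noncomputable def XX (s : ℝ) : ℝ := (T (5 * s) - T (5 * s - 4)) / 5

lemma chi_smooth : ContDiff ℝ (⊤ : ℕ∞) chi :=
  (sT_smooth.comp (contDiff_const.mul contDiff_id)).sub
    (sT_smooth.comp ((contDiff_const.mul contDiff_id).sub contDiff_const))
lemma XX_smooth : ContDiff ℝ (⊤ : ℕ∞) XX :=
  ((T_smooth.comp (contDiff_const.mul contDiff_id)).sub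
    (T_smooth.comp ((contDiff_const.mul contDiff_id).sub contDiff_const))).div_const _
lemma XX_hasDerivAt (s : ℝ) : HasDerivAt XX (chi s) s := by
  have h2 : HasDerivAt (fun s : ℝ => 5 * s - 4) 5 s := by
    simpa using ((hasDerivAt_id s).const_mul 5).sub_const 4
  have h1 : HasDerivAt (fun s : ℝ => 5 * s) 5 s := by
    simpa using ((hasDerivAt_id s).const_mul 5)
  have := (((T_hasDerivAt (5*s)).comp s h1).sub ((T_hasDerivAt (5*s-4)).comp s h2)).div_const 5
  have h3 : chi s = (smoothTransition (5 * s) * 5 - smoothTransition (5 * s - 4) * 5) / 5 := by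
    unfold chi; ring
  rw [h3]
  exact this
lemma chi_zero_left {s : ℝ} (h : s ≤ 0) : chi s = 0 := by
  unfold chi
  rw [smoothTransition.zero_of_nonpos (by linarith), smoothTransition.zero_of_nonpos (by linarith)]
  ring
lemma chi_zero_right {s : ℝ} (h : 1 ≤ s) : chi s = 0 := by
  unfold chi
  rw [smoothTransition.one_of_one_le (by linarith), smoothTransition.one_of_one_le (by linarith)]
  ring
lemma chi_one {s : ℝ} (h : 1/5 ≤ s) (h' : s ≤ 4/5) : chi s = 1 := by
  unfold chi
  rw [smoothTransition.one_of_one_le (by linarith), smoothTransition.zero_of_nonpos (by linarith)]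
  ring
lemma chi_nonneg (s : ℝ) : 0 ≤ chi s := by
  rcases le_total s (1/5) with h | h
  · unfold chi
    rw [smoothTransition.zero_of_nonpos (x := 5 * s - 4) (by linarith)]
    simpa using smoothTransition.nonneg _
  · unfold chi
    rw [smoothTransition.one_of_one_le (x := 5 * s) (by linarith)]
    linarith [smoothTransition.le_one (5 * s - 4)]
lemma chi_le_one (s : ℝ) : chi s ≤ 1 := by
  unfold chi
  linarith [smoothTransition.le_one (5 * s), smoothTransition.nonneg (5 * s - 4)]
lemma chi_db : DB 0 chi := db_of_const_outside chi_smooth 0 1 0 0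
  (fun _ hx => chi_zero_left hx.le) (fun _ hx => chi_zero_right hx.le)
lemma XX_zero {s : ℝ} (h : s ≤ 0) : XX s = 0 := by
  unfold XX
  rw [T_of_nonpos (by linarith), T_of_nonpos (by linarith)]; ring
lemma XX_right {s : ℝ} (h : 1 ≤ s) : XX s = 4 / 5 := by
  unfold XX
  rw [T_of_one_le (by linarith), T_of_one_le (t := 5 * s - 4) (by linarith)]; ring
lemma XX_mid {s : ℝ} (h : 1/5 ≤ s) (h' : s ≤ 4/5) : XX s = XX (1/2) + (s - 1/2) := by
  unfold XX
  rw [T_of_one_le (t := 5 * s) (by linarith), T_of_nonpos (t := 5 * s - 4) (by linarith),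
    T_of_one_le (t := 5 * (1/2)) (by norm_num), T_of_nonpos (t := 5 * (1/2) - 4) (by norm_num)]
  ring
lemma XX_db : DB 0 XX := db_of_const_outside XX_smooth 0 1 0 (4/5)
  (fun _ hx => XX_zero hx.le) (fun _ hx => XX_right hx.le)

lemma dchi_zero_left {x : ℝ} (hx : x ≤ 0) : deriv chi x = 0 := by
  have h : HasDerivAt chi (deriv chi x) x :=
    (chi_smooth.differentiable (by simp) x).hasDerivAt
  have h2 : HasDerivWithinAt chi 0 (Set.Iic x) x := by
    refine (hasDerivWithinAt_const x (Set.Iic x) (0:ℝ)).congr ?_ ?_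
    · intro y hy; exact chi_zero_left (le_trans hy hx)
    · exact chi_zero_left hx
  exact (uniqueDiffWithinAt_Iic x).eq_deriv _ h.hasDerivWithinAt h2
lemma dchi_zero_right {x : ℝ} (hx : 1 ≤ x) : deriv chi x = 0 := by
  have h : HasDerivAt chi (deriv chi x) x :=
    (chi_smooth.differentiable (by simp) x).hasDerivAt
  have h2 : HasDerivWithinAt chi 0 (Set.Ici x) x := by
    refine (hasDerivWithinAt_const x (Set.Ici x) (0:ℝ)).congr ?_ ?_
    · intro y hy; exact chi_zero_right (le_trans hx hy)
    · exact chi_zero_right hx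
  exact (uniqueDiffWithinAt_Ici x).eq_deriv _ h.hasDerivWithinAt h2
lemma dchi_bound : ∃ C : ℝ, 1 ≤ C ∧ ∀ x, |deriv chi x| ≤ C := by
  obtain ⟨C, hC⟩ := chi_db 1 (Nat.zero_le _)
  refine ⟨max 1 C, le_max_left _ _, fun x => ?_⟩
  have := hC x
  rw [norm_iteratedFDeriv_eq_norm_iteratedDeriv, iteratedDeriv_one] at this
  exact this.trans (le_max_right _ _)

/-- A smooth bump on the line. -/
noncomputable def beta : ContDiffBump (0:ℝ) := ⟨1/2, 3/4, by norm_num, by norm_num⟩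

/-- Globally smooth function equal to `1/(1+z)` for `|z| ≤ 1/2`. -/
noncomputable def w (z : ℝ) : ℝ := 1 / (1 + z * beta z)

lemma w_den_pos (z : ℝ) : 0 < 1 + z * beta z := by
  by_cases h : |z| < 3/4
  · have h1 := abs_lt.1 h
    have h2 : 0 ≤ beta z := beta.nonneg
    have h3 : beta z ≤ 1 := beta.le_one
    rcases le_total 0 z with hz | hz
    · positivity
    · nlinarith
  · have : beta z = 0 := beta.zero_of_le_dist (by
      rw [Real.dist_eq, sub_zero]; exact not_lt.1 h)
    rw [this]; norm_num

lemma w_eq {z : ℝ} (h : |z| ≤ 1/2) : w z = 1 / (1 + z) := by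
  have : beta z = 1 := beta.one_of_mem_closedBall (by
    rw [Metric.mem_closedBall, Real.dist_eq, sub_zero]; exact h)
  unfold w; rw [this, mul_one]

lemma w_smooth : ContDiff ℝ (⊤ : ℕ∞) w :=
  contDiff_const.div (contDiff_const.add (contDiff_id.mul beta.contDiff))
    (fun z => (w_den_pos z).ne')

lemma w_out {z : ℝ} (h : 3/4 ≤ |z|) : w z = 1 := by
  have : beta z = 0 := beta.zero_of_le_dist (by
      rw [Real.dist_eq, sub_zero]; exact h)
  unfold w; rw [this]; norm_num

lemma w_db : DB 0 w := db_of_const_outside w_smooth (-1) 1 1 1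
  (fun x hx => w_out (by rw [abs_of_neg (by linarith)]; linarith))
  (fun x hx => w_out (by rw [abs_of_pos (by linarith)]; linarith))

lemma cos_db : DB 0 cos := by
  intro m _
  refine ⟨1, fun x => ?_⟩
  rw [norm_iteratedFDeriv_eq_norm_iteratedDeriv]
  exact Real.abs_iteratedDeriv_cos_le_one m x
lemma sin_db : DB 0 sin := by
  intro m _
  refine ⟨1, fun x => ?_⟩
  rw [norm_iteratedFDeriv_eq_norm_iteratedDeriv]
  exact Real.abs_iteratedDeriv_sin_le_one m x

end BP
end

section
namespace BP

open Real Filter Topology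

/-! ### Families of functions with weighted polynomial bounds on derivatives -/

/-- Space-time. -/
abbrev E3 : Type := ℝ × ℝ × ℝ

/-- `F k` is smooth, and all derivatives of order at least `m₀` are bounded on `S k` by a
polynomial in `k` times the weight `W k`. -/
structure Bd (m₀ : ℕ) (S : ℕ → Set E3) (W : ℕ → ℝ) (F : ℕ → E3 → ℝ) : Prop where
  smooth : ∀ k, ContDiff ℝ (⊤ : ℕ∞) (F k)
  bd : ∀ m, m₀ ≤ m → ∃ (C : ℝ) (N : ℕ), 0 ≤ C ∧ ∀ k, ∀ p ∈ S k,
    ‖iteratedFDeriv ℝ m (F k) p‖ ≤ C * ((k:ℝ) + 1) ^ N * W k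

lemma pow_mono_k (k : ℕ) {N M : ℕ} (h : N ≤ M) : ((k:ℝ) + 1) ^ N ≤ ((k:ℝ) + 1) ^ M :=
  pow_le_pow_right₀ (by linarith [Nat.cast_nonneg (α := ℝ) k]) h

lemma one_le_pow_k (k : ℕ) (N : ℕ) : 1 ≤ ((k:ℝ) + 1) ^ N :=
  one_le_pow₀ (by linarith [Nat.cast_nonneg (α := ℝ) k])

lemma Bd.mono {m₀ m₁ : ℕ} (h : m₀ ≤ m₁) {S W F} (hF : Bd m₀ S W F) : Bd m₁ S W F :=
  ⟨hF.smooth, fun m hm => hF.bd m (h.trans hm)⟩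

lemma Bd.weaken {m₀ : ℕ} {S W W' F} (hF : Bd m₀ S W F) (h : ∀ k, W k ≤ W' k) :
    Bd m₀ S W' F := by
  refine ⟨hF.smooth, fun m hm => ?_⟩
  obtain ⟨C, N, hC, h1⟩ := hF.bd m hm
  refine ⟨C, N, hC, fun k p hp => (h1 k p hp).trans ?_⟩
  have := h k
  gcongr

lemma Bd.add {m₀ : ℕ} {S W F G} (hW : ∀ k, 0 ≤ W k) (hF : Bd m₀ S W F) (hG : Bd m₀ S W G) :
    Bd m₀ S W (fun k p => F k p + G k p) := by
  refine ⟨fun k => (hF.smooth k).add (hG.smooth k), fun m hm => ?_⟩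
  obtain ⟨C, N, hC, h1⟩ := hF.bd m hm
  obtain ⟨C', N', hC', h2⟩ := hG.bd m hm
  refine ⟨C + C', max N N', by positivity, fun k p hp => ?_⟩
  have e : iteratedFDeriv ℝ m (fun p => F k p + G k p) p
      = iteratedFDeriv ℝ m (F k) p + iteratedFDeriv ℝ m (G k) p :=
    iteratedFDeriv_add_apply ((hF.smooth k).of_le (by exact_mod_cast le_top)).contDiffAt
      ((hG.smooth k).of_le (by exact_mod_cast le_top)).contDiffAt
  rw [e]
  refine (norm_add_le _ _).trans ((add_le_add (h1 k p hp) (h2 k p hp)).trans ?_)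
  have a1 := pow_mono_k k (le_max_left N N')
  have a2 := pow_mono_k k (le_max_right N N')
  have a3 := hW k
  calc _ ≤ C * ((k:ℝ) + 1) ^ (max N N') * W k + C' * ((k:ℝ) + 1) ^ (max N N') * W k := by gcongr
    _ = _ := by ring

lemma Bd.mul {S W V F G} (hW : ∀ k, 0 ≤ W k) (hV : ∀ k, 0 ≤ V k)
    (hF : Bd 0 S W F) (hG : Bd 0 S V G) :
    Bd 0 S (fun k => W k * V k) (fun k p => F k p * G k p) := by
  refine ⟨fun k => (hF.smooth k).mul (hG.smooth k), fun m _ => ?_⟩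
  choose C N hC h1 using fun m => hF.bd m (Nat.zero_le m)
  choose C' N' hC' h2 using fun m => hG.bd m (Nat.zero_le m)
  refine ⟨∑ i ∈ Finset.range (m + 1), (m.choose i) * C i * C' (m - i),
    ∑ i ∈ Finset.range (m + 1), (N i + N' (m - i)),
    Finset.sum_nonneg fun i _ => by have := hC i; have := hC' (m-i); positivity,
    fun k p hp => ?_⟩
  refine (norm_iteratedFDeriv_mul_le (hF.smooth k) (hG.smooth k) p
    (by exact_mod_cast le_top)).trans ?_
  rw [Finset.sum_mul, Finset.sum_mul]
  refine Finset.sum_le_sum fun i hi => ?_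
  have a1 := h1 i k p hp
  have a2 := h2 (m - i) k p hp
  have a3 : N i + N' (m - i) ≤ ∑ i ∈ Finset.range (m + 1), (N i + N' (m - i)) :=
    Finset.single_le_sum (f := fun i => N i + N' (m - i)) (fun _ _ => Nat.zero_le _) hi
  have a4 := pow_mono_k k a3
  have := hC i; have := hC' (m-i); have := hW k; have := hV k
  calc _ ≤ (m.choose i) * (C i * ((k:ℝ) + 1) ^ (N i) * W k)
        * (C' (m - i) * ((k:ℝ) + 1) ^ (N' (m - i)) * V k) := by gcongr
    _ = (m.choose i) * C i * C' (m - i) * ((k:ℝ) + 1) ^ (N i + N' (m - i)) * (W k * V k) := by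
      rw [pow_add]; ring
    _ ≤ _ := by gcongr

/-- Product where the second factor is tempered. -/
lemma Bd.mul_one {S W F G} (hW : ∀ k, 0 ≤ W k)
    (hF : Bd 0 S W F) (hG : Bd 0 S (fun _ => 1) G) :
    Bd 0 S W (fun k p => F k p * G k p) := by
  have := hF.mul hW (fun _ => zero_le_one) hG
  simpa using this

lemma Bd.const_mul {m₀ : ℕ} {S W F} (hW : ∀ k, 0 ≤ W k) (hF : Bd m₀ S W F) (c : ℕ → ℝ)
    (A : ℝ) (M : ℕ) (hc : ∀ k, |c k| ≤ A * ((k:ℝ) + 1) ^ M) :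
    Bd m₀ S W (fun k p => c k * F k p) := by
  have hA : 0 ≤ A := by
    have := (abs_nonneg _).trans (hc 0)
    simpa using this
  refine ⟨fun k => contDiff_const.mul (hF.smooth k), fun m hm => ?_⟩
  obtain ⟨C, N, hC, h1⟩ := hF.bd m hm
  refine ⟨A * C, M + N, by positivity, fun k p hp => ?_⟩
  have e : iteratedFDeriv ℝ m (fun p => c k * F k p) p = c k • iteratedFDeriv ℝ m (F k) p :=
by
    change iteratedFDeriv ℝ m (c k • F k) p = _
    exact iteratedFDeriv_const_smul_apply
      ((hF.smooth k).of_le (by exact_mod_cast le_top)).contDiffAt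
  rw [e, norm_smul, Real.norm_eq_abs]
  have := hW k
  calc _ ≤ (A * ((k:ℝ) + 1) ^ M) * (C * ((k:ℝ) + 1) ^ N * W k) :=
        mul_le_mul (hc k) (h1 k p hp) (norm_nonneg _) (by positivity)
    _ = _ := by rw [pow_add]; ring

lemma Bd.add_const {S W F} (hF : Bd 1 S W F) (c : ℕ → ℝ) :
    Bd 1 S W (fun k p => F k p + c k) := by
  refine ⟨fun k => (hF.smooth k).add contDiff_const, fun m hm => ?_⟩
  obtain ⟨C, N, hC, h1⟩ := hF.bd m hm
  refine ⟨C, N, hC, fun k p hp => ?_⟩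
  have e : iteratedFDeriv ℝ m (fun p => F k p + c k) p
      = iteratedFDeriv ℝ m (F k) p + iteratedFDeriv ℝ m (fun _ => c k) p :=
    iteratedFDeriv_add_apply ((hF.smooth k).of_le (by exact_mod_cast le_top)).contDiffAt
      contDiffAt_const
  rw [e, iteratedFDeriv_const_of_ne (by omega)]
  simpa using h1 k p hp

lemma Bd.affine (S : ℕ → Set E3) (L : ℕ → E3 →L[ℝ] ℝ) (hL : ∀ k, ‖L k‖ ≤ 1) (c e : ℕ → ℝ)
    (A : ℝ) (M : ℕ) (hc : ∀ k, |c k| ≤ A * ((k:ℝ) + 1) ^ M) :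
    Bd 1 S (fun _ => 1) (fun k p => c k * L k p + e k) := by
  apply Bd.add_const
  refine Bd.const_mul (fun _ => zero_le_one) ?_ c A M hc
  refine ⟨fun k => (L k).contDiff, fun m hm => ⟨1, 0, zero_le_one, fun k p _ => ?_⟩⟩
  obtain ⟨m, rfl⟩ : ∃ k, m = k + 1 := ⟨m - 1, by omega⟩
  rw [← norm_iteratedFDeriv_fderiv]
  have : fderiv ℝ (fun p => (L k) p) = fun _ => L k := by ext1 p; exact (L k).fderiv
  rw [this]
  rcases Nat.eq_zero_or_pos m with rfl | hm
  · simpa using hL k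
  · rw [iteratedFDeriv_const_of_ne hm.ne']; simp

lemma Bd.comp {S V F} (hV : ∀ k, 0 ≤ V k) (hF : Bd 1 S (fun _ => 1) F) {g : ℝ → ℝ}
    (hg : ContDiff ℝ (⊤ : ℕ∞) g)
    (hb : ∀ m, 1 ≤ m → ∃ C, ∀ k, ∀ p ∈ S k, ‖iteratedFDeriv ℝ m g (F k p)‖ ≤ C * V k) :
    Bd 1 S V (fun k p => g (F k p)) := by
  refine ⟨fun k => hg.comp (hF.smooth k), fun m hm => ?_⟩
  choose! C hC using hb
  choose! A N hA hN using hF.bd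
  -- uniform constants
  set CC := ∑ i ∈ Finset.range (m + 1), |C i| with hCC
  set AA := 1 + ∑ i ∈ Finset.range (m + 1), |A i| with hAA
  set NN := ∑ i ∈ Finset.range (m + 1), N i with hNN
  have hCC0 : 0 ≤ CC := Finset.sum_nonneg fun _ _ => abs_nonneg _
  have hAA1 : 1 ≤ AA := by
    have : 0 ≤ ∑ i ∈ Finset.range (m + 1), |A i| := Finset.sum_nonneg fun _ _ => abs_nonneg _
    linarith
  refine ⟨m.factorial * CC * AA ^ m, NN * m, by positivity, fun k p hp => ?_⟩
  set G : ℝ → ℝ := fun y => g y - g (F k p) with hG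
  have hGs : ContDiff ℝ (⊤ : ℕ∞) G := hg.sub contDiff_const
  have hsub : (fun p' => g (F k p')) = fun p' => (G ∘ F k) p' + g (F k p) := by
    ext p'; simp [hG]
  have e : iteratedFDeriv ℝ m (fun p' => g (F k p')) p = iteratedFDeriv ℝ m (G ∘ F k) p := by
    rw [hsub]
    have e : iteratedFDeriv ℝ m (fun p' => (G ∘ F k) p' + g (F k p)) p
        = iteratedFDeriv ℝ m (G ∘ F k) p + iteratedFDeriv ℝ m (fun _ => g (F k p)) p :=
      iteratedFDeriv_add_apply
        ((hGs.comp (hF.smooth k)).of_le (by exact_mod_cast le_top)).contDiffAt contDiffAt_const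
    rw [e, iteratedFDeriv_const_of_ne (by omega)]
    simp
  rw [e]
  have hVk := hV k
  have := norm_iteratedFDeriv_comp_le (n := m) hGs (hF.smooth k) (by exact_mod_cast le_top) p
    (C := CC * V k) (D := AA * ((k:ℝ) + 1) ^ NN) ?_ ?_
  · refine this.trans (le_of_eq ?_)
    rw [mul_pow, ← pow_mul]; ring
  · intro i hi
    rcases Nat.eq_zero_or_pos i with rfl | hi0
    · simp [hG]; positivity
    · have e2 : iteratedFDeriv ℝ i G (F k p) = iteratedFDeriv ℝ i g (F k p) := by
        have : G = fun y => g y + (- g (F k p)) := by ext y; simp [hG]; ring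
        rw [this]
        have e : iteratedFDeriv ℝ i (fun y => g y + (- g (F k p))) (F k p)
            = iteratedFDeriv ℝ i g (F k p) + iteratedFDeriv ℝ i (fun _ => - g (F k p)) (F k p) :=
          iteratedFDeriv_add_apply
            (hg.of_le (by exact_mod_cast le_top)).contDiffAt contDiffAt_const
        rw [e, iteratedFDeriv_const_of_ne (by omega)]
        simp
      rw [e2]
      refine (hC i hi0 k p hp).trans ?_
      have : C i ≤ CC := (le_abs_self _).trans
        (Finset.single_le_sum (f := fun i => |C i|) (fun _ _ => abs_nonneg _)
          (Finset.mem_range.2 (by omega)))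
      gcongr
  · intro i hi0 hi
    have h1 := hN i hi0 k p hp
    have h2 : A i ≤ AA := by
      have := (Finset.single_le_sum (f := fun i => |A i|) (fun _ _ => abs_nonneg _)
          (Finset.mem_range.2 (by omega : i < m + 1)))
      have := le_abs_self (A i)
      linarith
    have h3 : N i ≤ NN := (Finset.single_le_sum (f := N) (fun _ _ => Nat.zero_le _)
          (Finset.mem_range.2 (by omega : i < m + 1)))
    have h4 := pow_mono_k k h3
    have h5 : 1 ≤ AA * ((k:ℝ) + 1) ^ NN := by
      have := one_le_pow_k k NN
      nlinarith
    calc _ ≤ _ := h1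
      _ ≤ AA * ((k:ℝ) + 1) ^ NN := by rw [_root_.mul_one]; gcongr
      _ ≤ _ := le_self_pow₀ h5 (by omega)

lemma Bd.zero {S W F} (hF : Bd 1 S W F)
    (h : ∃ (C : ℝ) (N : ℕ), 0 ≤ C ∧ ∀ k, ∀ p ∈ S k, |F k p| ≤ C * ((k:ℝ) + 1) ^ N * W k) :
    Bd 0 S W F := by
  refine ⟨hF.smooth, fun m _ => ?_⟩
  rcases Nat.eq_zero_or_pos m with rfl | hm
  · simpa using h
  · exact hF.bd m hm

lemma Bd.comp_db1 {S F} (hF : Bd 1 S (fun _ => 1) F) {g : ℝ → ℝ}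
    (hg : ContDiff ℝ (⊤ : ℕ∞) g) (hb : DB 1 g) : Bd 1 S (fun _ => 1) (fun k p => g (F k p)) := by
  refine hF.comp (fun _ => zero_le_one) hg fun m hm => ?_
  obtain ⟨C, hC⟩ := hb m hm
  exact ⟨C, fun k p _ => by simpa using hC _⟩

lemma Bd.comp_db {S F} (hF : Bd 1 S (fun _ => 1) F) {g : ℝ → ℝ}
    (hg : ContDiff ℝ (⊤ : ℕ∞) g) (hb : DB 0 g) : Bd 0 S (fun _ => 1) (fun k p => g (F k p)) := by
  refine (hF.comp_db1 hg fun m _ => hb m (Nat.zero_le _)).zero ?_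
  obtain ⟨C, hC⟩ := hb 0 le_rfl
  refine ⟨max C 0, 0, le_max_right _ _, fun k p _ => ?_⟩
  have := hC (F k p)
  simp only [norm_iteratedFDeriv_zero, Real.norm_eq_abs] at this
  simpa using Or.inl this

lemma Bd.exp {S V F} (hV : ∀ k, 0 ≤ V k) (hF : Bd 1 S (fun _ => 1) F) (B : ℝ)
    (hb : ∀ k, ∀ p ∈ S k, Real.exp (F k p) ≤ B * V k) :
    Bd 0 S V (fun k p => Real.exp (F k p)) := by
  refine (hF.comp hV Real.contDiff_exp fun m _ => ⟨B, fun k p hp => ?_⟩).zero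
    ⟨max B 0, 0, le_max_right _ _, fun k p hp => ?_⟩
  · rw [norm_iteratedFDeriv_eq_norm_iteratedDeriv, iteratedDeriv_eq_iterate, Real.iter_deriv_exp,
      Real.norm_eq_abs, abs_of_pos (Real.exp_pos _)]
    exact hb k p hp
  · rw [abs_of_pos (Real.exp_pos _), pow_zero, _root_.mul_one]
    exact (hb k p hp).trans (mul_le_mul_of_nonneg_right (le_max_left _ _) (hV k))

/-- The weight `exp (-k)`. -/
noncomputable def We (k : ℕ) : ℝ := Real.exp (-(k:ℝ))

lemma We_nonneg (k : ℕ) : 0 ≤ We k := (Real.exp_pos _).le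
lemma We_le_one (k : ℕ) : We k ≤ 1 := Real.exp_le_one_iff.2 (by simp)

lemma summable_We (N : ℕ) : Summable (fun k : ℕ => ((k:ℝ) + 1) ^ N * We k) := by
  have h := Real.summable_pow_mul_exp_neg_nat_mul N (r := 1) one_pos
  have h2 := (summable_nat_add_iff 1).2 h
  refine (h2.mul_left (Real.exp 1)).congr fun k => ?_
  unfold We
  push_cast
  rw [mul_left_comm, ← Real.exp_add]
  congr 2
  ring

theorem Bd.bound_global {S F} (hS : ∀ k, IsClosed (S k)) (hF : Bd 0 S We F)
    (hz : ∀ k p, p ∉ S k → F k p = 0) (m : ℕ) :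
    ∃ v : ℕ → ℝ, Summable v ∧ ∀ k p, ‖iteratedFDeriv ℝ m (F k) p‖ ≤ v k := by
  obtain ⟨C, N, hC, h⟩ := hF.bd m (Nat.zero_le _)
  refine ⟨fun k => C * (((k:ℝ) + 1) ^ N * We k), (summable_We N).mul_left C, fun k p => ?_⟩
  by_cases hp : p ∈ S k
  · simpa only [mul_assoc] using h k p hp
  · have h2 : F k =ᶠ[𝓝 p] fun _ => (0:ℝ) := by
      filter_upwards [(hS k).isOpen_compl.mem_nhds hp] with y hy using hz k y hy
    rw [(h2.iteratedFDeriv ℝ m).eq_of_nhds]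
    have : iteratedFDeriv ℝ m (fun _ : E3 => (0:ℝ)) p = 0 := by simp
    rw [this, norm_zero]
    have := We_nonneg k
    positivity

/-- Bundled form of `CinftyB`. -/
def CB (f : E3 → ℝ) : Prop :=
  ContDiff ℝ (⊤ : ℕ∞) f ∧ ∀ k : ℕ, ∃ M : ℝ, ∀ p, ‖iteratedFDeriv ℝ k f p‖ ≤ M

theorem Bd.tsum_CB {S F} (hS : ∀ k, IsClosed (S k)) (hF : Bd 0 S We F)
    (hz : ∀ k p, p ∉ S k → F k p = 0) : CB (fun p => ∑' k, F k p) := by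
  choose v hv hvb using fun m => hF.bound_global hS hz m
  refine ⟨contDiff_tsum hF.smooth (fun m _ => hv m) (fun m k p _ => hvb m k p), fun m => ?_⟩
  refine ⟨∑' k, v m k, fun p => ?_⟩
  rw [iteratedFDeriv_tsum (N := (⊤ : ℕ∞)) hF.smooth (fun m _ => hv m)
    (fun m k p _ => hvb m k p) le_top]
  exact tsum_of_norm_bounded (hv m).hasSum (fun k => hvb m k p)

lemma CB.add {f g : E3 → ℝ} (hf : CB f) (hg : CB g) : CB (fun p => f p + g p) := by
  refine ⟨hf.1.add hg.1, fun k => ?_⟩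
  obtain ⟨A, hA⟩ := hf.2 k
  obtain ⟨B, hB⟩ := hg.2 k
  refine ⟨A + B, fun p => ?_⟩
  have e : iteratedFDeriv ℝ k (fun p => f p + g p) p
      = iteratedFDeriv ℝ k f p + iteratedFDeriv ℝ k g p :=
    iteratedFDeriv_add_apply (hf.1.of_le (by exact_mod_cast le_top)).contDiffAt
      (hg.1.of_le (by exact_mod_cast le_top)).contDiffAt
  rw [e]
  exact (norm_add_le _ _).trans (add_le_add (hA p) (hB p))

/-- A smooth function of time with bounded derivatives. -/
lemma CB.of_time {g : ℝ → ℝ} (hg : ContDiff ℝ (⊤ : ℕ∞) g) (hb : DB 0 g) (c : ℝ) :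
    CB (fun p => g (p.1 - c)) := by
  have h := (Bd.affine (fun _ => Set.univ) (fun _ => ContinuousLinearMap.fst ℝ ℝ (ℝ × ℝ))
    (fun _ => ContinuousLinearMap.norm_fst_le ..) (fun _ => 1) (fun _ => -c) 1 0
    (by simp)).comp_db hg hb
  refine ⟨by simpa [sub_eq_add_neg] using h.smooth 0, fun m => ?_⟩
  obtain ⟨C, N, _, hC⟩ := h.bd m (Nat.zero_le _)
  exact ⟨C, fun p => by simpa [sub_eq_add_neg] using hC 0 p trivial⟩

lemma CB.const_mul {f : E3 → ℝ} (hf : CB f) (c : ℝ) : CB (fun p => c * f p) := by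
  refine ⟨contDiff_const.mul hf.1, fun k => ?_⟩
  obtain ⟨A, hA⟩ := hf.2 k
  refine ⟨|c| * A, fun p => ?_⟩
  have e : iteratedFDeriv ℝ k (fun p => c * f p) p = c • iteratedFDeriv ℝ k f p :=
by
    change iteratedFDeriv ℝ k (c • f) p = _
    exact iteratedFDeriv_const_smul_apply (hf.1.of_le (by exact_mod_cast le_top)).contDiffAt
  rw [e, norm_smul, Real.norm_eq_abs]
  exact mul_le_mul_of_nonneg_left (hA p) (abs_nonneg _)

end BP
end

section
namespace BP

open Real Filter Topology

/-! ### The sequences -/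

noncomputable def ga (k : ℕ) : ℝ := sqrt (log ((k:ℝ) + 100))
noncomputable def a (k : ℕ) : ℝ := exp (-ga k)
noncomputable def q : ℕ → ℝ
  | 0 => 0
  | (k+1) => 1 / (a k - a (k+1))
noncomputable def n (k : ℕ) : ℝ := ((k:ℝ) + 100) ^ 3
noncomputable def d (k : ℕ) : ℝ := (-1) ^ k * (14 / ((k:ℝ) + 100))
noncomputable def s (k : ℕ) (t : ℝ) : ℝ := q k * (t - a k)
noncomputable def par (k : ℕ) : ℝ := if Even k then 0 else 1
noncomputable def kappa (k : ℕ) : ℝ :=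
  (n k) ^ 2 * (1 + par k * d (k+1)) - (n (k+1)) ^ 2 * (1 + par (k+1) * d (k+1))
noncomputable def Lam (k : ℕ) : ℝ := kappa k * (a k - a (k+1))

lemma ga_sq (k : ℕ) : ga k ^ 2 = log ((k:ℝ) + 100) := by
  unfold ga
  exact sq_sqrt (log_nonneg (by have := Nat.cast_nonneg (α := ℝ) k; linarith))

lemma exp_ga_sq (k : ℕ) : exp (ga k ^ 2) = (k:ℝ) + 100 := by
  rw [ga_sq, exp_log (by positivity)]

lemma ga_ge_one (k : ℕ) : 1 ≤ ga k := by
  unfold ga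
  rw [one_le_sqrt, le_log_iff_exp_le (by positivity)]
  have := exp_one_lt_d9
  have := Nat.cast_nonneg (α := ℝ) k
  linarith

lemma ga_lt (k : ℕ) : ga k < ga (k+1) := by
  unfold ga
  refine sqrt_lt_sqrt (log_nonneg (by have := Nat.cast_nonneg (α := ℝ) k; linarith)) ?_
  apply log_lt_log (by positivity)
  push_cast; linarith

lemma log_diff (k : ℕ) : 1 / ((k:ℝ) + 101) ≤ ga (k+1) ^ 2 - ga k ^ 2 := by
  rw [ga_sq, ga_sq, ← log_div (by positivity) (by positivity)]
  have h := one_sub_inv_le_log_of_pos (x := (((k+1:ℕ):ℝ) + 100) / ((k:ℝ) + 100)) (by positivity)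
  refine le_trans (le_of_eq ?_) h
  push_cast
  field_simp
  ring

lemma log_diff' (k : ℕ) : ga (k+1) ^ 2 - ga k ^ 2 ≤ 1 := by
  rw [ga_sq, ga_sq, ← log_div (by positivity) (by positivity)]
  have h := log_le_sub_one_of_pos (x := (((k+1:ℕ):ℝ) + 100) / ((k:ℝ) + 100)) (by positivity)
  refine h.trans ?_
  rw [sub_le_iff_le_add, div_le_iff₀ (by positivity)]
  push_cast
  have := Nat.cast_nonneg (α := ℝ) k
  linarith

lemma ga_diff' (k : ℕ) : ga (k+1) - ga k ≤ 1 := by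
  have h := log_diff' k
  have h1 := ga_ge_one k
  have h2 := ga_lt k
  nlinarith

lemma ga_diff (k : ℕ) : 1 / (2 * ((k:ℝ) + 101) * ga (k+1)) ≤ ga (k+1) - ga k := by
  have h := log_diff k
  have h1 := ga_ge_one (k+1)
  have h2 := ga_lt k
  rw [show 2 * ((k:ℝ) + 101) * ga (k+1) = ((k:ℝ) + 101) * (2 * ga (k+1)) by ring,
    ← div_div, div_le_iff₀ (by positivity)]
  calc _ ≤ ga (k+1) ^ 2 - ga k ^ 2 := h
    _ ≤ _ := by nlinarith

lemma a_pos (k : ℕ) : 0 < a k := exp_pos _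
lemma a_lt (k : ℕ) : a (k+1) < a k := exp_lt_exp.2 (neg_lt_neg (ga_lt k))
lemma a_anti : StrictAnti a := strictAnti_nat_of_succ_lt a_lt
lemma a_le_one (k : ℕ) : a k ≤ 1 := exp_le_one_iff.2 (by linarith [ga_ge_one k])

lemma a_tendsto : Tendsto a atTop (𝓝 0) := by
  have h : Tendsto ga atTop atTop := by
    unfold ga
    exact tendsto_sqrt_atTop.comp (tendsto_log_atTop.comp
      (tendsto_atTop_add_const_right _ _ tendsto_natCast_atTop_atTop))
  exact tendsto_exp_neg_atTop_nhds_zero.comp h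

lemma tau_ge (k : ℕ) : a (k+1) / (2 * ((k:ℝ) + 101) * ga (k+1)) ≤ a k - a (k+1) := by
  have h := ga_diff k
  have e : a k = a (k+1) * exp (ga (k+1) - ga k) := by
    unfold a; rw [← exp_add]; congr 1; ring
  have h1 := add_one_le_exp (ga (k+1) - ga k)
  have h2 := a_pos (k+1)
  rw [e, div_eq_mul_one_div]
  nlinarith

lemma q_zero : q 0 = 0 := rfl
lemma q_succ (k : ℕ) : q (k+1) = 1 / (a k - a (k+1)) := rfl
lemma q_pos (k : ℕ) : 0 < q (k+1) := by
  rw [q_succ]; have := a_lt k; exact one_div_pos.2 (by linarith)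
lemma q_nonneg (k : ℕ) : 0 ≤ q k := by
  cases k with
  | zero => exact le_rfl
  | succ k => exact (q_pos k).le
lemma q_mul (k : ℕ) : q (k+1) * (a k - a (k+1)) = 1 := by
  rw [q_succ]; have := a_lt k; exact one_div_mul_cancel (by linarith)
lemma q_inv (k : ℕ) : (q (k+1))⁻¹ = a k - a (k+1) := by
  rw [q_succ]; simp

lemma q_le_ga (k : ℕ) : q (k+1) ≤ 2 * ((k:ℝ) + 101) * (ga (k+1) * exp (ga (k+1))) := by
  have h := tau_ge k
  have h1 := ga_ge_one (k+1)
  have h2 := a_pos (k+1)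
  rw [q_succ, div_le_iff₀ (by have := a_lt k; linarith)]
  rw [div_le_iff₀ (by positivity)] at h
  have e : exp (ga (k+1)) * a (k+1) = 1 := by unfold a; rw [← exp_add]; simp
  have h3 := mul_le_mul_of_nonneg_left h (exp_pos (ga (k+1))).le
  rw [e] at h3
  linarith

lemma ga_exp_le (k : ℕ) : ga k * exp (ga k) ≤ exp (2 * ga k) := by
  rw [two_mul, exp_add]
  have := add_one_le_exp (ga k)
  exact mul_le_mul_of_nonneg_right (by linarith) (exp_pos _).le

lemma q_le' (k : ℕ) : q (k+1) ≤ 6 * ((k:ℝ) + 101) ^ 2 := by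
  refine (q_le_ga k).trans ?_
  have h := ga_exp_le (k+1)
  have h1 : exp (2 * ga (k+1)) ≤ 3 * ((k:ℝ) + 101) := by
    have : exp (2 * ga (k+1)) ≤ exp (1 + ga (k+1) ^ 2) := exp_le_exp.2 (by
      nlinarith [sq_nonneg (ga (k+1) - 1)])
    rw [exp_add, exp_ga_sq] at this
    have h2 := exp_one_lt_d9
    push_cast at this
    nlinarith [Nat.cast_nonneg (α := ℝ) k]
  have h0 : (0:ℝ) ≤ 2 * ((k:ℝ) + 101) := by positivity
  have := mul_le_mul_of_nonneg_left (h.trans h1) h0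
  nlinarith

lemma tau_ge' (k : ℕ) : 1 / (6 * ((k:ℝ) + 101) ^ 2) ≤ a k - a (k+1) := by
  have h := q_le' k
  have h2 := q_mul k
  have := a_lt k
  rw [div_le_iff₀ (by positivity)]
  nlinarith

lemma q_le (k : ℕ) : |q k| ≤ 100000 * ((k:ℝ) + 1) ^ 2 := by
  rw [abs_of_nonneg (q_nonneg k)]
  cases k with
  | zero => rw [q_zero]; positivity
  | succ k =>
    refine (q_le' k).trans ?_
    push_cast
    nlinarith [Nat.cast_nonneg (α := ℝ) k]

lemma n_ge_one (k : ℕ) : 1 ≤ n k :=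
  one_le_pow₀ (by linarith [Nat.cast_nonneg (α := ℝ) k])
lemma n_pos (k : ℕ) : 0 < n k := lt_of_lt_of_le one_pos (n_ge_one k)

lemma cast_add_le (k : ℕ) : (k:ℝ) + 100 ≤ 100 * ((k:ℝ) + 1) := by
  linarith [Nat.cast_nonneg (α := ℝ) k]
lemma n_le (k : ℕ) : |n k| ≤ 100 ^ 3 * ((k:ℝ) + 1) ^ 3 := by
  rw [abs_of_pos (n_pos k), ← mul_pow]
  exact pow_le_pow_left₀ (by positivity) (cast_add_le k) 3
lemma n_succ_le (k : ℕ) : |n (k+1)| ≤ 200 ^ 3 * ((k:ℝ) + 1) ^ 3 := by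
  rw [abs_of_pos (n_pos _), ← mul_pow]
  refine pow_le_pow_left₀ (by positivity) ?_ 3
  push_cast
  linarith [Nat.cast_nonneg (α := ℝ) k]

lemma abs_d (k : ℕ) : |d k| = 14 / ((k:ℝ) + 100) := by
  unfold d
  rw [abs_mul, abs_pow, abs_neg, abs_one, one_pow, one_mul, abs_of_pos (by positivity)]
lemma d_le (k : ℕ) : |d k| ≤ 1 / 4 := by
  rw [abs_d, div_le_div_iff₀ (by positivity) (by norm_num)]
  linarith [Nat.cast_nonneg (α := ℝ) k]

lemma kappa_ge (k : ℕ) : ((k:ℝ) + 101) ^ 5 ≤ kappa k := by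
  have hk := Nat.cast_nonneg (α := ℝ) k
  obtain ⟨x, hx⟩ : ∃ x : ℝ, x = (k:ℝ) + 101 := ⟨_, rfl⟩
  have hx1 : 101 ≤ x := by linarith
  have e0 : n k = (x - 1) ^ 3 := by unfold n; rw [hx]; ring
  have e1 : n (k+1) = x ^ 3 := by unfold n; rw [hx]; push_cast; ring
  have key : x ^ 6 - 6 * x ^ 5 ≤ (x - 1) ^ 6 := by
    have : (x-1)^6 - (x ^ 6 - 6 * x ^ 5)
      = x^3 * (15 * x - 20) + x * (15 * x - 6) + 1 := by ring
    have h1 : 0 ≤ x^3 * (15 * x - 20) := mul_nonneg (by positivity) (by linarith)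
    have h2 : 0 ≤ x * (15 * x - 6) := mul_nonneg (by linarith) (by linarith)
    linarith
  unfold kappa
  rw [e0, e1, ← hx]
  rcases Nat.even_or_odd k with h | h
  · have p0 : par k = 0 := if_pos h
    have p1 : par (k+1) = 1 := if_neg (by simpa [Nat.even_add_one] using h)
    have dd : d (k+1) = - (14 / x) := by
      unfold d; rw [(h.add_one).neg_one_pow, hx]; push_cast; ring
    rw [p0, p1, dd]
    have : (x ^ 3) ^ 2 * (1 + 1 * -(14 / x)) = x ^ 6 - 14 * x ^ 5 := by
      field_simp
      ring
    rw [this]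
    have : 0 ≤ x ^ 5 := by positivity
    nlinarith
  · have p0 : par k = 1 := if_neg (by simpa using h)
    have p1 : par (k+1) = 0 := if_pos (h.add_one)
    have dd : d (k+1) = (14 / x) := by
      unfold d; rw [(h.add_one).neg_one_pow, hx]; push_cast; ring
    rw [p0, p1, dd]
    have h5 : 0 ≤ x ^ 5 := by positivity
    have half : x ^ 6 / 2 ≤ (x-1)^6 := by
      have : x ^ 6 = x * x ^ 5 := by ring
      nlinarith
    have : 7 * x ^ 5 ≤ ((x - 1) ^ 3) ^ 2 * (14 / x) := by
      rw [← pow_mul, mul_div_assoc', le_div_iff₀ (by linarith)]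
      norm_num
      linarith [show x ^ 5 * x = x ^ 6 by ring]
    have e : ((x - 1) ^ 3) ^ 2 = (x-1)^6 := by ring
    have e' : (x ^ 3) ^ 2 = x^6 := by ring
    rw [e] at this ⊢
    rw [e']
    nlinarith

lemma kappa_pos (k : ℕ) : 0 < kappa k := lt_of_lt_of_le (by positivity) (kappa_ge k)

lemma Lam_ge (k : ℕ) : 10 * ((k:ℝ) + 1) ≤ Lam k := by
  have h1 := kappa_ge k
  have h2 := tau_ge' k
  have hk := Nat.cast_nonneg (α := ℝ) k
  unfold Lam
  have h3 := mul_le_mul h1 h2 (by positivity) (kappa_pos k).le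
  refine le_trans ?_ h3
  rw [mul_one_div, le_div_iff₀ (by positivity)]
  have : (101:ℝ) ^ 2 ≤ ((k:ℝ) + 101) ^ 2 := pow_le_pow_left₀ (by norm_num) (by linarith) 2
  have h4 : 0 ≤ ((k:ℝ) + 101) ^ 2 := by positivity
  have e : ((k:ℝ) + 101) ^ 5 = ((k:ℝ) + 101) ^ 2 * (((k:ℝ) + 101) ^ 2 * ((k:ℝ) + 101)) := by ring
  rw [e, mul_comm, mul_assoc, mul_comm, mul_assoc]
  refine mul_le_mul_of_nonneg_left ?_ h4
  nlinarith

lemma Lam_pos (k : ℕ) : 0 < Lam k := lt_of_lt_of_le (by positivity) (Lam_ge k)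

lemma par_cases (k : ℕ) : par k = 0 ∨ par k = 1 := by
  unfold par; split_ifs <;> simp

lemma Lam_le (k : ℕ) : |Lam k| ≤ 2 * 100 ^ 6 * ((k:ℝ) + 1) ^ 6 := by
  rw [abs_of_pos (Lam_pos k)]
  have h1 : kappa k ≤ 2 * n k ^ 2 := by
    unfold kappa
    have h := abs_le.1 (d_le (k+1))
    have h2 : 0 ≤ (n k)^2 := by positivity
    have h3 : 0 ≤ (n (k+1))^2 := by positivity
    rcases par_cases k with e | e <;> rcases par_cases (k+1) with e' | e' <;> rw [e, e'] <;>
      nlinarith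
  have h2 : a k - a (k+1) ≤ 1 := by linarith [a_le_one k, a_pos (k+1)]
  have h3 : Lam k ≤ kappa k := by
    unfold Lam; have := kappa_pos k; nlinarith
  refine (h3.trans h1).trans ?_
  have h4 : n k ^ 2 ≤ (100 ^ 3 * ((k:ℝ) + 1) ^ 3) ^ 2 :=
    pow_le_pow_left₀ (n_pos k).le ((le_abs_self _).trans (n_le k)) 2
  calc _ ≤ 2 * (100 ^ 3 * ((k:ℝ) + 1) ^ 3) ^ 2 := by linarith
    _ = _ := by ring

lemma growth (k : ℕ) : 1 ≤ (n (k+1)) ^ 2 / 2 * (4 / 5 * (a k - a (k+1))) := by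
  have h := tau_ge' k
  have e1 : n (k+1) = ((k:ℝ) + 101) ^ 3 := by unfold n; push_cast; ring
  have hk := Nat.cast_nonneg (α := ℝ) k
  rw [e1]
  have : 1 ≤ (((k:ℝ) + 101) ^ 3) ^ 2 / 2 * (4 / 5 * (1 / (6 * ((k:ℝ) + 101) ^ 2))) := by
    have e : (((k:ℝ) + 101) ^ 3) ^ 2 / 2 * (4 / 5 * (1 / (6 * ((k:ℝ) + 101) ^ 2)))
      = ((k:ℝ) + 101) ^ 4 / 15 := by field_simp; ring
    rw [e]
    have : (101:ℝ) ^ 4 ≤ ((k:ℝ) + 101) ^ 4 := pow_le_pow_left₀ (by norm_num) (by linarith) 4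
    linarith
  refine this.trans ?_
  gcongr

lemma dq_ga (k : ℕ) : |d (k+1)| * q (k+1) ≤ 28 * (ga (k+1) * exp (ga (k+1))) := by
  have h := q_le_ga k
  have e : |d (k+1)| = 14 / ((k:ℝ) + 101) := by rw [abs_d]; push_cast; ring
  rw [e]
  calc _ ≤ 14 / ((k:ℝ) + 101) * (2 * ((k:ℝ) + 101) * (ga (k+1) * exp (ga (k+1)))) := by gcongr
    _ = _ := by field_simp; ring

lemma dq_eps (ε : ℝ) (hε : 0 < ε) : ∃ C : ℝ, 0 < C ∧ ∀ k,
    |d (k+1)| * q (k+1) ≤ C * (a k) ^ (-(1 + ε)) := by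
  refine ⟨28 / ε * exp (1 + ε), by positivity, fun k => (dq_ga k).trans ?_⟩
  have e : (a k) ^ (-(1+ε)) = exp (ga k * (1 + ε)) := by
    unfold a; rw [← exp_mul]; congr 1; ring
  rw [e]
  have h1 : ga (k+1) * ε ≤ exp (ga (k+1) * ε) := by linarith [add_one_le_exp (ga (k+1) * ε)]
  have h2 : exp (1 + ε) * exp (ga k * (1 + ε)) ≥ exp (ga (k+1) * ε) * exp (ga (k+1)) := by
    rw [← exp_add, ← exp_add]
    refine exp_le_exp.2 ?_
    have := ga_diff' k
    nlinarith
  have h3 : ga (k+1) ≤ exp (ga (k+1) * ε) / ε := by rwa [le_div_iff₀ hε]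
  calc _ ≤ 28 * (exp (ga (k+1) * ε) / ε * exp (ga (k+1))) := by gcongr
    _ = 28 / ε * (exp (ga (k+1) * ε) * exp (ga (k+1))) := by ring
    _ ≤ 28 / ε * (exp (1 + ε) * exp (ga k * (1 + ε))) := by gcongr
    _ = _ := by ring

lemma dq_alpha (α : ℝ) (h0 : 0 ≤ α) (h1 : α < 1) : ∃ C : ℝ, 0 ≤ C ∧ ∀ k,
    |d k| * q k ^ α ≤ C := by
  refine ⟨max 1 (28 * exp (α ^ 2 / (1 - α))), le_max_of_le_left zero_le_one, fun k => ?_⟩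
  cases k with
  | zero =>
    refine le_max_of_le_left ?_
    have h := d_le 0
    have : q 0 ^ α ≤ 1 := rpow_le_one (q_nonneg 0) (by rw [q_zero]; norm_num) h0
    have h3 : 0 ≤ q 0 ^ α := rpow_nonneg (q_nonneg 0) _
    nlinarith [abs_nonneg (d 0)]
  | succ k =>
    refine le_max_of_le_right ?_
    have e : |d (k+1)| = 14 / ((k:ℝ) + 101) := by rw [abs_d]; push_cast; ring
    set G := ga (k+1) with hG
    have eN : (k:ℝ) + 101 = exp (G ^ 2) := by rw [hG, exp_ga_sq]; push_cast; ring
    have h2 : q (k+1) ≤ 2 * (exp (G ^ 2) * exp (2 * G)) := by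
      refine (q_le_ga k).trans ?_
      rw [← eN]
      have := mul_le_mul_of_nonneg_left (ga_exp_le (k+1))
        (show (0:ℝ) ≤ 2 * ((k:ℝ) + 101) by positivity)
      linarith
    have h3 : q (k+1) ^ α ≤ 2 * (exp (G ^ 2 * α + 2 * G * α)) := by
      refine (rpow_le_rpow (q_nonneg _) h2 h0).trans ?_
      rw [mul_rpow (by norm_num) (by positivity), ← exp_add, ← exp_mul, ← add_mul]
      have : (2:ℝ) ^ α ≤ 2 := by
        conv_rhs => rw [← rpow_one 2]
        exact rpow_le_rpow_of_exponent_le (by norm_num) h1.le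
      gcongr
    rw [e, eN]
    calc 14 / exp (G^2) * q (k+1) ^ α ≤ 14 / exp (G^2) * (2 * (exp (G ^ 2 * α + 2 * G * α))) := by
          gcongr
      _ = 28 * exp (G ^ 2 * α + 2 * G * α - G^2) := by rw [exp_sub]; ring
      _ ≤ _ := by
        gcongr
        rw [le_div_iff₀ (by linarith)]
        nlinarith [sq_nonneg (G * (1 - α) - α)]

/-! ### Rescaled times -/

lemma s_zero (t : ℝ) : s 0 t = 0 := by unfold s; rw [q_zero, zero_mul]
lemma s_mono (k : ℕ) : Monotone (s k) := fun x y h => by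
  unfold s; have := q_nonneg k; gcongr
lemma s_at (k : ℕ) : s k (a k) = 0 := by unfold s; simp
lemma s_at' (k : ℕ) : s (k+1) (a k) = 1 := q_mul k
lemma s_le_zero {k : ℕ} {t : ℝ} (h : t ≤ a k) : s k t ≤ 0 := by
  rw [← s_at k]; exact s_mono k h
lemma s_ge_one {k : ℕ} {t : ℝ} (h : a k ≤ t) : 1 ≤ s (k+1) t := by
  rw [← s_at' k]; exact s_mono _ h
lemma s_ge_zero {k : ℕ} {t : ℝ} (h : a k ≤ t) : 0 ≤ s k t := by
  rw [← s_at k]; exact s_mono _ h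
lemma s_le_one {k : ℕ} {t : ℝ} (h : t ≤ a k) : s (k+1) t ≤ 1 := by
  rw [← s_at' k]; exact s_mono _ h
lemma s_hasDerivAt (k : ℕ) (t : ℝ) : HasDerivAt (s k) (q k) t := by
  unfold s
  simpa using ((hasDerivAt_id t).sub_const (a k)).const_mul (q k)
lemma s_inv (k : ℕ) (t : ℝ) : t = a (k+1) + (a k - a (k+1)) * s (k+1) t := by
  unfold s
  have := q_mul k
  linear_combination (a (k+1) - t) * this
lemma s_smooth (k : ℕ) : ContDiff ℝ (⊤ : ℕ∞) (s k) := by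
  unfold s; fun_prop

end BP
end

section
namespace BP

open Real Filter Topology

/-! ### The coefficient `l` -/

noncomputable def lterm (k : ℕ) (t : ℝ) : ℝ := d k * chi (s k t)
noncomputable def l (t : ℝ) : ℝ := 1 + ∑' k, lterm k t

lemma loc_of_s {k : ℕ} {t : ℝ} (h0 : 0 < s k t) (h1 : s k t < 1) :
    ∃ j, k = j + 1 ∧ a (j+1) < t ∧ t < a j := by
  cases k with
  | zero => rw [s_zero] at h0; exact absurd h0 (lt_irrefl _)
  | succ j =>
    refine ⟨j, rfl, ?_, ?_⟩
    · by_contra h; exact absurd (s_le_zero (not_lt.1 h)) (not_le.2 h0)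
    · by_contra h; exact absurd (s_ge_one (not_lt.1 h)) (not_le.2 h1)

lemma loc_unique {i j : ℕ} {t : ℝ} (hi : a (i+1) < t) (hi' : t < a i) (hj : a (j+1) < t)
    (hj' : t < a j) : i = j := by
  have h1 : i < j + 1 := a_anti.lt_iff_gt.1 (hj.trans hi')
  have h2 : j < i + 1 := a_anti.lt_iff_gt.1 (hi.trans hj')
  omega

lemma s_unique {i j : ℕ} {t : ℝ} (hi : 0 < s i t) (hi' : s i t < 1) (hj : 0 < s j t)
    (hj' : s j t < 1) : i = j := by
  obtain ⟨i, rfl, h1, h2⟩ := loc_of_s hi hi'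
  obtain ⟨j, rfl, h3, h4⟩ := loc_of_s hj hj'
  rw [loc_unique h1 h2 h3 h4]

lemma chi_s_ne {k : ℕ} {t : ℝ} (h : chi (s k t) ≠ 0) : 0 < s k t ∧ s k t < 1 := by
  constructor
  · by_contra h2; exact h (chi_zero_left (not_lt.1 h2))
  · by_contra h2; exact h (chi_zero_right (not_lt.1 h2))

lemma lterm_ne {k : ℕ} {t : ℝ} (h : lterm k t ≠ 0) : 0 < s k t ∧ s k t < 1 :=
  chi_s_ne (right_ne_zero_of_mul h)

/-- At each time at most one term is present. -/
lemma l_cases (t : ℝ) : (∃ k, l t = 1 + lterm k t ∧ ∀ j, j ≠ k → lterm j t = 0) := by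
  by_cases h : ∃ k, lterm k t ≠ 0
  · obtain ⟨k, hk⟩ := h
    have hz : ∀ j, j ≠ k → lterm j t = 0 := by
      intro j hj
      by_contra h2
      exact hj (s_unique (lterm_ne h2).1 (lterm_ne h2).2 (lterm_ne hk).1 (lterm_ne hk).2)
    refine ⟨k, ?_, hz⟩
    unfold l; rw [tsum_eq_single k hz]
  · push Not at h
    refine ⟨0, ?_, fun j _ => h j⟩
    unfold l; simp [h]

lemma l_on {k : ℕ} {t : ℝ} (h1 : a (k+1) ≤ t) (h2 : t ≤ a k) :
    l t = 1 + d (k+1) * chi (s (k+1) t) := by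
  unfold l
  rw [tsum_eq_single (k+1)]
  · rfl
  · intro j hj
    by_contra h
    obtain ⟨i, rfl, h3, h4⟩ := loc_of_s (lterm_ne h).1 (lterm_ne h).2
    have e1 : i < k + 1 := a_anti.lt_iff_gt.1 (h1.trans_lt h4)
    have e2 : k < i + 1 := a_anti.lt_iff_gt.1 (h3.trans_le h2)
    omega

lemma lterm_abs (k : ℕ) (t : ℝ) : |lterm k t| ≤ 1/4 := by
  unfold lterm
  rw [abs_mul, abs_of_nonneg (chi_nonneg _)]
  have := d_le k
  have := chi_le_one (s k t)
  have := chi_nonneg (s k t)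
  nlinarith [abs_nonneg (d k)]

lemma l_bounds (t : ℝ) : 1/2 ≤ l t ∧ l t ≤ 3/2 := by
  obtain ⟨k, hk, _⟩ := l_cases t
  have := abs_le.1 (lterm_abs k t)
  rw [hk]; constructor <;> linarith

lemma chi_holder : ∃ C : ℝ, 1 ≤ C ∧ ∀ α : ℝ, 0 ≤ α → α < 1 → ∀ x y : ℝ,
    |chi x - chi y| ≤ C * |x - y| ^ α := by
  obtain ⟨C, hC1, hC⟩ := dchi_bound
  refine ⟨C, hC1, fun α h0 h1 x y => ?_⟩
  rcases le_total |x - y| 1 with h | h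
  · have hl : |chi x - chi y| ≤ C * |x - y| := by
      have := Convex.norm_image_sub_le_of_norm_deriv_le (f := chi) (s := Set.univ) (C := C)
        (fun z _ => chi_smooth.differentiable (by simp) z) (fun z _ => hC z) convex_univ
        (Set.mem_univ y) (Set.mem_univ x)
      exact this
    refine hl.trans (mul_le_mul_of_nonneg_left ?_ (by linarith))
    conv_lhs => rw [← rpow_one |x - y|]
    exact rpow_le_rpow_of_exponent_ge' (abs_nonneg _) h h0 h1.le
  · have h2 : |chi x - chi y| ≤ 1 := by
      rw [abs_le]
      have := chi_nonneg x; have := chi_nonneg y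
      have := chi_le_one x; have := chi_le_one y
      constructor <;> linarith
    have h3 := one_le_rpow h h0
    nlinarith

lemma lterm_holder (α : ℝ) (h0 : 0 ≤ α) (h1 : α < 1) : ∃ C : ℝ, 0 ≤ C ∧ ∀ k x y,
    |lterm k x - lterm k y| ≤ C * |x - y| ^ α := by
  obtain ⟨A, hA, hchi⟩ := chi_holder
  obtain ⟨B, hB, hd⟩ := dq_alpha α h0 h1
  refine ⟨A * B, by positivity, fun k x y => ?_⟩
  unfold lterm
  rw [← mul_sub, abs_mul]
  have e : s k x - s k y = q k * (x - y) := by unfold s; ring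
  have h2 := hchi α h0 h1 (s k x) (s k y)
  rw [e, abs_mul, abs_of_nonneg (q_nonneg k), mul_rpow (q_nonneg k) (abs_nonneg _)] at h2
  calc _ ≤ |d k| * (A * (q k ^ α * |x - y| ^ α)) := by gcongr
    _ = A * (|d k| * q k ^ α) * |x - y| ^ α := by ring
    _ ≤ _ := by have := hd k; gcongr

lemma l_holder (α : ℝ) (h0 : 0 ≤ α) (h1 : α < 1) : ∃ K : NNReal, HolderWith K α.toNNReal l := by
  obtain ⟨C, hC, h⟩ := lterm_holder α h0 h1
  have key : ∀ x y, |l x - l y| ≤ 2 * C * |x - y| ^ α := by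
    intro x y
    obtain ⟨i, hi, hi'⟩ := l_cases x
    obtain ⟨j, hj, hj'⟩ := l_cases y
    have a1 := h i x y
    have a2 := h j x y
    by_cases hij : i = j
    · subst hij
      rw [hi, hj, add_sub_add_left_eq_sub]
      have := (abs_nonneg _).trans a1
      linarith
    · rw [hi' j (Ne.symm hij)] at a2
      rw [hj' i hij] at a1
      have e : l x - l y = (lterm i x - 0) + (0 - lterm j y) := by rw [hi, hj]; ring
      rw [e]
      refine (abs_add_le _ _).trans ?_
      linarith
  refine ⟨(2 * C).toNNReal, fun x y => ?_⟩
  rw [edist_dist, edist_dist, Real.dist_eq, Real.dist_eq, Real.coe_toNNReal α h0,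
    ENNReal.ofReal_rpow_of_nonneg (abs_nonneg _) h0]
  change _ ≤ ENNReal.ofReal (2 * C) * _
  rw [← ENNReal.ofReal_mul (by positivity)]
  exact ENNReal.ofReal_le_ofReal (key x y)

/-- Away from zero `l` is a finite sum. -/
lemma l_finite {J : ℕ} {t : ℝ} (h : a J < t) :
    l t = 1 + ∑ k ∈ Finset.range (J+1), lterm k t := by
  unfold l
  rw [tsum_eq_sum (s := Finset.range (J+1))]
  intro k hk
  by_contra h2
  obtain ⟨j, rfl, h3, h4⟩ := loc_of_s (lterm_ne h2).1 (lterm_ne h2).2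
  have := a_anti.lt_iff_gt.1 (h.trans h4)
  rw [Finset.mem_range] at hk
  omega

lemma l_neg {t : ℝ} (h : t ≤ 0) : l t = 1 := by
  unfold l
  have : ∀ k, lterm k t = 0 := by
    intro k
    by_contra h2
    obtain ⟨j, rfl, h3, h4⟩ := loc_of_s (lterm_ne h2).1 (lterm_ne h2).2
    linarith [a_pos (j+1)]
  simp [this]

lemma lterm_smooth (k : ℕ) : ContDiff ℝ (⊤ : ℕ∞) (lterm k) :=
  contDiff_const.mul (chi_smooth.comp (s_smooth k))

lemma exists_a_lt {t : ℝ} (h : 0 < t) : ∃ J, a J < t :=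
  (a_tendsto.eventually (Iio_mem_nhds h)).exists

lemma l_eventually {t : ℝ} {J : ℕ} (h : a J < t) :
    l =ᶠ[𝓝 t] fun t => 1 + ∑ k ∈ Finset.range (J+1), lterm k t := by
  filter_upwards [Ioi_mem_nhds h] with y hy using l_finite hy

lemma l_eventually_neg {t : ℝ} (h : t < 0) : l =ᶠ[𝓝 t] fun _ => 1 := by
  filter_upwards [Iio_mem_nhds h] with y hy using l_neg (le_of_lt hy)

lemma l_smooth : ContDiffOn ℝ (⊤ : ℕ∞) l {(0:ℝ)}ᶜ := by
  intro t ht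
  apply ContDiffAt.contDiffWithinAt
  rcases lt_or_gt_of_ne (show t ≠ 0 from ht) with h | h
  · exact contDiffAt_const.congr_of_eventuallyEq (l_eventually_neg h)
  · obtain ⟨J, hJ⟩ := exists_a_lt h
    refine ContDiffAt.congr_of_eventuallyEq ?_ (l_eventually hJ)
    exact (contDiff_const.add (ContDiff.sum fun k _ => lterm_smooth k)).contDiffAt

lemma lterm_hasDerivAt (k : ℕ) (t : ℝ) :
    HasDerivAt (lterm k) (d k * (deriv chi (s k t) * q k)) t := by
  have h : HasDerivAt chi (deriv chi (s k t)) (s k t) :=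
    (chi_smooth.differentiable (by simp) _).hasDerivAt
  exact (h.comp t (s_hasDerivAt k t)).const_mul (d k)

lemma l_deriv_bound (ε : ℝ) (hε : 0 < ε) : ∃ Cε > (0:ℝ), ∀ t : ℝ, t ≠ 0 →
    |deriv l t| ≤ Cε * |t| ^ (-(1 + ε)) := by
  obtain ⟨C, hC0, hC⟩ := dq_eps ε hε
  obtain ⟨A, hA1, hA⟩ := dchi_bound
  refine ⟨C * A, by positivity, fun t ht => ?_⟩
  have hpos : 0 ≤ C * A * |t| ^ (-(1 + ε)) := by positivity
  rcases lt_or_gt_of_ne ht with h | h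
  · rw [(l_eventually_neg h).deriv_eq, deriv_const, abs_zero]; exact hpos
  · obtain ⟨J, hJ⟩ := exists_a_lt h
    have hd : HasDerivAt (fun t => 1 + ∑ k ∈ Finset.range (J+1), lterm k t)
        (∑ k ∈ Finset.range (J+1), d k * (deriv chi (s k t) * q k)) t :=
      (HasDerivAt.fun_sum fun k _ => lterm_hasDerivAt k t).const_add 1
    rw [(l_eventually hJ).deriv_eq, hd.deriv]
    by_cases hex : ∃ k, 0 < s k t ∧ s k t < 1
    · obtain ⟨k, hk0, hk1⟩ := hex
      have hz : ∀ j, j ≠ k → d j * (deriv chi (s j t) * q j) = 0 := by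
        intro j hj
        have : deriv chi (s j t) = 0 := by
          rcases le_or_gt (s j t) 0 with h | h
          · exact dchi_zero_left h
          rcases le_or_gt 1 (s j t) with h' | h'
          · exact dchi_zero_right h'
          · exact absurd (s_unique h h' hk0 hk1) hj
        rw [this]; ring
      have hle : |∑ k ∈ Finset.range (J+1), d k * (deriv chi (s k t) * q k)|
          ≤ |d k * (deriv chi (s k t) * q k)| := by
        by_cases hk : k ∈ Finset.range (J+1)
        · rw [Finset.sum_eq_single_of_mem k hk (fun j _ hj => hz j hj)]
        · rw [Finset.sum_eq_zero fun j hj => hz j (fun e => hk (e ▸ hj)), abs_zero]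
          exact abs_nonneg _
      refine hle.trans ?_
      obtain ⟨j, rfl, h3, h4⟩ := loc_of_s hk0 hk1
      rw [abs_mul, abs_mul, abs_of_nonneg (q_nonneg _), abs_of_pos h]
      have h5 := hC j
      have h6 := hA (s (j+1) t)
      have h7 : (a j) ^ (-(1+ε)) ≤ t ^ (-(1+ε)) :=
        rpow_le_rpow_of_nonpos h h4.le (by linarith)
      have := q_nonneg (j+1)
      calc _ = |deriv chi (s (j+1) t)| * (|d (j+1)| * q (j+1)) := by ring
        _ ≤ A * (C * (a j) ^ (-(1+ε))) := by gcongr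
        _ ≤ A * (C * t ^ (-(1+ε))) := by gcongr
        _ = _ := by ring
    · rw [Finset.sum_eq_zero, abs_zero]
      · exact hpos
      · intro j _
        have : deriv chi (s j t) = 0 := by
          rcases le_or_gt (s j t) 0 with h | h
          · exact dchi_zero_left h
          rcases le_or_gt 1 (s j t) with h' | h'
          · exact dchi_zero_right h'
          · exact absurd ⟨j, h, h'⟩ hex
        rw [this]; ring

end BP
end

section
open Real Filter Topology
namespace BP

/-- Time variable, frozen after `a 0 + 1`. -/
noncomputable def Y (t : ℝ) : ℝ := t - T (t - a 0)
noncomputable def LL (k : ℕ) (t : ℝ) : ℝ :=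
  (n k)^2 * (Y t + par k * (d (k+1) * (q (k+1))⁻¹ * XX (s (k+1) t) + d k * (q k)⁻¹ * XX (s k t)))
noncomputable def mid (k : ℕ) : ℝ := (a k + a (k+1)) / 2
noncomputable def CC : ℕ → ℝ
  | 0 => 0
  | (k+1) => LL k (mid k) + CC k - LL (k+1) (mid k)
noncomputable def h (k : ℕ) (t : ℝ) : ℝ := LL k t + CC k
noncomputable def h' (k : ℕ) (t : ℝ) : ℝ :=
  (n k)^2 * ((1 - smoothTransition (t - a 0)) +
    par k * (d (k+1) * chi (s (k+1) t) + d k * chi (s k t)))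

lemma Y_hasDerivAt (t : ℝ) : HasDerivAt Y (1 - smoothTransition (t - a 0)) t := by
  have h := (T_hasDerivAt (t - a 0)).comp t ((hasDerivAt_id t).sub_const (a 0))
  rw [mul_one] at h
  exact (hasDerivAt_id t).sub h

lemma XX_term_hasDerivAt (k : ℕ) (t : ℝ) :
    HasDerivAt (fun t => d k * (q k)⁻¹ * XX (s k t)) (d k * chi (s k t)) t := by
  have h := ((XX_hasDerivAt (s k t)).comp t (s_hasDerivAt k t)).const_mul (d k * (q k)⁻¹)
  refine h.congr_deriv ?_
  cases k with
  | zero => rw [s_zero, chi_zero_left le_rfl]; simp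
  | succ k => have := (q_pos k).ne'; field_simp

lemma h_hasDerivAt (k : ℕ) (t : ℝ) : HasDerivAt (h k) (h' k t) t :=
  (((Y_hasDerivAt t).add (((XX_term_hasDerivAt (k+1) t).add
    (XX_term_hasDerivAt k t)).const_mul (par k))).const_mul ((n k)^2)).add_const (CC k)

lemma T_nonneg (t : ℝ) : 0 ≤ T t := by
  have hm : Monotone T := monotone_of_deriv_nonneg
    (fun t => (T_hasDerivAt t).differentiableAt)
    (fun t => by rw [T_deriv]; exact smoothTransition.nonneg _)
  rcases le_total t 0 with h | h
  · rw [T_of_nonpos h]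
  · rw [← T_of_nonpos (le_refl (0:ℝ))]; exact hm h

lemma Y_le (t : ℝ) : Y t ≤ a 0 + 1 := by
  unfold Y
  rcases le_total (t - a 0) 1 with h | h
  · linarith [T_nonneg (t - a 0)]
  · rw [T_of_one_le h]; linarith [T_nonneg 1]

lemma Y_eq {t : ℝ} (h : t ≤ a 0) : Y t = t := by
  unfold Y; rw [T_of_nonpos (by linarith)]; ring

lemma a_le_zero (k : ℕ) : a k ≤ a 0 := a_anti.antitone (Nat.zero_le k)

lemma h0_le (t : ℝ) : h 0 t ≤ (n 0)^2 * (a 0 + 1) := by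
  have : h 0 t = (n 0)^2 * Y t := by simp [h, LL, par, CC]
  rw [this]
  have := Y_le t
  gcongr

lemma h'_ge {k : ℕ} {t : ℝ} (ht : t ≤ a 0) : (n k)^2 / 2 ≤ h' k t := by
  unfold h'
  rw [smoothTransition.zero_of_nonpos (by linarith)]
  have key : -(1/2) ≤ par k * (d (k+1) * chi (s (k+1) t) + d k * chi (s k t)) := by
    have b : ∀ j, -(1/4) ≤ d j * chi (s j t) := fun j => (abs_le.1 (lterm_abs j t)).1
    have b1 := b k
    have b2 := b (k+1)
    rcases par_cases k with e | e <;> rw [e] <;> linarith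
  have := sq_nonneg (n k)
  nlinarith

lemma h_grow {k : ℕ} {x y : ℝ} (hxy : x ≤ y) (hy : y ≤ a 0) :
    h k x + (n k)^2/2 * (y - x) ≤ h k y := by
  have := (convex_Iic (a 0)).mul_sub_le_image_sub_of_le_deriv (f := h k)
    (fun t _ => (h_hasDerivAt k t).continuousAt.continuousWithinAt)
    (fun t _ => (h_hasDerivAt k t).differentiableAt.differentiableWithinAt)
    (C := (n k)^2/2) (fun t ht => by
      rw [interior_Iic] at ht
      rw [(h_hasDerivAt k t).deriv]; exact h'_ge (le_of_lt ht)) x (hxy.trans hy) y hy hxy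
  linarith

lemma h_mono {k : ℕ} {x y : ℝ} (hxy : x ≤ y) (hy : y ≤ a 0) : h k x ≤ h k y := by
  have := h_grow (k := k) hxy hy
  have : 0 ≤ (n k)^2/2 * (y - x) := mul_nonneg (by positivity) (by linarith)
  linarith

lemma h_diff {k : ℕ} {t : ℝ} (h1 : 1/5 ≤ s (k+1) t) (h2 : s (k+1) t ≤ 4/5) :
    h k t - h (k+1) t = Lam k * (s (k+1) t - 1/2) := by
  have ha := a_lt k
  have ha0 := a_le_zero k
  have hmid : s (k+1) (mid k) = 1/2 := by
    have := q_mul k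
    unfold s mid
    linear_combination (1/2) * this
  have gen : ∀ x, 1/5 ≤ s (k+1) x → s (k+1) x ≤ 4/5 → a (k+1) ≤ x ∧ x ≤ a k := by
    intro x h1 h2
    have := s_inv k x
    constructor <;> nlinarith
  have e1 : ∀ x, 1/5 ≤ s (k+1) x → s (k+1) x ≤ 4/5 → LL k x =
      (n k)^2 * (x + par k * (d (k+1) * (a k - a (k+1)) * XX (s (k+1) x))) := by
    intro x h1 h2
    obtain ⟨g1, g2⟩ := gen x h1 h2
    unfold LL
    rw [Y_eq (g2.trans ha0), XX_zero (s_le_zero g2), q_inv]; ring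
  have e2 : ∀ x, 1/5 ≤ s (k+1) x → s (k+1) x ≤ 4/5 → LL (k+1) x =
      (n (k+1))^2 * (x + par (k+1) * (d (k+2) * (q (k+2))⁻¹ * (4/5) +
        d (k+1) * (a k - a (k+1)) * XX (s (k+1) x))) := by
    intro x h1 h2
    obtain ⟨g1, g2⟩ := gen x h1 h2
    unfold LL
    rw [Y_eq (g2.trans ha0), XX_right (s_ge_one g1), q_inv k]
  have et := s_inv k t
  have ex := XX_mid h1 h2
  have hCC : CC (k+1) = LL k (mid k) + CC k - LL (k+1) (mid k) := rfl
  unfold h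
  rw [hCC, e1 t h1 h2, e2 t h1 h2, e1 (mid k) (by rw [hmid]; norm_num) (by rw [hmid]; norm_num),
    e2 (mid k) (by rw [hmid]; norm_num) (by rw [hmid]; norm_num), hmid, ex]
  unfold Lam kappa mid
  linear_combination ((n k)^2 - (n (k+1))^2) * et

noncomputable def ee (k : ℕ) : ℝ := a (k+1) + (a k - a (k+1)) * (4/5)

lemma s_ee (k : ℕ) : s (k+1) (ee k) = 4/5 := by
  have := q_mul k
  unfold s ee; linear_combination (4/5) * this
lemma ee_le (k : ℕ) : ee k ≤ a k := by have := a_lt k; unfold ee; linarith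
lemma ee_ge (k : ℕ) : a (k+1) ≤ ee k := by have := a_lt k; unfold ee; linarith
lemma le_ee {k : ℕ} {t : ℝ} (h : s (k+1) t ≤ 4/5) : t ≤ ee k := by
  have := s_inv k t
  have := a_lt k
  unfold ee; nlinarith

lemma h_ee (k : ℕ) : h (k+1) (ee k) ≤ h k (ee k) := by
  have := h_diff (k := k) (t := ee k) (by rw [s_ee]; norm_num) (by rw [s_ee])
  rw [s_ee] at this
  have := Lam_pos k
  linarith

lemma h_ee_bound (k : ℕ) : h (k+1) (ee k) ≤ (n 0)^2 * (a 0 + 1) - k := by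
  induction k with
  | zero => simpa using (h_ee 0).trans (h0_le _)
  | succ k ih =>
    refine (h_ee (k+1)).trans ?_
    have h1 := h_grow (k := k+1) (x := ee (k+1)) (y := ee k) ((ee_le (k+1)).trans (ee_ge k))
      ((ee_le k).trans (a_le_zero k))
    have h2 := growth k
    have h3 : 4/5 * (a k - a (k+1)) ≤ ee k - ee (k+1) := by
      have := ee_le (k+1); unfold ee at *; linarith
    have h4 : (n (k+1))^2/2 * (4/5 * (a k - a (k+1))) ≤ (n (k+1))^2/2 * (ee k - ee (k+1)) := by
      gcongr
    push_cast
    linarith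

lemma h_bound (k : ℕ) (t : ℝ) (ht : s k t ≤ 4/5) :
    exp (h k t) ≤ exp ((n 0)^2 * (a 0 + 1) + 1) * We k := by
  unfold We
  rw [← exp_add, exp_le_exp]
  cases k with
  | zero => have := h0_le t; push_cast; linarith
  | succ k =>
    have := h_ee_bound k
    have := h_mono (k := k+1) (le_ee ht) ((ee_le k).trans (a_le_zero k))
    push_cast; linarith

/-- Coefficient of the second derivative seen by mode `k`. -/
noncomputable def lam (k : ℕ) (t : ℝ) : ℝ := if Even k then 1 else l t

lemma h'_left {k : ℕ} {t : ℝ} (h1 : a (k+1) ≤ t) (h2 : t ≤ a k) :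
    h' k t = (n k)^2 * lam k t := by
  unfold h' lam par
  rw [smoothTransition.zero_of_nonpos (by linarith [a_le_zero k]), l_on h1 h2,
    chi_zero_left (s_le_zero h2)]
  split_ifs <;> ring

lemma h'_right {k : ℕ} {t : ℝ} (h1 : a (k+1) ≤ t) (h2 : t ≤ a k) :
    h' (k+1) t = (n (k+1))^2 * lam (k+1) t := by
  unfold h' lam par
  rw [smoothTransition.zero_of_nonpos (by linarith [a_le_zero k]), l_on h1 h2,
    chi_zero_right (s_ge_one h1)]
  split_ifs <;> ring

lemma h'_zero (t : ℝ) : h' 0 t = (n 0)^2 * (1 - smoothTransition (t - a 0)) := by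
  unfold h' par; simp

/-- Spatial coordinate used by mode `k`. -/
noncomputable def xc (k : ℕ) : E3 →L[ℝ] ℝ :=
  if Even k then (ContinuousLinearMap.fst ℝ ℝ ℝ).comp (ContinuousLinearMap.snd ℝ ℝ (ℝ × ℝ))
  else (ContinuousLinearMap.snd ℝ ℝ ℝ).comp (ContinuousLinearMap.snd ℝ ℝ (ℝ × ℝ))

noncomputable def tc : E3 →L[ℝ] ℝ := ContinuousLinearMap.fst ℝ ℝ (ℝ × ℝ)

lemma xc_norm (k : ℕ) : ‖xc k‖ ≤ 1 := by
  have h1 := ContinuousLinearMap.norm_snd_le ℝ ℝ (ℝ × ℝ)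
  have h2 := ContinuousLinearMap.norm_snd_le ℝ ℝ ℝ
  have h3 := ContinuousLinearMap.norm_fst_le ℝ ℝ ℝ
  unfold xc
  split_ifs
  · refine (ContinuousLinearMap.opNorm_comp_le _ _).trans ?_
    exact mul_le_one₀ h3 (norm_nonneg _) h1
  · refine (ContinuousLinearMap.opNorm_comp_le _ _).trans ?_
    exact mul_le_one₀ h2 (norm_nonneg _) h1

lemma tc_norm : ‖tc‖ ≤ 1 := ContinuousLinearMap.norm_fst_le ℝ ℝ (ℝ × ℝ)

lemma q_succ_le (k : ℕ) : |q (k+1)| ≤ 400000 * ((k:ℝ) + 1) ^ 2 := by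
  refine (q_le (k+1)).trans ?_
  push_cast
  nlinarith [Nat.cast_nonneg (α := ℝ) k]

lemma bd_s (S : ℕ → Set E3) : Bd 1 S (fun _ => 1) (fun k p => s k p.1) := by
  have := Bd.affine S (fun _ => tc) (fun _ => tc_norm) q (fun k => -(q k * a k)) _ _ q_le
  convert this using 3
  unfold s tc; simp; ring

lemma bd_s1 (S : ℕ → Set E3) : Bd 1 S (fun _ => 1) (fun k p => s (k+1) p.1) := by
  have := Bd.affine S (fun _ => tc) (fun _ => tc_norm) (fun k => q (k+1))
    (fun k => -(q (k+1) * a (k+1))) _ _ q_succ_le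
  convert this using 3
  unfold s tc; simp; ring

lemma one_nn : ∀ _ : ℕ, (0:ℝ) ≤ 1 := fun _ => zero_le_one

lemma Bd.one_sub {S F} (hF : Bd 1 S (fun _ => 1) F) :
    Bd 1 S (fun _ => 1) (fun k p => 1 - F k p) := by
  have := (hF.const_mul one_nn (fun _ => -1) 1 0 (by simp)).add_const (fun _ => 1)
  convert this using 3
  ring

lemma bd_x (S : ℕ → Set E3) : Bd 1 S (fun _ => 1) (fun k p => n k * xc k p) := by
  have := Bd.affine S xc xc_norm n (fun _ => 0) _ _ n_le
  simpa using this

lemma bd_x1 (S : ℕ → Set E3) : Bd 1 S (fun _ => 1) (fun k p => n (k+1) * xc (k+1) p) := by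
  have := Bd.affine S (fun k => xc (k+1)) (fun k => xc_norm (k+1)) (fun k => n (k+1))
    (fun _ => 0) _ _ n_succ_le
  simpa using this

lemma dq_inv_le (k : ℕ) : |d k * (q k)⁻¹| ≤ 1 := by
  cases k with
  | zero => rw [q_zero]; simp
  | succ k =>
    rw [q_inv, abs_mul, abs_of_pos (a := a k - a (k+1)) (by linarith [a_lt k])]
    have := d_le (k+1)
    have := a_le_one k
    have := a_pos (k+1)
    have := a_lt k
    exact mul_le_one₀ (by linarith) (by linarith) (by linarith)

lemma bd_h (S : ℕ → Set E3) : Bd 1 S (fun _ => 1) (fun k p => h k p.1) := by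
  have ht : ∀ c : ℝ, Bd 1 S (fun _ => 1) (fun k p => p.1 + c) := by
    intro c
    have := Bd.affine S (fun _ => tc) (fun _ => tc_norm) (fun _ => 1) (fun _ => c) 1 0 (by simp)
    convert this using 3
    unfold tc; simp
  have hY : Bd 1 S (fun _ => 1) (fun k p => Y p.1) := by
    have h1 := ((ht (-a 0)).comp_db1 T_smooth T_db).const_mul one_nn (fun _ => -1) 1 0 (by simp)
    have := (ht 0).add one_nn h1
    convert this using 3
    unfold Y
    simp only [sub_eq_add_neg]; ring
  have hX : Bd 1 S (fun _ => 1) (fun k p => d k * (q k)⁻¹ * XX (s k p.1)) :=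
    (((bd_s S).comp_db XX_smooth XX_db).mono zero_le_one).const_mul one_nn
      (fun k => d k * (q k)⁻¹) 1 0 (by simpa using dq_inv_le)
  have hX1 : Bd 1 S (fun _ => 1) (fun k p => d (k+1) * (q (k+1))⁻¹ * XX (s (k+1) p.1)) :=
    (((bd_s1 S).comp_db XX_smooth XX_db).mono zero_le_one).const_mul one_nn
      (fun k => d (k+1) * (q (k+1))⁻¹) 1 0 (by simpa using fun k => dq_inv_le (k+1))
  have h1 := (hX1.add one_nn hX).const_mul one_nn par 1 0 (by
    intro k; rcases par_cases k with e | e <;> simp [e])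
  have h2 := (hY.add one_nn h1).const_mul one_nn (fun k => (n k)^2) (100^6) 6 (by
    intro k
    rw [abs_pow]
    calc |n k| ^ 2 ≤ (100 ^ 3 * ((k:ℝ) + 1) ^ 3) ^ 2 := by
          have := n_le k; gcongr
      _ = _ := by ring)
  exact h2.add_const CC

/-- The `k`-th mode. -/
noncomputable def U (k : ℕ) (p : E3) : ℝ :=
  exp (h k p.1) * phi (s (k+1) p.1) * phi (1 - s k p.1) * cos (n k * xc k p)
noncomputable def uu (p : E3) : ℝ := ∑' k, U k p

def SU (k : ℕ) : Set E3 := {p | 1/5 ≤ s (k+1) p.1 ∧ s k p.1 ≤ 4/5}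

lemma s_cont (k : ℕ) : Continuous (s k) := (s_smooth k).continuous

lemma SU_closed (k : ℕ) : IsClosed (SU k) :=
  (isClosed_le continuous_const ((s_cont _).comp continuous_fst)).inter
    (isClosed_le ((s_cont _).comp continuous_fst) continuous_const)

lemma U_zero_left {k : ℕ} {p : E3} (hp : s (k+1) p.1 ≤ 1/5) : U k p = 0 := by
  unfold U; rw [phi_zero hp]; ring
lemma U_zero_right {k : ℕ} {p : E3} (hp : 4/5 ≤ s k p.1) : U k p = 0 := by
  unfold U; rw [phi_zero (s := 1 - s k p.1) (by linarith)]; ring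

lemma uu_CB : CB uu := by
  have hE : Bd 0 SU We (fun k p => exp (h k p.1)) :=
    (bd_h SU).exp We_nonneg _ (fun k p hp => h_bound k p.1 hp.2)
  have h1 := (bd_s1 SU).comp_db phi_smooth phi_db
  have h2 := (bd_s SU).one_sub.comp_db phi_smooth phi_db
  have h3 := (bd_x SU).comp_db contDiff_cos cos_db
  have := ((hE.mul_one We_nonneg h1).mul_one We_nonneg h2).mul_one We_nonneg h3
  refine Bd.tsum_CB (F := U) SU_closed this ?_
  intro k p hp
  by_cases hA : 1/5 ≤ s (k+1) p.1
  · exact U_zero_right (not_lt.1 fun hB => hp ⟨hA, hB.le⟩)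
  · exact U_zero_left (not_le.1 hA).le

end BP
end

section
open Real Filter Topology
namespace BP

noncomputable def Hf (Λ σ α β : ℝ) : ℝ :=
  exp (Λ * σ + -(Λ * (1/2))) * phi' σ * cos β *
    w (exp (Λ * σ + -(Λ * (1/2))) * phi σ * (cos α * cos β))

lemma Hf_bd {S : ℕ → Set E3} {σ α β : ℕ → E3 → ℝ} (hσ : Bd 1 S (fun _ => 1) σ)
    (hα : Bd 1 S (fun _ => 1) α) (hβ : Bd 1 S (fun _ => 1) β)
    (hS : ∀ k, ∀ p ∈ S k, σ k p ≤ 2/5) :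
    Bd 0 S We (fun k p => Hf (Lam k) (σ k p) (α k p) (β k p)) := by
  have hE : Bd 0 S We (fun k p => exp (Lam k * σ k p + -(Lam k * (1/2)))) := by
    refine Bd.exp We_nonneg ((hσ.const_mul one_nn Lam _ _ Lam_le).add_const _) 1 ?_
    intro k p hp
    have h1 := hS k p hp
    have h2 := Lam_ge k
    unfold We
    rw [one_mul, exp_le_exp]
    have : Lam k * σ k p ≤ Lam k * (2/5) := mul_le_mul_of_nonneg_left h1 (Lam_pos k).le
    linarith
  have hca := hα.comp_db contDiff_cos cos_db
  have hcb := hβ.comp_db contDiff_cos cos_db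
  have hphi := hσ.comp_db phi_smooth phi_db
  have hphi' := hσ.comp_db phi'_smooth phi'_db
  have hz := ((hE.mul_one We_nonneg hphi).mul_one We_nonneg (hca.mul_one one_nn hcb))
  have hw := ((hz.weaken We_le_one).mono zero_le_one).comp_db w_smooth w_db
  exact ((hE.mul_one We_nonneg hphi').mul_one We_nonneg hcb).mul_one We_nonneg hw

def SF (k : ℕ) : Set E3 := {p | 1/5 ≤ s (k+1) p.1 ∧ s (k+1) p.1 ≤ 2/5}
def SG (k : ℕ) : Set E3 := {p | 1/5 ≤ 1 - s (k+1) p.1 ∧ 1 - s (k+1) p.1 ≤ 2/5}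

lemma SF_closed (k : ℕ) : IsClosed (SF k) :=
  (isClosed_le continuous_const ((s_cont _).comp continuous_fst)).inter
    (isClosed_le ((s_cont _).comp continuous_fst) continuous_const)
lemma SG_closed (k : ℕ) : IsClosed (SG k) :=
  (isClosed_le continuous_const (continuous_const.sub ((s_cont _).comp continuous_fst))).inter
    (isClosed_le (continuous_const.sub ((s_cont _).comp continuous_fst)) continuous_const)

noncomputable def HF (k : ℕ) (p : E3) : ℝ :=
  Hf (Lam k) (s (k+1) p.1) (n (k+1) * xc (k+1) p) (n k * xc k p)
noncomputable def HG (k : ℕ) (p : E3) : ℝ :=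
  Hf (Lam k) (1 - s (k+1) p.1) (n k * xc k p) (n (k+1) * xc (k+1) p)

lemma Hf_zero {Λ σ α β : ℝ} (h : ¬ (1/5 ≤ σ ∧ σ ≤ 2/5)) : Hf Λ σ α β = 0 := by
  have : phi' σ = 0 := by
    by_cases h1 : 1/5 ≤ σ
    · exact phi'_zero_right (not_lt.1 fun h2 => h ⟨h1, h2.le⟩)
    · exact phi'_zero_left (not_le.1 h1).le
  unfold Hf; rw [this]; ring

lemma HF_bd : Bd 0 SF We HF :=
  Hf_bd (bd_s1 SF) (bd_x1 SF) (bd_x SF) (fun _ _ hp => hp.2)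
lemma HG_bd : Bd 0 SG We HG :=
  Hf_bd (bd_s1 SG).one_sub (bd_x SG) (bd_x1 SG) (fun _ _ hp => hp.2)
lemma HF_zero {k : ℕ} {p : E3} (h : p ∉ SF k) : HF k p = 0 := Hf_zero h
lemma HG_zero {k : ℕ} {p : E3} (h : p ∉ SG k) : HG k p = 0 := Hf_zero h

/-- Generic coefficient built on `HF`. -/
lemma sumF_CB (cf : ℕ → ℝ) (A : ℝ) (M : ℕ) (hc : ∀ k, |cf k| ≤ A * ((k:ℝ) + 1) ^ M)
    {g : ℝ → ℝ} (hg : ContDiff ℝ (⊤ : ℕ∞) g) (hb : DB 0 g) :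
    CB (fun p => ∑' k, cf k * HF k p * g (n (k+1) * xc (k+1) p)) := by
  refine Bd.tsum_CB (S := SF) SF_closed ?_ ?_
  · exact (HF_bd.const_mul We_nonneg cf A M hc).mul_one We_nonneg ((bd_x1 SF).comp_db hg hb)
  · intro k p hp
    rw [HF_zero hp]; ring
lemma sumG_CB (cf : ℕ → ℝ) (A : ℝ) (M : ℕ) (hc : ∀ k, |cf k| ≤ A * ((k:ℝ) + 1) ^ M)
    {g : ℝ → ℝ} (hg : ContDiff ℝ (⊤ : ℕ∞) g) (hb : DB 0 g) :
    CB (fun p => ∑' k, cf k * HG k p * g (n k * xc k p)) := by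
  refine Bd.tsum_CB (S := SG) SG_closed ?_ ?_
  · exact (HG_bd.const_mul We_nonneg cf A M hc).mul_one We_nonneg ((bd_x SG).comp_db hg hb)
  · intro k p hp
    rw [HG_zero hp]; ring

noncomputable def sumF (cf : ℕ → ℝ) (g : ℝ → ℝ) (p : E3) : ℝ :=
  ∑' k, cf k * HF k p * g (n (k+1) * xc (k+1) p)
noncomputable def sumG (cf : ℕ → ℝ) (g : ℝ → ℝ) (p : E3) : ℝ :=
  ∑' k, cf k * HG k p * g (n k * xc k p)

noncomputable def b1 (p : E3) : ℝ :=
  sumG (fun k => -((1 - par k) * q (k+1) / n k)) sin p +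
    sumF (fun k => par k * q (k+1) / n (k+1)) sin p
noncomputable def b2 (p : E3) : ℝ :=
  sumG (fun k => -(par k * q (k+1) / n k)) sin p +
    sumF (fun k => (1 - par k) * q (k+1) / n (k+1)) sin p
noncomputable def cc (p : E3) : ℝ :=
  sumG (fun k => q (k+1)) cos p + sumF (fun k => -q (k+1)) cos p +
    (n 0)^2 * smoothTransition (p.1 - a 0)

lemma cf_le (k j : ℕ) (x : ℝ) (hx : |x| ≤ 1) :
    |x * q (k+1) / n j| ≤ 400000 * ((k:ℝ) + 1) ^ 2 := by
  rw [abs_div, abs_mul, abs_of_pos (n_pos j)]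
  have h1 := q_succ_le k
  have h2 := n_ge_one j
  refine (div_le_self (by positivity) h2).trans ?_
  refine le_trans ?_ h1
  exact mul_le_of_le_one_left (abs_nonneg _) hx

lemma par_abs (k : ℕ) : |par k| ≤ 1 := by rcases par_cases k with e | e <;> simp [e]
lemma par_abs' (k : ℕ) : |1 - par k| ≤ 1 := by rcases par_cases k with e | e <;> simp [e]

lemma b1_CB : CB b1 :=
  (sumG_CB _ _ _ (fun k => by rw [abs_neg]; exact cf_le k k _ (par_abs' k)) contDiff_sin sin_db).add
    (sumF_CB _ _ _ (fun k => cf_le k (k+1) _ (par_abs k)) contDiff_sin sin_db)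
lemma b2_CB : CB b2 :=
  (sumG_CB _ _ _ (fun k => by rw [abs_neg]; exact cf_le k k _ (par_abs k)) contDiff_sin sin_db).add
    (sumF_CB _ _ _ (fun k => cf_le k (k+1) _ (par_abs' k)) contDiff_sin sin_db)
lemma cc_CB : CB cc :=
  ((sumG_CB _ _ _ q_succ_le contDiff_cos cos_db).add
    (sumF_CB _ _ _ (fun k => by rw [abs_neg]; exact q_succ_le k) contDiff_cos cos_db)).add
    ((CB.of_time sT_smooth sT_db (a 0)).const_mul _)

/-- Slab condition. -/
def Slab (k : ℕ) (t : ℝ) : Prop := a (k+1) ≤ t ∧ (t ≤ a k ∨ k = 0)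

lemma slab_exists {t : ℝ} (ht : 0 < t) : ∃ k, Slab k t := by
  classical
  by_cases h0 : a 0 ≤ t
  · exact ⟨0, (a_lt 0).le.trans h0, Or.inr rfl⟩
  · have hex : ∃ J, a J ≤ t := by
      obtain ⟨J, hJ⟩ := exists_a_lt ht
      exact ⟨J, hJ.le⟩
    obtain ⟨k, hk⟩ : ∃ k, Nat.find hex = k + 1 := by
      refine Nat.exists_eq_succ_of_ne_zero fun h => ?_
      have := Nat.find_spec hex
      rw [h] at this
      exact h0 this
    refine ⟨k, ?_, Or.inl ?_⟩
    · rw [← hk]; exact Nat.find_spec hex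
    · exact (not_le.1 (Nat.find_min hex (m := k) (by omega))).le

lemma slab_unique {k j : ℕ} {t : ℝ} (h : Slab k t) (h0 : 0 < s (j+1) t) (h1 : s (j+1) t < 1) :
    j = k := by
  obtain ⟨i, hi, h2, h3⟩ := loc_of_s h0 h1
  obtain rfl : j = i := by omega
  have e1 : j < k + 1 := a_anti.lt_iff_gt.1 (lt_of_le_of_lt h.1 h3)
  rcases h.2 with h4 | h4
  · have e2 : k < j + 1 := a_anti.lt_iff_gt.1 (lt_of_lt_of_le h2 h4)
    omega
  · omega

lemma sumF_eq {k : ℕ} {p : E3} (h : Slab k p.1) (cf : ℕ → ℝ) (g : ℝ → ℝ) :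
    sumF cf g p = cf k * HF k p * g (n (k+1) * xc (k+1) p) := by
  unfold sumF
  refine tsum_eq_single k fun j hj => ?_
  rw [HF_zero, mul_zero, zero_mul]
  intro hp
  exact hj (slab_unique h (by linarith [hp.1]) (by linarith [hp.2]))
lemma sumG_eq {k : ℕ} {p : E3} (h : Slab k p.1) (cf : ℕ → ℝ) (g : ℝ → ℝ) :
    sumG cf g p = cf k * HG k p * g (n k * xc k p) := by
  unfold sumG
  refine tsum_eq_single k fun j hj => ?_
  rw [HG_zero, mul_zero, zero_mul]
  intro hp
  exact hj (slab_unique h (by linarith [hp.2]) (by linarith [hp.1]))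

/-- Times around which only modes `k`, `k+1` are present. -/
def Good (k : ℕ) (t : ℝ) : Prop := 4/5 < s (k+2) t ∧ s k t < 1/5

lemma Slab.good {k : ℕ} {t : ℝ} (h : Slab k t) : Good k t := by
  refine ⟨by linarith [s_ge_one h.1], ?_⟩
  rcases h.2 with h2 | rfl
  · linarith [s_le_zero h2]
  · rw [s_zero]; norm_num

lemma Good.eventually {k : ℕ} {t : ℝ} (h : Good k t) : ∀ᶠ r in 𝓝 t, Good k r :=
  ((s_cont (k+2)).continuousAt.eventually (Ioi_mem_nhds h.1)).and
    ((s_cont k).continuousAt.eventually (Iio_mem_nhds h.2))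

noncomputable def AA (k : ℕ) (t : ℝ) : ℝ := exp (h (k+1) t) * phi (1 - s (k+1) t)
noncomputable def BB (k : ℕ) (t : ℝ) : ℝ := exp (h k t) * phi (s (k+1) t)

lemma U_eq_zero_of_good {k j : ℕ} {p : E3} (hg : Good k p.1) (h1 : j ≠ k) (h2 : j ≠ k + 1) :
    U j p = 0 := by
  rcases lt_or_gt_of_ne h1 with hlt | hgt
  · apply U_zero_left
    obtain ⟨i, rfl⟩ : ∃ i, k = i + 1 := ⟨k - 1, by omega⟩
    rcases eq_or_lt_of_le (show j ≤ i by omega) with rfl | hji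
    · exact hg.2.le
    · have h3 : p.1 ≤ a i := by
        by_contra hc
        have := s_ge_one (not_le.1 hc).le
        linarith [hg.2]
      have h4 : a i ≤ a (j+1) := a_anti.antitone hji
      linarith [s_le_zero (h3.trans h4)]
  · apply U_zero_right
    rcases eq_or_lt_of_le (show k + 2 ≤ j by omega) with rfl | hji
    · exact hg.1.le
    · obtain ⟨i, rfl⟩ : ∃ i, j = i + 1 := ⟨j - 1, by omega⟩
      have h3 : a (k+2) ≤ p.1 := by
        by_contra hc
        have := s_le_zero (not_le.1 hc).le
        linarith [hg.1]
      have h4 : a i ≤ a (k+2) := a_anti.antitone (by omega)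
      linarith [s_ge_one (h4.trans h3)]

lemma uu_eq {k : ℕ} {p : E3} (hg : Good k p.1) :
    uu p = AA k p.1 * cos (n (k+1) * xc (k+1) p) + BB k p.1 * cos (n k * xc k p) := by
  unfold uu
  rw [tsum_eq_sum (s := {k+1, k})]
  · rw [Finset.sum_pair (by omega)]
    unfold U AA BB
    rw [phi_one (s := s (k+1+1) p.1) (by have := hg.1; linarith), phi_one (s := 1 - s k p.1) (by have := hg.2; linarith)]
    ring
  · intro j hj
    simp only [Finset.mem_insert, Finset.mem_singleton, not_or] at hj
    exact U_eq_zero_of_good hg hj.2 hj.1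

lemma uu_nonpos {p : E3} (hp : p.1 ≤ 0) : uu p = 0 := by
  unfold uu
  have : ∀ k, U k p = 0 := fun k =>
    U_zero_left (by linarith [s_le_zero (k := k+1) (hp.trans (a_pos _).le)])
  simp [this]

noncomputable def AA' (k : ℕ) (t : ℝ) : ℝ :=
  exp (h (k+1) t) * (h' (k+1) t * phi (1 - s (k+1) t) - q (k+1) * phi' (1 - s (k+1) t))
noncomputable def BB' (k : ℕ) (t : ℝ) : ℝ :=
  exp (h k t) * (h' k t * phi (s (k+1) t) + q (k+1) * phi' (s (k+1) t))

lemma AA_hasDerivAt (k : ℕ) (t : ℝ) : HasDerivAt (AA k) (AA' k t) t := by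
  have h1 := (h_hasDerivAt (k+1) t).exp
  have h2 := (phi_hasDerivAt (1 - s (k+1) t)).comp t ((s_hasDerivAt (k+1) t).const_sub 1)
  refine (h1.mul h2).congr_deriv ?_
  unfold AA'; simp only [Function.comp]; ring
lemma BB_hasDerivAt (k : ℕ) (t : ℝ) : HasDerivAt (BB k) (BB' k t) t := by
  have h1 := (h_hasDerivAt k t).exp
  have h2 := (phi_hasDerivAt (s (k+1) t)).comp t (s_hasDerivAt (k+1) t)
  refine (h1.mul h2).congr_deriv ?_
  unfold BB'; simp only [Function.comp]; ring

lemma xc_even {k : ℕ} (hk : Even k) (t x y : ℝ) : xc k (t, x, y) = x := by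
  unfold xc; rw [if_pos hk]; rfl
lemma xc_odd {k : ℕ} (hk : ¬ Even k) (t x y : ℝ) : xc k (t, x, y) = y := by
  unfold xc; rw [if_neg hk]; rfl
lemma xc_t (k : ℕ) (t r x y : ℝ) : xc k (t, x, y) = xc k (r, x, y) := by
  by_cases hk : Even k
  · rw [xc_even hk, xc_even hk]
  · rw [xc_odd hk, xc_odd hk]

lemma uu_deriv_t {k : ℕ} {t x y : ℝ} (hg : Good k t) :
    deriv (fun r => uu (r, x, y)) t = AA' k t * cos (n (k+1) * xc (k+1) (t, x, y)) +
      BB' k t * cos (n k * xc k (t, x, y)) := by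
  have he : (fun r => uu (r, x, y)) =ᶠ[𝓝 t] fun r => AA k r * cos (n (k+1) * xc (k+1) (t, x, y)) +
      BB k r * cos (n k * xc k (t, x, y)) := by
    filter_upwards [hg.eventually] with r hr
    rw [uu_eq (p := (r, x, y)) hr, xc_t k r t, xc_t (k+1) r t]
  rw [he.deriv_eq]
  exact (((AA_hasDerivAt k t).mul_const _).add ((BB_hasDerivAt k t).mul_const _)).deriv

lemma cosw_deriv (P B m : ℝ) : deriv (fun y => P + B * cos (m * y)) =
    fun y => -(B * m * sin (m * y)) := by
  funext y
  have h1 : HasDerivAt (fun y => m * y) m y := by simpa using (hasDerivAt_id y).const_mul m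
  refine ((h1.cos.const_mul B).const_add P).deriv.trans ?_
  ring
lemma cosw_deriv2 (P B m y : ℝ) : iteratedDeriv 2 (fun y => P + B * cos (m * y)) y =
    -(B * m^2 * cos (m * y)) := by
  rw [iteratedDeriv_succ, iteratedDeriv_one, cosw_deriv]
  have h1 : HasDerivAt (fun y => m * y) m y := by simpa using (hasDerivAt_id y).const_mul m
  refine ((h1.sin.const_mul (B * m)).neg).deriv.trans ?_
  ring

lemma uu_even {k : ℕ} {t : ℝ} (hg : Good k t) (hk : Even k) (x y : ℝ) :
    uu (t, x, y) = AA k t * cos (n (k+1) * y) + BB k t * cos (n k * x) := by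
  rw [uu_eq (p := (t, x, y)) hg, xc_even hk, xc_odd (by simpa [Nat.even_add_one] using hk)]
lemma uu_odd {k : ℕ} {t : ℝ} (hg : Good k t) (hk : ¬ Even k) (x y : ℝ) :
    uu (t, x, y) = AA k t * cos (n (k+1) * x) + BB k t * cos (n k * y) := by
  rw [uu_eq (p := (t, x, y)) hg, xc_odd hk, xc_even (by simpa [Nat.even_add_one] using hk)]

end BP
end

section
open Real Filter Topology
namespace BP

lemma Hf_key {Λ σ α β E : ℝ} (hΛ : 10 ≤ Λ) (h2 : σ ≤ 2/5) :
    Hf Λ σ α β * (E + exp (Λ * σ + -(Λ * (1/2))) * E * phi σ * (cos α * cos β)) =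
      phi' σ * (exp (Λ * σ + -(Λ * (1/2))) * E) * cos β := by
  unfold Hf
  obtain ⟨r, hr⟩ : ∃ r, r = exp (Λ * σ + -(Λ * (1/2))) := ⟨_, rfl⟩
  have r0 : 0 < r := by rw [hr]; exact exp_pos _
  have r1 : r ≤ 1/2 := by
    have e1 : r ≤ exp (-1) := by
      rw [hr, exp_le_exp]
      nlinarith
    have := exp_neg_one_lt_d9
    linarith
  rw [← hr]
  have hz : |r * phi σ * (cos α * cos β)| ≤ 1/2 := by
    rw [abs_mul, abs_mul, abs_mul, abs_of_pos r0, abs_of_nonneg (phi_nonneg σ)]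
    have c1 := abs_cos_le_one α
    have c2 := abs_cos_le_one β
    have c3 : |cos α| * |cos β| ≤ 1 := mul_le_one₀ c1 (abs_nonneg _) c2
    have p1 := phi_le_one σ
    have p0 := phi_nonneg σ
    calc r * phi σ * (|cos α| * |cos β|) ≤ 1/2 * 1 * 1 := by gcongr
      _ = 1/2 := by norm_num
  rw [w_eq hz]
  have hne : 1 + r * phi σ * (cos α * cos β) ≠ 0 := by
    have := (abs_le.1 hz).1
    intro h; linarith
  have hi := one_div_mul_cancel hne
  linear_combination (r * phi' σ * cos β * E) * hi

lemma Lam_ge_ten (k : ℕ) : 10 ≤ Lam k := by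
  have := Lam_ge k
  have := Nat.cast_nonneg (α := ℝ) k
  linarith

lemma keyF (k : ℕ) (t α β : ℝ) :
    Hf (Lam k) (s (k+1) t) α β * (AA k t + BB k t * (cos α * cos β)) =
      phi' (s (k+1) t) * exp (h k t) * cos β := by
  by_cases hs : 1/5 ≤ s (k+1) t ∧ s (k+1) t ≤ 2/5
  · have e : exp (h k t) = exp (Lam k * s (k+1) t + -(Lam k * (1/2))) * exp (h (k+1) t) := by
      rw [← exp_add]
      congr 1
      have := h_diff (k := k) (t := t) hs.1 (by linarith [hs.2])
      linarith
    have := Hf_key (E := exp (h (k+1) t)) (α := α) (β := β) (Lam_ge_ten k) hs.2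
    unfold AA BB
    rw [phi_one (s := 1 - s (k+1) t) (by linarith [hs.2]), e, mul_one]
    exact this
  · have hp : phi' (s (k+1) t) = 0 := by
      by_cases h1 : 1/5 ≤ s (k+1) t
      · exact phi'_zero_right (not_lt.1 fun h2 => hs ⟨h1, h2.le⟩)
      · exact phi'_zero_left (not_le.1 h1).le
    rw [Hf_zero hs, hp]; ring

lemma keyG (k : ℕ) (t α β : ℝ) :
    Hf (Lam k) (1 - s (k+1) t) α β * (BB k t + AA k t * (cos α * cos β)) =
      phi' (1 - s (k+1) t) * exp (h (k+1) t) * cos β := by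
  by_cases hs : 1/5 ≤ 1 - s (k+1) t ∧ 1 - s (k+1) t ≤ 2/5
  · have e : exp (h (k+1) t) =
        exp (Lam k * (1 - s (k+1) t) + -(Lam k * (1/2))) * exp (h k t) := by
      rw [← exp_add]
      congr 1
      have := h_diff (k := k) (t := t) (by linarith [hs.2]) (by linarith [hs.1])
      linarith
    have := Hf_key (E := exp (h k t)) (α := α) (β := β) (Lam_ge_ten k) hs.2
    unfold AA BB
    rw [phi_one (s := s (k+1) t) (by linarith [hs.2]), e, mul_one]
    exact this
  · have hp : phi' (1 - s (k+1) t) = 0 := by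
      by_cases h1 : 1/5 ≤ 1 - s (k+1) t
      · exact phi'_zero_right (not_lt.1 fun h2 => hs ⟨h1, h2.le⟩)
      · exact phi'_zero_left (not_le.1 h1).le
    rw [Hf_zero hs, hp]; ring

/-- The time part, after removing the second order terms. -/
lemma time_part {k : ℕ} {t : ℝ} (hS : Slab k t) (α β : ℝ) :
    AA' k t * cos α + BB' k t * cos β - (n k)^2 * lam k t * BB k t * cos β
      - (n (k+1))^2 * lam (k+1) t * AA k t * cos α
      + (n 0)^2 * smoothTransition (t - a 0) * (AA k t * cos α + BB k t * cos β) =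
    q (k+1) * (phi' (s (k+1) t) * exp (h k t) * cos β)
      - q (k+1) * (phi' (1 - s (k+1) t) * exp (h (k+1) t) * cos α) := by
  by_cases ht : t ≤ a k
  · unfold AA' BB' AA BB
    rw [h'_left hS.1 ht, h'_right hS.1 ht,
      smoothTransition.zero_of_nonpos (by linarith [a_le_zero k])]
    ring
  · have hk : k = 0 := hS.2.resolve_left ht
    subst hk
    have h1 := s_ge_one (not_le.1 ht).le
    unfold AA' BB' AA BB
    rw [phi_zero (s := 1 - s (0+1) t) (by linarith), phi'_zero_left (s := 1 - s (0+1) t)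
      (by linarith), phi_one (s := s (0+1) t) (by linarith), phi'_zero_right (s := s (0+1) t)
      (by linarith), h'_zero]
    have : lam 0 t = 1 := by simp [lam]
    rw [this]; ring

lemma pde_pos {t : ℝ} (ht : 0 < t) (x y : ℝ) :
    deriv (fun r => uu (r, x, y)) t
      + iteratedDeriv 2 (fun z => uu (t, z, y)) x
      + l t * iteratedDeriv 2 (fun z => uu (t, x, z)) y
      + b1 (t, x, y) * deriv (fun z => uu (t, z, y)) x
      + b2 (t, x, y) * deriv (fun z => uu (t, x, z)) y
      + cc (t, x, y) * uu (t, x, y) = 0 := by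
  obtain ⟨k, hS⟩ := slab_exists ht
  have hg := hS.good
  have nk := (n_pos k).ne'
  have nk1 := (n_pos (k+1)).ne'
  unfold b1 b2 cc
  simp only [sumF_eq (p := (t, x, y)) hS, sumG_eq (p := (t, x, y)) hS]
  rw [uu_deriv_t hg]
  unfold HF HG
  by_cases hk : Even k
  · have hk1 : ¬ Even (k+1) := by simpa [Nat.even_add_one] using hk
    have e1 : (fun z => uu (t, z, y)) =
        fun z => AA k t * cos (n (k+1) * y) + BB k t * cos (n k * z) := by
      funext z; exact uu_even hg hk z y
    have e2 : (fun z => uu (t, x, z)) =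
        fun z => BB k t * cos (n k * x) + AA k t * cos (n (k+1) * z) := by
      funext z; rw [uu_even hg hk x z, add_comm]
    rw [e1, e2, uu_even hg hk, cosw_deriv2, cosw_deriv2, cosw_deriv, cosw_deriv,
      xc_even hk, xc_odd hk1]
    have hp : par k = 0 := by unfold par; rw [if_pos hk]
    have tp := time_part hS (n (k+1) * y) (n k * x)
    have l0 : lam k t = 1 := by unfold lam; rw [if_pos hk]
    have l1 : lam (k+1) t = l t := by unfold lam; rw [if_neg hk1]
    have kF := keyF k t (n (k+1) * y) (n k * x)
    have kG := keyG k t (n k * x) (n (k+1) * y)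
    rw [l0, l1] at tp
    rw [hp]
    have s1 := sin_sq_add_cos_sq (n (k+1) * y)
    have s0 := sin_sq_add_cos_sq (n k * x)
    generalize Hf (Lam k) (s (k+1) t) (n (k+1) * y) (n k * x) = F at *
    generalize Hf (Lam k) (1 - s (k+1) t) (n k * x) (n (k+1) * y) = G at *
    field_simp
    linear_combination (n k * n (k+1)) * (tp - q (k+1) * kF + q (k+1) * kG
      - q (k+1) * F * AA k t * s1 + q (k+1) * G * BB k t * s0)
  · have hk1 : Even (k+1) := by simpa [Nat.even_add_one] using hk
    have e1 : (fun z => uu (t, z, y)) =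
        fun z => BB k t * cos (n k * y) + AA k t * cos (n (k+1) * z) := by
      funext z; rw [uu_odd hg hk z y, add_comm]
    have e2 : (fun z => uu (t, x, z)) =
        fun z => AA k t * cos (n (k+1) * x) + BB k t * cos (n k * z) := by
      funext z; exact uu_odd hg hk x z
    rw [e1, e2, uu_odd hg hk, cosw_deriv2, cosw_deriv2, cosw_deriv, cosw_deriv,
      xc_even hk1, xc_odd hk]
    have hp : par k = 1 := by unfold par; rw [if_neg hk]
    have tp := time_part hS (n (k+1) * x) (n k * y)
    have l0 : lam k t = l t := by unfold lam; rw [if_neg hk]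
    have l1 : lam (k+1) t = 1 := by unfold lam; rw [if_pos hk1]
    have kF := keyF k t (n (k+1) * x) (n k * y)
    have kG := keyG k t (n k * y) (n (k+1) * x)
    rw [l0, l1] at tp
    rw [hp]
    have s1 := sin_sq_add_cos_sq (n (k+1) * x)
    have s0 := sin_sq_add_cos_sq (n k * y)
    generalize Hf (Lam k) (s (k+1) t) (n (k+1) * x) (n k * y) = F at *
    generalize Hf (Lam k) (1 - s (k+1) t) (n k * y) (n (k+1) * x) = G at *
    field_simp
    linear_combination (n k * n (k+1)) * (tp - q (k+1) * kF + q (k+1) * kG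
      - q (k+1) * F * AA k t * s1 + q (k+1) * G * BB k t * s0)

lemma pde_nonpos {t : ℝ} (ht : t ≤ 0) (x y : ℝ) :
    deriv (fun r => uu (r, x, y)) t
      + iteratedDeriv 2 (fun z => uu (t, z, y)) x
      + l t * iteratedDeriv 2 (fun z => uu (t, x, z)) y
      + b1 (t, x, y) * deriv (fun z => uu (t, z, y)) x
      + b2 (t, x, y) * deriv (fun z => uu (t, x, z)) y
      + cc (t, x, y) * uu (t, x, y) = 0 := by
  have e1 : (fun z => uu (t, z, y)) = fun z => 0 + 0 * cos (0 * z) := by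
    funext z; rw [uu_nonpos (p := (t, z, y)) ht]; simp
  have e2 : (fun z => uu (t, x, z)) = fun z => 0 + 0 * cos (0 * z) := by
    funext z; rw [uu_nonpos (p := (t, x, z)) ht]; simp
  have e3 : deriv (fun r => uu (r, x, y)) t = 0 := by
    have hd : Differentiable ℝ (fun r => uu (r, x, y)) :=
      (uu_CB.1.differentiable (by simp)).comp
        (differentiable_id.prodMk (differentiable_const (x, y)))
    have h1 : HasDerivWithinAt (fun r => uu (r, x, y)) (deriv (fun r => uu (r, x, y)) t)
      (Set.Iic t) t := (hd t).hasDerivAt.hasDerivWithinAt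
    have h2 : HasDerivWithinAt (fun r => uu (r, x, y)) 0 (Set.Iic t) t := by
      refine (hasDerivWithinAt_const t (Set.Iic t) (0:ℝ)).congr ?_ ?_
      · intro r hr; exact uu_nonpos (p := (r, x, y)) (le_trans hr ht)
      · exact uu_nonpos (p := (t, x, y)) ht
    exact (uniqueDiffOn_Iic t t Set.self_mem_Iic).eq_deriv _ h1 h2
  rw [e1, e2, e3, cosw_deriv2, cosw_deriv2, cosw_deriv,
    uu_nonpos (p := (t, x, y)) ht]
  simp

lemma pde (t x y : ℝ) :
    deriv (fun r => uu (r, x, y)) t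
      + iteratedDeriv 2 (fun z => uu (t, z, y)) x
      + l t * iteratedDeriv 2 (fun z => uu (t, x, z)) y
      + b1 (t, x, y) * deriv (fun z => uu (t, z, y)) x
      + b2 (t, x, y) * deriv (fun z => uu (t, x, z)) y
      + cc (t, x, y) * uu (t, x, y) = 0 := by
  rcases le_or_gt t 0 with h | h
  · exact pde_nonpos h x y
  · exact pde_pos h x y

lemma amp_zero {P B m y : ℝ} (hm : m ≠ 0)
    (h : (fun z => P + B * cos (m * z)) =ᶠ[𝓝 y] fun _ => 0) : B = 0 := by
  have h1 := h.deriv_eq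
  have h2 := (h.iteratedDeriv_eq 2)
  rw [cosw_deriv] at h1
  rw [cosw_deriv2] at h2
  simp only [deriv_const] at h1
  have h3 : iteratedDeriv 2 (fun _ : ℝ => (0:ℝ)) y = 0 := by
    rw [iteratedDeriv_succ, iteratedDeriv_one]; simp
  rw [h3] at h2
  have e1 : B * sin (m * y) = 0 := by
    have : m * (B * sin (m * y)) = 0 := by linarith
    exact (mul_eq_zero.1 this).resolve_left hm
  have e2 : B * cos (m * y) = 0 := by
    have : m^2 * (B * cos (m * y)) = 0 := by linarith
    exact (mul_eq_zero.1 this).resolve_left (pow_ne_zero 2 hm)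
  have := sin_sq_add_cos_sq (m * y)
  linear_combination (-B) * this + sin (m * y) * e1 + cos (m * y) * e2

lemma pos_mem_tsupport {t x y : ℝ} (ht : 0 < t) : (t, x, y) ∈ tsupport uu := by
  by_contra hn
  have h0 : uu =ᶠ[𝓝 (t, x, y)] 0 := notMem_tsupport_iff_eventuallyEq.1 hn
  obtain ⟨k, hS⟩ := slab_exists ht
  have hg := hS.good
  have c1 : Tendsto (fun z : ℝ => ((t, z, y) : E3)) (𝓝 x) (𝓝 (t, x, y)) :=
    Continuous.tendsto (by fun_prop) x
  have c2 : Tendsto (fun z : ℝ => ((t, x, z) : E3)) (𝓝 y) (𝓝 (t, x, y)) :=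
    Continuous.tendsto (by fun_prop) y
  have f1 : ∀ᶠ z in 𝓝 x, uu (t, z, y) = 0 := c1.eventually h0
  have f2 : ∀ᶠ z in 𝓝 y, uu (t, x, z) = 0 := c2.eventually h0
  have nk := (n_pos k).ne'
  have nk1 := (n_pos (k+1)).ne'
  have key : AA k t = 0 ∧ BB k t = 0 := by
    by_cases hk : Even k
    · constructor
      · refine amp_zero (P := BB k t * cos (n k * x)) (y := y) nk1 ?_
        filter_upwards [f2] with z hz
        rw [← hz, uu_even hg hk]; ring
      · refine amp_zero (P := AA k t * cos (n (k+1) * y)) (y := x) nk ?_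
        filter_upwards [f1] with z hz
        rw [← hz, uu_even hg hk]
    · constructor
      · refine amp_zero (P := BB k t * cos (n k * y)) (y := x) nk1 ?_
        filter_upwards [f1] with z hz
        rw [← hz, uu_odd hg hk]; ring
      · refine amp_zero (P := AA k t * cos (n (k+1) * x)) (y := y) nk ?_
        filter_upwards [f2] with z hz
        rw [← hz, uu_odd hg hk]
  unfold AA BB at key
  have k1 := (mul_eq_zero.1 key.1).resolve_left (exp_pos _).ne'
  have k2 := (mul_eq_zero.1 key.2).resolve_left (exp_pos _).ne'
  rcases lt_or_ge (1/5) (s (k+1) t) with hh | hh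
  · exact (phi_pos hh).ne' k2
  · exact (phi_pos (s := 1 - s (k+1) t) (by linarith)).ne' k1

lemma uu_tsupport : tsupport uu = {p : E3 | 0 ≤ p.1} := by
  apply Set.Subset.antisymm
  · refine closure_minimal ?_ (isClosed_le continuous_const continuous_fst)
    intro p hp
    by_contra hc
    exact hp (uu_nonpos (not_le.1 hc).le)
  · rintro ⟨t, x, y⟩ hp
    have hp : 0 ≤ t := hp
    have c : Tendsto (fun r : ℝ => ((t + r, x, y) : E3)) (𝓝[>] 0) (𝓝 (t, x, y)) := by
      have : Tendsto (fun r : ℝ => ((t + r, x, y) : E3)) (𝓝 0) (𝓝 (t + 0, x, y)) :=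
        Continuous.tendsto (by fun_prop) 0
      rw [add_zero] at this
      exact this.mono_left nhdsWithin_le_nhds
    refine (isClosed_tsupport uu).mem_of_tendsto c ?_
    filter_upwards [self_mem_nhdsWithin] with r hr
    have hr : 0 < r := hr
    exact pos_mem_tsupport (by linarith)

end BP
end

/-- There exists `l : ℝ → ℝ` belonging to `C^{0,α}(ℝ)` for every
`α ∈ [0,1)` and `C^∞` on `ℝ ∖ {0}`, with `1/2 ≤ l ≤ 3/2` and, for every `ε > 0`,
`|l'(t)| ≤ C_ε |t|^{−(1+ε)}` for all `t ≠ 0`, and there exist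
`u, b₁, b₂, c ∈ C^∞_b(ℝ_t × ℝ²_x)` with `supp u = {t ≥ 0}` such that
`∂_t u + ∂²_{x₁} u + l ∂²_{x₂} u + b₁ ∂_{x₁} u + b₂ ∂_{x₂} u + c u = 0` everywhere;
in particular this backward parabolic operator does not have the uniqueness
property from `t = 0`. -/
theorem stmt_11 :
    ∃ l : ℝ → ℝ,
      (∀ α : ℝ, 0 ≤ α → α < 1 → ∃ K : NNReal, HolderWith K α.toNNReal l) ∧
      ContDiffOn ℝ (⊤ : ℕ∞) l {(0:ℝ)}ᶜ ∧
      (∀ t : ℝ, 1/2 ≤ l t ∧ l t ≤ 3/2) ∧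
      (∀ ε > (0:ℝ), ∃ Cε > (0:ℝ), ∀ t : ℝ, t ≠ 0 →
        |deriv l t| ≤ Cε * |t| ^ (-(1 + ε))) ∧
      ∃ u b₁ b₂ c : ℝ → ℝ → ℝ → ℝ,
        CinftyB u ∧ CinftyB b₁ ∧ CinftyB b₂ ∧ CinftyB c ∧
        tsupport (fun p : ℝ × ℝ × ℝ => u p.1 p.2.1 p.2.2) =
          {p : ℝ × ℝ × ℝ | 0 ≤ p.1} ∧
        ∀ t x₁ x₂ : ℝ,
          deriv (fun s => u s x₁ x₂) t
            + iteratedDeriv 2 (fun y => u t y x₂) x₁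
            + l t * iteratedDeriv 2 (fun y => u t x₁ y) x₂
            + b₁ t x₁ x₂ * deriv (fun y => u t y x₂) x₁
            + b₂ t x₁ x₂ * deriv (fun y => u t x₁ y) x₂
            + c t x₁ x₂ * u t x₁ x₂ = 0 := by
  exact ⟨BP.l, BP.l_holder, BP.l_smooth, BP.l_bounds, BP.l_deriv_bound,
    fun t x y => BP.uu (t, x, y), fun t x y => BP.b1 (t, x, y), fun t x y => BP.b2 (t, x, y),
    fun t x y => BP.cc (t, x, y), BP.uu_CB, BP.b1_CB, BP.b2_CB, BP.cc_CB, BP.uu_tsupport, BP.pde⟩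
end

section
/- Fix an integer j₀ ≥ 2 and define a_n = −exp(−√(log(n+j₀))) and r_n = a_{n+1} − a_n for n ≥ 1. Then −1 < a_n < a_{n+1} < 0 for all n ≥ 1, lim_n a_n = 0, and lim_{n→∞} r_n·(n+j₀)·√(log(n+j₀))·exp(√(log(n+j₀))) = 1/2. -/
/-- The sequence `a_n = -exp(-√(log(n+j₀)))`. -/
noncomputable def aSeq (j₀ n : ℕ) : ℝ :=
  -Real.exp (-Real.sqrt (Real.log ((n : ℝ) + (j₀ : ℝ))))

/-- The sequence `r_n = a_{n+1} - a_n`. -/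
noncomputable def rSeq (j₀ n : ℕ) : ℝ := aSeq j₀ (n + 1) - aSeq j₀ n

open Filter Topology in
theorem aux_limit :
    Tendsto (fun x : ℝ => (-Real.exp (-Real.sqrt (Real.log (x + 1))) -
        -Real.exp (-Real.sqrt (Real.log x))) * x * Real.sqrt (Real.log x) *
        Real.exp (Real.sqrt (Real.log x))) atTop (𝓝 (1 / 2)) := by
  have hs : Tendsto (fun x : ℝ => Real.sqrt (Real.log x)) atTop atTop :=
    Real.tendsto_sqrt_atTop.comp Real.tendsto_log_atTop
  have hs' : Tendsto (fun x : ℝ => Real.sqrt (Real.log (x + 1))) atTop atTop :=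
    hs.comp (tendsto_atTop_add_const_right _ _ tendsto_id)
  have hsum := hs.atTop_add_atTop hs'
  have hinv := hsum.inv_tendsto_atTop
  have hxl : Tendsto (fun x : ℝ => x * Real.log (1 + 1 / x)) atTop (𝓝 1) :=
    Real.tendsto_mul_log_one_add_div_atTop 1
  have hl : Tendsto (fun x : ℝ => Real.log (1 + 1 / x)) atTop (𝓝 0) := by
    have h := hxl.mul tendsto_inv_atTop_zero
    rw [mul_zero] at h
    refine h.congr' ?_
    filter_upwards [eventually_gt_atTop 0] with x hx
    field_simp
  have key : ∀ᶠ x : ℝ in atTop, 0 < Real.sqrt (Real.log x) ∧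
      0 < Real.sqrt (Real.log (x + 1)) - Real.sqrt (Real.log x) ∧
      (Real.sqrt (Real.log (x + 1)) - Real.sqrt (Real.log x)) *
        (Real.sqrt (Real.log x) + Real.sqrt (Real.log (x + 1))) = Real.log (1 + 1 / x) := by
    filter_upwards [eventually_gt_atTop 1] with x hx
    have h1 : 0 < Real.log x := Real.log_pos hx
    have h2 : Real.log x < Real.log (x + 1) := Real.log_lt_log (by linarith) (by linarith)
    refine ⟨Real.sqrt_pos.2 h1, sub_pos.2 (Real.sqrt_lt_sqrt h1.le h2), ?_⟩
    have e1 := Real.sq_sqrt h1.le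
    have e2 := Real.sq_sqrt (h1.trans h2).le
    have e3 : 1 + 1 / x = (x + 1) / x := by field_simp
    rw [e3, Real.log_div (by linarith) (by linarith)]
    linear_combination e2 - e1
  have hd : Tendsto (fun x : ℝ => Real.sqrt (Real.log (x + 1)) - Real.sqrt (Real.log x))
      atTop (𝓝 0) := by
    have h := hl.mul hinv
    rw [mul_zero] at h
    refine h.congr' ?_
    filter_upwards [key] with x ⟨h1, h2, h3⟩
    rw [← h3]
    simp only [Pi.inv_apply]
    have : Real.sqrt (Real.log x) + Real.sqrt (Real.log (x + 1)) ≠ 0 := by linarith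
    field_simp
  have hd' : Tendsto (fun x : ℝ => Real.sqrt (Real.log (x + 1)) - Real.sqrt (Real.log x))
      atTop (𝓝[≠] 0) := by
    refine tendsto_nhdsWithin_iff.2 ⟨hd, ?_⟩
    filter_upwards [key] with x hx
    exact hx.2.1.ne'
  have hder : HasDerivAt (fun y : ℝ => 1 - Real.exp (-y)) 1 0 := by
    have := ((hasDerivAt_id (0 : ℝ)).neg.exp).const_sub 1
    simpa using this
  have hslope := hder.tendsto_slope_zero.comp hd'
  have hfrac := (hd.mul hinv).const_mul (1 / 2) |>.const_sub (1 / 2)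
  have hall := (hslope.mul hxl).mul hfrac
  norm_num at hall
  refine hall.congr' ?_
  filter_upwards [key, eventually_gt_atTop 0] with x ⟨h1, h2, h3⟩ hx
  have h4 : Real.log (1 + x⁻¹) = (Real.sqrt (Real.log (x + 1)) - Real.sqrt (Real.log x)) *
        (Real.sqrt (Real.log x) + Real.sqrt (Real.log (x + 1))) := by rw [h3, one_div]
  have hE : Real.exp (-Real.sqrt (Real.log x)) * Real.exp (Real.sqrt (Real.log x)) = 1 := by
    rw [← Real.exp_add]; simp
  have hE' : Real.exp (-Real.sqrt (Real.log (x + 1))) * Real.exp (Real.sqrt (Real.log x)) =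
      Real.exp (Real.sqrt (Real.log x) - Real.sqrt (Real.log (x + 1))) := by
    rw [← Real.exp_add]; ring_nf
  rw [h4]
  have hR : (-Real.exp (-Real.sqrt (Real.log (x + 1))) -
        -Real.exp (-Real.sqrt (Real.log x))) * x * Real.sqrt (Real.log x) *
        Real.exp (Real.sqrt (Real.log x)) =
      (1 - Real.exp (Real.sqrt (Real.log x) - Real.sqrt (Real.log (x + 1)))) * x *
        Real.sqrt (Real.log x) := by
    linear_combination x * Real.sqrt (Real.log x) * (hE - hE')
  norm_num
  norm_num at hR
  rw [hR]
  generalize Real.exp (Real.sqrt (Real.log x) - Real.sqrt (Real.log (x + 1))) = E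
  generalize Real.sqrt (Real.log (x + 1)) = t at *
  generalize Real.sqrt (Real.log x) = s at *
  have : s + t ≠ 0 := by linarith
  have : t - s ≠ 0 := h2.ne'
  field_simp
  ring

/-- Fix an integer `j₀ ≥ 2` and define `a_n = −exp(−√(log(n+j₀)))` and
`r_n = a_{n+1} − a_n` for `n ≥ 1`. Then `−1 < a_n < a_{n+1} < 0` for all `n ≥ 1`,
`lim_n a_n = 0`, and `lim_n r_n (n+j₀) √(log(n+j₀)) exp(√(log(n+j₀))) = 1/2`. -/
theorem stmt_13 (j₀ : ℕ) (hj₀ : 2 ≤ j₀) :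
    (∀ n : ℕ, 1 ≤ n →
      -1 < aSeq j₀ n ∧ aSeq j₀ n < aSeq j₀ (n + 1) ∧ aSeq j₀ (n + 1) < 0) ∧
    Filter.Tendsto (fun n : ℕ => aSeq j₀ n) Filter.atTop (nhds 0) ∧
    Filter.Tendsto
      (fun n : ℕ => rSeq j₀ n * ((n : ℝ) + (j₀ : ℝ)) *
        Real.sqrt (Real.log ((n : ℝ) + (j₀ : ℝ))) *
        Real.exp (Real.sqrt (Real.log ((n : ℝ) + (j₀ : ℝ)))))
      Filter.atTop (nhds (1 / 2)) := by
  have hlog : ∀ n : ℕ, 0 < Real.log ((n : ℝ) + (j₀ : ℝ)) := by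
    intro n
    apply Real.log_pos
    have : (2 : ℝ) ≤ j₀ := by exact_mod_cast hj₀
    have : (0 : ℝ) ≤ n := n.cast_nonneg
    linarith
  have hx : Filter.Tendsto (fun n : ℕ => (n : ℝ) + (j₀ : ℝ)) Filter.atTop Filter.atTop :=
    Filter.tendsto_atTop_add_const_right _ _ tendsto_natCast_atTop_atTop
  refine ⟨fun n _ => ⟨?_, ?_, ?_⟩, ?_, ?_⟩
  · unfold aSeq
    rw [neg_lt_neg_iff, Real.exp_lt_one_iff, neg_lt_zero]
    exact Real.sqrt_pos.2 (hlog n)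
  · unfold aSeq
    rw [neg_lt_neg_iff, Real.exp_lt_exp, neg_lt_neg_iff]
    apply Real.sqrt_lt_sqrt (hlog n).le
    apply Real.log_lt_log
    · have : (2 : ℝ) ≤ j₀ := by exact_mod_cast hj₀
      positivity
    · push_cast
      linarith
  · unfold aSeq
    exact neg_lt_zero.2 (Real.exp_pos _)
  · have h := (Real.tendsto_exp_neg_atTop_nhds_zero.comp
      (Real.tendsto_sqrt_atTop.comp (Real.tendsto_log_atTop.comp hx))).neg
    rw [neg_zero] at h
    exact h
  · refine (aux_limit.comp hx).congr fun n => ?_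
    simp only [Function.comp, rSeq, aSeq]
    push_cast
    rw [add_right_comm]
end

section
/- Fix an integer j₀ ≥ 2 and define a_n = −exp(−√(log(n+j₀))), z_n = (n+j₀)³, r_n = a_{n+1} − a_n, and p_n = (z_{n+1} − z_n)·r_n for n ≥ 1. Then: (i) lim_{n→∞} p_n·√(log(n+j₀))·exp(√(log(n+j₀)))/(n+j₀) = 3/2; (ii) lim_{n→∞} (n+j₀)·p_n/(r_n·z_n) = 3; and (iii) for every δ > 0 there exists an integer j₀* ≥ 2 such that for all j₀ ≥ j₀*, sup_{n ≥ 1} p_n/(r_n·z_n) ≤ δ. -/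
/-- The sequence `z_n = (n+j₀)³`. -/
noncomputable def zSeq (j₀ n : ℕ) : ℝ := ((n : ℝ) + (j₀ : ℝ)) ^ 3

/-- The sequence `p_n = (z_{n+1} - z_n) r_n`. -/
noncomputable def pSeq (j₀ n : ℕ) : ℝ := (zSeq j₀ (n + 1) - zSeq j₀ n) * rSeq j₀ n

lemma aux_rpos (j n : ℕ) (hj : 2 ≤ j) : 0 < rSeq j n := by
  have hj' : (2:ℝ) ≤ j := by exact_mod_cast hj
  have hn : (0:ℝ) ≤ n := Nat.cast_nonneg n
  unfold rSeq aSeq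
  have h : Real.sqrt (Real.log ((n : ℝ) + (j : ℝ))) < Real.sqrt (Real.log (((n+1:ℕ) : ℝ) + (j : ℝ))) := by
    apply Real.sqrt_lt_sqrt (Real.log_nonneg (by linarith))
    apply Real.log_lt_log (by linarith)
    push_cast; linarith
  have := Real.exp_lt_exp.2 (neg_lt_neg h)
  linarith

lemma aux_ratio (j n : ℕ) (hj : 2 ≤ j) : pSeq j n / (rSeq j n * zSeq j n)
    = (3 * ((n:ℝ)+j)^2 + 3 * ((n:ℝ)+j) + 1) / ((n:ℝ)+j)^3 := by
  have hr := (aux_rpos j n hj).ne'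
  have hj' : (2:ℝ) ≤ j := by exact_mod_cast hj
  have hn : (0:ℝ) ≤ n := Nat.cast_nonneg n
  have hx : ((n:ℝ)+j) ≠ 0 := by linarith
  unfold pSeq zSeq
  push_cast
  field_simp
  ring

lemma aux_lim : Filter.Tendsto (fun x : ℝ => (3 * x^2 + 3 * x + 1) / x^2) Filter.atTop (nhds 3) := by
  have h1 : Filter.Tendsto (fun x : ℝ => x⁻¹) Filter.atTop (nhds 0) := tendsto_inv_atTop_zero
  have h2 : Filter.Tendsto (fun x : ℝ => 3 + 3 * x⁻¹ + x⁻¹ * x⁻¹) Filter.atTop (nhds (3 + 3 * 0 + 0 * 0)) :=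
    (tendsto_const_nhds.add (tendsto_const_nhds.mul h1)).add (h1.mul h1)
  norm_num at h2
  refine h2.congr' ?_
  filter_upwards [Filter.eventually_gt_atTop 0] with x hx
  field_simp

lemma aux_shift (j : ℕ) : Filter.Tendsto (fun n : ℕ => (n:ℝ) + (j:ℝ)) Filter.atTop Filter.atTop :=
  Filter.tendsto_atTop_add_const_right _ _ tendsto_natCast_atTop_atTop

lemma aux_main : Filter.Tendsto (fun x : ℝ =>
    ((x+1)^3 - x^3) * (Real.exp (-√(Real.log x)) - Real.exp (-√(Real.log (x+1)))) * √(Real.log x)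
      * Real.exp (√(Real.log x)) / x) Filter.atTop (nhds (3/2)) := by
  have hs : Filter.Tendsto (fun x : ℝ => √(Real.log x)) Filter.atTop Filter.atTop :=
    Real.tendsto_sqrt_atTop.comp Real.tendsto_log_atTop
  have hxL : Filter.Tendsto (fun x : ℝ => x * Real.log (1 + 1/x)) Filter.atTop (nhds 1) :=
    Real.tendsto_mul_log_one_add_div_atTop 1
  have hinv : Filter.Tendsto (fun x : ℝ => x⁻¹) Filter.atTop (nhds 0) := tendsto_inv_atTop_zero
  have hL : Filter.Tendsto (fun x : ℝ => Real.log (1 + 1/x)) Filter.atTop (nhds 0) := by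
    have := hinv.mul hxL
    rw [zero_mul] at this
    refine this.congr' ?_
    filter_upwards [Filter.eventually_gt_atTop 0] with x hx
    field_simp
  have key : ∀ x : ℝ, 1 < x → Real.log (x+1) = Real.log x + Real.log (1+1/x) := by
    intro x hx
    rw [← Real.log_mul (by linarith) (by positivity)]
    congr 1; field_simp
  have hu : Filter.Tendsto (fun x : ℝ => (√(Real.log x))⁻¹) Filter.atTop (nhds 0) :=
    tendsto_inv_atTop_zero.comp hs
  -- ratio t/s
  have hq : Filter.Tendsto (fun x : ℝ => √(Real.log (x+1)) / √(Real.log x)) Filter.atTop (nhds 1) := by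
    have h1 : Filter.Tendsto (fun x : ℝ => √(1 + Real.log (1+1/x) * (Real.log x)⁻¹)) Filter.atTop
        (nhds (√(1 + 0 * 0))) :=
      (tendsto_const_nhds.add (hL.mul (tendsto_inv_atTop_zero.comp Real.tendsto_log_atTop))).sqrt
    norm_num at h1
    refine h1.congr' ?_
    filter_upwards [Filter.eventually_gt_atTop 1] with x hx
    have hl := Real.log_pos hx
    rw [← Real.sqrt_div' _ hl.le, key x hx]
    congr 1
    field_simp
  have hhalf : Filter.Tendsto (fun x : ℝ => √(Real.log x) / (√(Real.log (x+1)) + √(Real.log x)))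
      Filter.atTop (nhds (1/2)) := by
    have h1 : Filter.Tendsto (fun x : ℝ => (√(Real.log (x+1)) / √(Real.log x) + 1)⁻¹) Filter.atTop
        (nhds ((1+1)⁻¹)) := (hq.add tendsto_const_nhds).inv₀ (by norm_num)
    norm_num at h1 ⊢
    refine h1.congr' ?_
    filter_upwards [Filter.eventually_gt_atTop 1] with x hx
    have hl := Real.sqrt_pos.2 (Real.log_pos hx)
    have ht := Real.sqrt_nonneg (Real.log (x+1))
    field_simp
  have hdeq : ∀ x : ℝ, 1 < x → √(Real.log (x+1)) - √(Real.log x)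
      = Real.log (1+1/x) / (√(Real.log (x+1)) + √(Real.log x)) := by
    intro x hx
    have hl := Real.sqrt_pos.2 (Real.log_pos hx)
    have ht := Real.sqrt_nonneg (Real.log (x+1))
    rw [eq_div_iff (by positivity)]
    have e1 := Real.sq_sqrt (Real.log_pos hx).le
    have e2 := Real.sq_sqrt (Real.log_pos (show 1 < x + 1 by linarith)).le
    have := key x hx
    nlinarith
  have hdpos : ∀ x : ℝ, 1 < x → 0 < √(Real.log (x+1)) - √(Real.log x) := by
    intro x hx
    have := Real.sqrt_lt_sqrt (Real.log_pos hx).le (Real.log_lt_log (by linarith) (show x < x+1 by linarith))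
    linarith
  have hd0 : Filter.Tendsto (fun x : ℝ => √(Real.log (x+1)) - √(Real.log x)) Filter.atTop (nhds 0) := by
    have h1 := (hL.mul hhalf).mul hu
    norm_num at h1
    refine h1.congr' ?_
    filter_upwards [Filter.eventually_gt_atTop 1] with x hx
    have hl := Real.sqrt_pos.2 (Real.log_pos hx)
    have ht := Real.sqrt_nonneg (Real.log (x+1))
    rw [hdeq x hx]
    field_simp
  have hd : Filter.Tendsto (fun x : ℝ => √(Real.log (x+1)) - √(Real.log x)) Filter.atTop
      (nhdsWithin 0 {0}ᶜ) := by
    refine tendsto_nhdsWithin_iff.2 ⟨hd0, ?_⟩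
    filter_upwards [Filter.eventually_gt_atTop 1] with x hx
    exact (hdpos x hx).ne'
  have hslope : Filter.Tendsto (fun d : ℝ => (1 - Real.exp (-d)) / d) (nhdsWithin 0 {0}ᶜ) (nhds 1) := by
    have h : HasDerivAt (fun d : ℝ => 1 - Real.exp (-d)) 1 0 := by
      have := ((hasDerivAt_neg (0:ℝ)).exp).const_sub 1
      simpa using this
    have := hasDerivAt_iff_tendsto_slope.1 h
    refine this.congr ?_
    intro d
    simp [slope_def_field]
  have hE := hslope.comp hd
  have hfin := ((aux_lim.mul hxL).mul hhalf).mul hE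
  have e : (3 * 1 * (1/2) * 1 : ℝ) = 3/2 := by norm_num
  rw [e] at hfin
  refine hfin.congr' ?_
  filter_upwards [Filter.eventually_gt_atTop 1] with x hx
  have hl := Real.sqrt_pos.2 (Real.log_pos hx)
  have ht := Real.sqrt_nonneg (Real.log (x+1))
  have hdp := hdpos x hx
  have hLe : Real.log (1+1/x) = (√(Real.log (x+1)) - √(Real.log x)) * (√(Real.log (x+1)) + √(Real.log x)) := by
    rw [hdeq x hx]; field_simp
  have hexp : (Real.exp (-√(Real.log x)) - Real.exp (-√(Real.log (x+1)))) * Real.exp (√(Real.log x))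
      = 1 - Real.exp (-(√(Real.log (x+1)) - √(Real.log x))) := by
    rw [sub_mul, ← Real.exp_add, ← Real.exp_add]
    congr 1
    · simp
    · congr 1; ring
  rw [mul_right_comm _ (√(Real.log x)), mul_assoc ((x+1)^3 - x^3), hexp, Function.comp, hLe]
  generalize √(Real.log (x+1)) = t at *
  generalize √(Real.log x) = s at *
  have h3 : t + s ≠ 0 := by positivity
  have h4 := hdp.ne'
  generalize 1 - Real.exp (-(t - s)) = E
  field_simp
  ring

/-- Fix an integer `j₀ ≥ 2` and define `a_n`, `z_n`, `r_n`, `p_n` as above.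
Then (i) `lim_n p_n √(log(n+j₀)) exp(√(log(n+j₀)))/(n+j₀) = 3/2`;
(ii) `lim_n (n+j₀) p_n/(r_n z_n) = 3`; and (iii) for every `δ > 0` there exists an
integer `j₀* ≥ 2` such that for all `j₀ ≥ j₀*`, `sup_{n ≥ 1} p_n/(r_n z_n) ≤ δ`. -/
theorem stmt_14 (j₀ : ℕ) (hj₀ : 2 ≤ j₀) :
    Filter.Tendsto
      (fun n : ℕ => pSeq j₀ n * Real.sqrt (Real.log ((n : ℝ) + (j₀ : ℝ))) *
        Real.exp (Real.sqrt (Real.log ((n : ℝ) + (j₀ : ℝ)))) / ((n : ℝ) + (j₀ : ℝ)))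
      Filter.atTop (nhds (3 / 2)) ∧
    Filter.Tendsto
      (fun n : ℕ => ((n : ℝ) + (j₀ : ℝ)) * pSeq j₀ n / (rSeq j₀ n * zSeq j₀ n))
      Filter.atTop (nhds 3) ∧
    (∀ δ > (0:ℝ), ∃ j₀s : ℕ, 2 ≤ j₀s ∧ ∀ j₀' : ℕ, j₀s ≤ j₀' →
      ∀ n : ℕ, 1 ≤ n → pSeq j₀' n / (rSeq j₀' n * zSeq j₀' n) ≤ δ) := by
  refine ⟨?_, ?_, ?_⟩
  · refine (aux_main.comp (aux_shift j₀)).congr ?_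
    intro n
    simp only [Function.comp, pSeq, rSeq, zSeq, aSeq]
    push_cast
    rw [show (n:ℝ) + 1 + j₀ = n + j₀ + 1 by ring]
    ring
  · refine (aux_lim.comp (aux_shift j₀)).congr ?_
    intro n
    have hj' : (2:ℝ) ≤ j₀ := by exact_mod_cast hj₀
    have hn : (0:ℝ) ≤ n := Nat.cast_nonneg n
    have hx : ((n:ℝ)+j₀) ≠ 0 := by linarith
    rw [mul_div_assoc, aux_ratio j₀ n hj₀, Function.comp]
    field_simp
  · intro δ hδ
    obtain ⟨N, hN⟩ := exists_nat_gt (7 / δ)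
    refine ⟨max 2 N, le_max_left _ _, ?_⟩
    intro j hj n _
    have hj2 : 2 ≤ j := (le_max_left _ _).trans hj
    have hjN : (N:ℝ) ≤ j := by exact_mod_cast (le_max_right _ _).trans hj
    have hj' : (2:ℝ) ≤ j := by exact_mod_cast hj2
    have hn : (0:ℝ) ≤ n := Nat.cast_nonneg n
    rw [aux_ratio j n hj2]
    have h7 : 7 < δ * ((n:ℝ)+j) := by
      have := (div_lt_iff₀' hδ).1 (hN.trans_le (hjN.trans (le_add_of_nonneg_left hn)))
      exact this
    have hx : 2 ≤ (n:ℝ)+j := by linarith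
    generalize (n:ℝ)+j = x at *
    rw [div_le_iff₀ (by positivity)]
    have : 7 * x^2 ≤ δ * x * x^2 := by gcongr
    nlinarith
end

section
/- Fix an integer j₀ ≥ 2 and define a_n = −exp(−√(log(n+j₀))), z_n = (n+j₀)³, r_n = a_{n+1} − a_n, p_n = (z_{n+1} − z_n)·r_n, q₁ = 0 and q_n = Σ_{k=2}^n z_k·r_{k−1} for n ≥ 2. Then there exists an integer j₀* ≥ 2 such that for every j₀ ≥ j₀* there is a constant λ > 0 with: q_n ≥ λ·(n+j₀)^{7/4} for all n ≥ 2, and p_n ≤ λ⁻¹·(n+j₀)^{5/4} for all n ≥ 1; moreover p_n > 1 for all n ≥ 1. -/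
/-- The sequence `q₁ = 0`, `q_n = Σ_{k=2}^n z_k r_{k-1}` for `n ≥ 2`. -/
noncomputable def qSeq (j₀ n : ℕ) : ℝ := ∑ k ∈ Finset.Icc 2 n, zSeq j₀ k * rSeq j₀ (k - 1)

lemma f_hasDeriv (t : ℝ) (ht : 3 ≤ t) :
    HasDerivAt (fun t : ℝ => -Real.exp (-Real.sqrt (Real.log t)))
      (Real.exp (-Real.sqrt (Real.log t)) / (2 * t * Real.sqrt (Real.log t))) t := by
  have hl : 0 < Real.log t := Real.log_pos (by linarith)
  have hs : 0 < Real.sqrt (Real.log t) := Real.sqrt_pos.2 hl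
  have h := (((Real.hasDerivAt_log (by linarith : t ≠ 0)).sqrt hl.ne').neg.exp).neg
  have e : Real.exp (-Real.sqrt (Real.log t)) / (2 * t * Real.sqrt (Real.log t)) =
      -(Real.exp (-Real.sqrt (Real.log t)) * -(t⁻¹ / (2 * Real.sqrt (Real.log t)))) := by
    field_simp
  rw [e]
  exact h

lemma r_bounds (x : ℝ) (hx : 3 ≤ x) :
    Real.exp (-4) * (x + 1) ^ (-(5:ℝ)/4) ≤
      -Real.exp (-Real.sqrt (Real.log (x + 1))) - -Real.exp (-Real.sqrt (Real.log x)) ∧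
    -Real.exp (-Real.sqrt (Real.log (x + 1))) - -Real.exp (-Real.sqrt (Real.log x)) ≤ 1 / x := by
  obtain ⟨c, hc, h⟩ := exists_hasDerivAt_eq_slope
    (fun t : ℝ => -Real.exp (-Real.sqrt (Real.log t)))
    (fun t => Real.exp (-Real.sqrt (Real.log t)) / (2 * t * Real.sqrt (Real.log t)))
    (by linarith : x < x + 1)
    (fun t ht => (f_hasDeriv t (by linarith [ht.1])).continuousAt.continuousWithinAt)
    (fun t ht => f_hasDeriv t (by linarith [ht.1]))
  rw [add_sub_cancel_left, div_one] at h
  rw [← h]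
  have hcx : x < c := hc.1
  have hc1 : c < x + 1 := hc.2
  have hc0 : 0 < c := by linarith
  have hl : 1 ≤ Real.log c := by
    rw [Real.le_log_iff_exp_le hc0]
    linarith [Real.exp_one_lt_d9]
  have hsq : Real.sqrt (Real.log c) ^ 2 = Real.log c := Real.sq_sqrt (by linarith)
  have hs1 : 1 ≤ Real.sqrt (Real.log c) := Real.one_le_sqrt.2 hl
  generalize Real.sqrt (Real.log c) = s at *
  have hs0 : 0 < s := by linarith
  constructor
  · have h1 : Real.exp (-4) * (x + 1) ^ (-(5:ℝ)/4) ≤ Real.exp (-4) * c ^ (-(5:ℝ)/4) := by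
      apply mul_le_mul_of_nonneg_left _ (Real.exp_pos _).le
      exact Real.rpow_le_rpow_of_nonpos hc0 hc1.le (by norm_num)
    refine h1.trans ?_
    have h2 : 2 * s ≤ Real.exp s := by
      have := Real.quadratic_le_exp_of_nonneg hs0.le
      nlinarith [sq_nonneg (s - 1)]
    have h3 : Real.exp (-4) * c ^ (-(5:ℝ)/4) ≤ Real.exp (-2 * s) / c := by
      rw [Real.rpow_def_of_pos hc0, ← Real.exp_add]
      conv_rhs => rw [← Real.exp_log hc0, ← Real.exp_sub]
      apply Real.exp_le_exp.2
      nlinarith [sq_nonneg (s / 2 - 2)]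
    refine h3.trans ?_
    rw [div_le_div_iff₀ hc0 (by positivity)]
    have h4 : Real.exp (-s) = Real.exp (-2 * s) * Real.exp s := by
      rw [← Real.exp_add]; ring_nf
    rw [h4]
    have : 0 ≤ Real.exp (-2 * s) * c := by positivity
    nlinarith
  · have he : Real.exp (-s) ≤ 1 := Real.exp_le_one_iff.2 (by linarith)
    rw [div_le_div_iff₀ (by positivity) (by linarith)]
    nlinarith [Real.exp_pos (-s)]

/-- There exists an integer `j₀* ≥ 2` such that for every `j₀ ≥ j₀*`
there is a constant `λ > 0` with `q_n ≥ λ (n+j₀)^{7/4}` for all `n ≥ 2` and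
`p_n ≤ λ⁻¹ (n+j₀)^{5/4}` for all `n ≥ 1`; moreover `p_n > 1` for all `n ≥ 1`. -/
theorem stmt_15 :
    ∃ j₀s : ℕ, 2 ≤ j₀s ∧ ∀ j₀ : ℕ, j₀s ≤ j₀ →
      (∃ lam > (0:ℝ),
        (∀ n : ℕ, 2 ≤ n → lam * ((n : ℝ) + (j₀ : ℝ)) ^ ((7:ℝ)/4) ≤ qSeq j₀ n) ∧
        (∀ n : ℕ, 1 ≤ n → pSeq j₀ n ≤ lam⁻¹ * ((n : ℝ) + (j₀ : ℝ)) ^ ((5:ℝ)/4))) ∧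
      (∀ n : ℕ, 1 ≤ n → 1 < pSeq j₀ n) := by
  have hE : Real.exp 4 = Real.exp 1 ^ 4 := by
    rw [← Real.exp_nat_mul]; norm_num
  have hlo : (7:ℝ) ≤ Real.exp 4 := by
    rw [hE]
    calc (7:ℝ) ≤ 2 ^ 4 := by norm_num
      _ ≤ _ := pow_le_pow_left₀ (by norm_num) (by linarith [Real.exp_one_gt_d9]) 4
  have hhi : Real.exp 4 < 512 := by
    rw [hE]
    calc Real.exp 1 ^ 4 ≤ 3 ^ 4 :=
          pow_le_pow_left₀ (Real.exp_pos _).le (by linarith [Real.exp_one_lt_d9]) 4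
      _ < 512 := by norm_num
  refine ⟨4096, by norm_num, fun j₀ hj => ?_⟩
  have hj' : (4096:ℝ) ≤ j₀ := by exact_mod_cast hj
  have hr : ∀ n : ℕ, Real.exp (-4) * ((n:ℝ) + j₀ + 1) ^ (-(5:ℝ)/4) ≤ rSeq j₀ n ∧
      rSeq j₀ n ≤ 1 / ((n:ℝ) + j₀) := by
    intro n
    have hn : (0:ℝ) ≤ n := n.cast_nonneg
    have := r_bounds ((n:ℝ) + j₀) (by linarith)
    have e : ((n + 1 : ℕ) : ℝ) + j₀ = (n:ℝ) + j₀ + 1 := by push_cast; ring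
    unfold rSeq aSeq
    rw [e]
    exact this
  have hr0 : ∀ n : ℕ, 0 ≤ rSeq j₀ n := fun n => le_trans (by positivity) (hr n).1
  refine ⟨⟨Real.exp (-4), Real.exp_pos _, ?_, ?_⟩, ?_⟩
  · intro n hn
    have h1 : zSeq j₀ n * rSeq j₀ (n - 1) ≤ qSeq j₀ n := by
      unfold qSeq
      apply Finset.single_le_sum (f := fun k => zSeq j₀ k * rSeq j₀ (k - 1)) (s := Finset.Icc 2 n)
      · intro k _
        exact mul_nonneg (by unfold zSeq; positivity) (hr0 _)
      · exact Finset.mem_Icc.2 ⟨hn, le_rfl⟩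
    refine le_trans ?_ h1
    have h2 := (hr (n - 1)).1
    have e : ((n - 1 : ℕ) : ℝ) + j₀ + 1 = (n:ℝ) + j₀ := by
      rw [Nat.cast_sub (by omega)]; push_cast; ring
    rw [e] at h2
    have hy : (0:ℝ) < (n:ℝ) + j₀ := by positivity
    have e2 : ((n:ℝ) + j₀) ^ ((7:ℝ)/4) = ((n:ℝ) + j₀) ^ 3 * ((n:ℝ) + j₀) ^ (-(5:ℝ)/4) := by
      rw [← Real.rpow_natCast, ← Real.rpow_add hy]; norm_num
    rw [e2]
    unfold zSeq
    have := mul_le_mul_of_nonneg_left h2 (by positivity : 0 ≤ ((n:ℝ) + j₀) ^ 3)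
    linarith
  · intro n _
    have hn : (0:ℝ) ≤ n := n.cast_nonneg
    have h2 := (hr n).2
    unfold pSeq zSeq
    push_cast
    rw [Real.exp_neg, inv_inv]
    set x : ℝ := (n:ℝ) + j₀ with hx
    have hx1 : 4096 ≤ x := by linarith
    have e : (n:ℝ) + 1 + j₀ = x + 1 := by rw [hx]; ring
    rw [e]
    have h3 : x ≤ x ^ ((5:ℝ)/4) := by
      conv_lhs => rw [← Real.rpow_one x]
      exact Real.rpow_le_rpow_of_exponent_le (by linarith) (by norm_num)
    calc ((x + 1) ^ 3 - x ^ 3) * rSeq j₀ n ≤ (7 * x ^ 2) * (1 / x) := by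
          apply mul_le_mul _ h2 (hr0 n) (by positivity)
          nlinarith
      _ = 7 * x := by field_simp
      _ ≤ Real.exp 4 * x ^ ((5:ℝ)/4) := mul_le_mul hlo h3 (by linarith) (Real.exp_pos _).le
  · intro n _
    have hn : (0:ℝ) ≤ n := n.cast_nonneg
    have h1 := (hr n).1
    unfold pSeq zSeq
    push_cast
    have e : (n:ℝ) + 1 + j₀ = (n:ℝ) + j₀ + 1 := by ring
    rw [e]
    set x : ℝ := (n:ℝ) + j₀ with hx
    have hx1 : 4096 ≤ x := by linarith
    have hy : 0 < x + 1 := by linarith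
    have h4 : (512:ℝ) ≤ (x + 1) ^ ((3:ℝ)/4) := by
      have e3 : (512:ℝ) = 4096 ^ ((3:ℝ)/4) := by
        rw [show (4096:ℝ) = 2 ^ (12:ℝ) by norm_num, ← Real.rpow_mul (by norm_num)]
        norm_num
      rw [e3]
      exact Real.rpow_le_rpow (by norm_num) (by linarith) (by norm_num)
    have e2 : (x + 1) ^ ((3:ℝ)/4) = (x + 1) ^ 2 * (x + 1) ^ (-(5:ℝ)/4) := by
      rw [← Real.rpow_natCast, ← Real.rpow_add hy]; norm_num
    calc (1:ℝ) = Real.exp (-4) * Real.exp 4 := by rw [← Real.exp_add]; norm_num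
      _ < Real.exp (-4) * (x + 1) ^ ((3:ℝ)/4) :=
          mul_lt_mul_of_pos_left (by linarith) (Real.exp_pos _)
      _ = (x + 1) ^ 2 * (Real.exp (-4) * (x + 1) ^ (-(5:ℝ)/4)) := by rw [e2]; ring
      _ ≤ ((x + 1) ^ 3 - x ^ 3) * rSeq j₀ n := by
          apply mul_le_mul _ h1 (by positivity) _
          · nlinarith
          · nlinarith
end

section
/- Fix an integer j₀ ≥ 2 sufficiently large and define a_n = −exp(−√(log(n+j₀))), z_n = (n+j₀)³, r_n = a_{n+1} − a_n, p_n = (z_{n+1} − z_n)·r_n, q₁ = 0 and q_n = Σ_{k=2}^n z_k·r_{k−1} for n ≥ 2. Then for all real α, β, γ > 0, lim_{n→∞} exp(−q_n + 2p_n)·z_{n+1}^α·p_n^β·r_n^{−γ} = 0. -/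
lemma deriv_bounds (c : ℝ) (hc : 3 < c) :
    ∃ d : ℝ, HasDerivAt (fun x : ℝ => -Real.exp (-Real.sqrt (Real.log x))) d c ∧
      1 / (4 * c ^ 2) ≤ d ∧ d ≤ 1 / (2 * c) := by
  have hc0 : 0 < c := by linarith
  have hL : 1 ≤ Real.log c := by
    rw [Real.le_log_iff_exp_le hc0]
    linarith [Real.exp_one_lt_d9]
  set s := Real.sqrt (Real.log c) with hs
  have hs1 : 1 ≤ s := by rw [hs]; exact Real.one_le_sqrt.mpr hL
  have hs2 : s ^ 2 = Real.log c := Real.sq_sqrt (by linarith)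
  have h1 := (((Real.hasDerivAt_log hc0.ne').sqrt (by linarith)).neg.exp).neg
  refine ⟨_, h1, ?_, ?_⟩
  · have e1 : Real.exp (-s) * c = Real.exp (s ^ 2 - s) := by
      rw [sub_eq_add_neg, Real.exp_add, hs2, Real.exp_log hc0, mul_comm]
    have e2 := Real.add_one_le_exp (s ^ 2 - s)
    have e3 : s ≤ 2 * (Real.exp (-s) * c) := by
      rw [e1]; nlinarith [sq_nonneg (s - 3 / 4)]
    have e4 : -(Real.exp (-s) * -(c⁻¹ / (2 * s))) = Real.exp (-s) / (2 * c * s) := by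
      field_simp
    change _ ≤ -(Real.exp (-s) * -(c⁻¹ / (2 * s)))
    rw [e4, div_le_div_iff₀ (by positivity) (by positivity)]
    nlinarith
  · have e4 : -(Real.exp (-s) * -(c⁻¹ / (2 * s))) = Real.exp (-s) / (2 * c * s) := by
      field_simp
    have e5 : Real.exp (-s) ≤ 1 := Real.exp_le_one_iff.mpr (by linarith)
    change -(Real.exp (-s) * -(c⁻¹ / (2 * s))) ≤ _
    rw [e4]
    apply div_le_div₀ zero_le_one e5 (by positivity)
    nlinarith

lemma r_bounds_s16 (j n : ℕ) (hj : 3 ≤ j) :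
    1 / (4 * ((n : ℝ) + j + 1) ^ 2) ≤ rSeq j n ∧ rSeq j n ≤ 1 / (2 * ((n : ℝ) + j)) := by
  have hj' : (3 : ℝ) ≤ j := by exact_mod_cast hj
  have hn : (0 : ℝ) ≤ n := Nat.cast_nonneg n
  set x : ℝ := (n : ℝ) + j with hx
  have hx3 : 3 ≤ x := by linarith
  obtain ⟨c, hc, he⟩ := exists_deriv_eq_slope
    (fun x : ℝ => -Real.exp (-Real.sqrt (Real.log x))) (show x < x + 1 by linarith)
    (by
      apply ContinuousOn.neg
      apply Real.continuous_exp.comp_continuousOn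
      apply ContinuousOn.neg
      apply Real.continuous_sqrt.comp_continuousOn
      apply Real.continuousOn_log.mono
      intro y hy
      have := hy.1
      simp only [Set.mem_compl_iff, Set.mem_singleton_iff]
      intro h; linarith)
    (by
      intro y hy
      obtain ⟨d, hd, -⟩ := deriv_bounds y (by linarith [hy.1])
      exact hd.differentiableAt.differentiableWithinAt)
  obtain ⟨d, hd, h1, h2⟩ := deriv_bounds c (by linarith [hc.1])
  rw [hd.deriv] at he
  have hr : rSeq j n = d := by
    rw [he]
    simp only [rSeq, aSeq]
    push_cast
    have : (n : ℝ) + 1 + j = x + 1 := by rw [hx]; ring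
    rw [this, ← hx]
    simp
  have hc1 := hc.1
  have hc2 := hc.2
  have hc0 : 0 < c := by linarith
  rw [hr]
  constructor
  · refine le_trans ?_ h1
    apply one_div_le_one_div_of_le (by positivity)
    nlinarith
  · refine le_trans h2 ?_
    apply one_div_le_one_div_of_le (by positivity)
    linarith

lemma p_bounds (j n : ℕ) (hj : 3 ≤ j) :
    0 ≤ pSeq j n ∧ pSeq j n ≤ 4 * ((n : ℝ) + j + 1) := by
  obtain ⟨h1, h2⟩ := r_bounds_s16 j n hj
  have hj' : (3 : ℝ) ≤ j := by exact_mod_cast hj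
  have hn : (0 : ℝ) ≤ n := Nat.cast_nonneg n
  have hz : zSeq j (n + 1) - zSeq j n = 3 * ((n : ℝ) + j) ^ 2 + 3 * ((n : ℝ) + j) + 1 := by
    simp only [zSeq]; push_cast; ring
  set x : ℝ := (n : ℝ) + j with hx
  have hx3 : 3 ≤ x := by linarith
  have h0 : 0 ≤ rSeq j n := le_trans (by positivity) h1
  simp only [pSeq, hz]
  refine ⟨by positivity, ?_⟩
  calc _ ≤ (3 * x ^ 2 + 3 * x + 1) * (1 / (2 * x)) := by gcongr
    _ ≤ _ := by
      rw [mul_one_div, div_le_iff₀ (by positivity)]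
      nlinarith

lemma q_bound (j n : ℕ) (hj : 3 ≤ j) : (n : ℝ) ^ 2 / 8 - 1 ≤ qSeq j n := by
  induction n with
  | zero => simp [qSeq]
  | succ n ih =>
    rcases Nat.eq_zero_or_pos n with rfl | hn
    · simp [qSeq]; norm_num
    · have hs : qSeq j (n + 1) = qSeq j n + zSeq j (n + 1) * rSeq j n := by
        simp only [qSeq]
        rw [Finset.sum_Icc_succ_top (by omega)]
        simp
      have h1 := (r_bounds_s16 j n hj).1
      have hj' : (3 : ℝ) ≤ j := by exact_mod_cast hj
      have hn0 : (0 : ℝ) ≤ n := Nat.cast_nonneg n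
      have hz : zSeq j (n + 1) = ((n : ℝ) + j + 1) ^ 3 := by
        simp only [zSeq]; push_cast; ring
      have h2 : ((n : ℝ) + j + 1) / 4 ≤ zSeq j (n + 1) * rSeq j n := by
        rw [hz]
        calc ((n : ℝ) + j + 1) / 4 = ((n : ℝ) + j + 1) ^ 3 * (1 / (4 * ((n : ℝ) + j + 1) ^ 2)) := by
              have : (n : ℝ) + j + 1 ≠ 0 := by positivity
              field_simp
          _ ≤ _ := by gcongr
      rw [hs]
      push_cast
      nlinarith

lemma rpow_le_exp_mul {u v a : ℝ} (hu : 0 ≤ u) (ha : 0 < a) (h : u ≤ Real.exp v) :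
    u ^ a ≤ Real.exp (v * a) := by
  rw [Real.exp_mul]
  exact Real.rpow_le_rpow hu h ha.le

lemma main_bound (j n : ℕ) (hj : 3 ≤ j) (α β γ : ℝ) (hα : 0 < α) (hβ : 0 < β) (hγ : 0 < γ) :
    Real.exp (-qSeq j n + 2 * pSeq j n) *
            zSeq j (n + 1) ^ α * pSeq j n ^ β * rSeq j n ^ (-γ) ≤
    Real.exp (-((n : ℝ) ^ 2 / 8 - 1) + (8 + 3 * α + 4 * β + 4 * γ) * ((n : ℝ) + j + 1)) := by
  have hq := q_bound j n hj
  obtain ⟨hp0, hp⟩ := p_bounds j n hj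
  have hr := (r_bounds_s16 j n hj).1
  have hz : zSeq j (n + 1) = ((n : ℝ) + j + 1) ^ 3 := by
    simp only [zSeq]; push_cast; ring
  have hy : 0 < (n : ℝ) + j + 1 := by positivity
  set y : ℝ := (n : ℝ) + j + 1
  have h1 : zSeq j (n + 1) ^ α ≤ Real.exp (3 * y * α) := by
    apply rpow_le_exp_mul (by rw [hz]; positivity) hα
    rw [hz, show 3 * y = ((3 : ℕ) : ℝ) * y by norm_num, Real.exp_nat_mul]
    gcongr
    linarith [Real.add_one_le_exp y]
  have h2 : pSeq j n ^ β ≤ Real.exp (4 * y * β) := by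
    apply rpow_le_exp_mul hp0 hβ
    linarith [Real.add_one_le_exp (4 * y)]
  have hr0 : 0 < rSeq j n := lt_of_lt_of_le (by positivity) hr
  have h3 : rSeq j n ^ (-γ) ≤ Real.exp (4 * y * γ) := by
    rw [Real.rpow_neg hr0.le, ← Real.inv_rpow hr0.le]
    apply rpow_le_exp_mul (by positivity) hγ
    have : (rSeq j n)⁻¹ ≤ (2 * y) ^ 2 := by
      rw [inv_le_comm₀ hr0 (by positivity)]
      refine le_trans (le_of_eq ?_) hr
      rw [one_div]; congr 1; ring
    refine this.trans ?_
    rw [show 4 * y = ((2 : ℕ) : ℝ) * (2 * y) by push_cast; ring, Real.exp_nat_mul]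
    gcongr
    linarith [Real.add_one_le_exp (2 * y)]
  have hz0 : 0 ≤ zSeq j (n + 1) := by rw [hz]; positivity
  calc _ ≤ Real.exp (-((n : ℝ) ^ 2 / 8 - 1) + 2 * (4 * y)) * Real.exp (3 * y * α) *
        Real.exp (4 * y * β) * Real.exp (4 * y * γ) := by gcongr
    _ = _ := by
      rw [← Real.exp_add, ← Real.exp_add, ← Real.exp_add]
      congr 1; ring

/-- For `j₀ ≥ 2` sufficiently large, for all real `α, β, γ > 0`,
`lim_n exp(−q_n + 2p_n) z_{n+1}^α p_n^β r_n^{−γ} = 0`. -/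
theorem stmt_16 :
    ∃ j₀s : ℕ, 2 ≤ j₀s ∧ ∀ j₀ : ℕ, j₀s ≤ j₀ →
      ∀ α β γ : ℝ, 0 < α → 0 < β → 0 < γ →
        Filter.Tendsto
          (fun n : ℕ => Real.exp (-qSeq j₀ n + 2 * pSeq j₀ n) *
            zSeq j₀ (n + 1) ^ α * pSeq j₀ n ^ β * rSeq j₀ n ^ (-γ))
          Filter.atTop (nhds 0) := by
  refine ⟨3, by norm_num, ?_⟩
  intro j hj α β γ hα hβ hγ
  refine squeeze_zero (fun n => ?_) (fun n => main_bound j n hj α β γ hα hβ hγ) ?_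
  · have hp := (p_bounds j n hj).1
    have hr : 0 ≤ rSeq j n := le_trans (by positivity) (r_bounds_s16 j n hj).1
    have hz : 0 ≤ zSeq j (n + 1) := by unfold zSeq; positivity
    positivity
  · apply Real.tendsto_exp_atBot.comp
    set K := 8 + 3 * α + 4 * β + 4 * γ
    have h : Filter.Tendsto (fun n : ℕ => -(n : ℝ) + (1 + K * (j + 1) + 2 * (K + 1) ^ 2))
        Filter.atTop Filter.atBot :=
      Filter.tendsto_atBot_add_const_right _ _
        (Filter.tendsto_neg_atTop_atBot.comp tendsto_natCast_atTop_atTop)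
    refine Filter.tendsto_atBot_mono (fun n => ?_) h
    nlinarith [sq_nonneg ((n : ℝ) - 4 * (K + 1))]
end

section
/- Fix an integer j₀ ≥ 2 and define a_n = −exp(−√(log(n+j₀))), z_n = (n+j₀)³, r_n = a_{n+1} − a_n, and p_n = (z_{n+1} − z_n)·r_n for n ≥ 1. Then for every α ∈ [0,1), sup_{n ≥ 1} p_n·r_n^{−1−α}·z_n^{−1} < +∞; moreover sup_{n ≥ 1} sup_{t ∈ [a_n, a_{n+1}]} (|t|/(1 + |log|t||))·p_n·r_n^{−2}·z_n^{−1} < +∞. -/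
/-- Key lower bound on `r_n`, with `s = √(log (n+j₀))`. -/
lemma key_bound (x s s' : ℝ) (hx : 3 ≤ x) (hs : s = Real.sqrt (Real.log x))
    (hs' : s' = Real.sqrt (Real.log (x + 1))) :
    1 ≤ s ∧ s ^ 2 = Real.log x ∧ s ≤ s' ∧
    0 < Real.exp (-s) - Real.exp (-s') ∧
    (Real.exp (-s) - Real.exp (-s'))⁻¹ ≤ 8 * Real.exp 1 * x * s * Real.exp s := by
  have hx0 : 0 < x := by linarith
  have hl : 1 ≤ Real.log x := by
    rw [Real.le_log_iff_exp_le hx0]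
    linarith [Real.exp_one_lt_d9]
  have hl1 : Real.log x ≤ Real.log (x + 1) := Real.log_le_log hx0 (by linarith)
  have hsq : s ^ 2 = Real.log x := by rw [hs, Real.sq_sqrt (by linarith)]
  have hsq' : s' ^ 2 = Real.log (x + 1) := by rw [hs', Real.sq_sqrt (by linarith)]
  have h1s : 1 ≤ s := by rw [hs]; exact Real.one_le_sqrt.mpr hl
  have hss : s ≤ s' := by rw [hs, hs']; exact Real.sqrt_le_sqrt hl1
  have hdiff : Real.log (x + 1) - Real.log x = Real.log ((x + 1) / x) := by
    rw [Real.log_div (by linarith) (by linarith)]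
  have hup : s' ^ 2 - s ^ 2 ≤ 1 := by
    rw [hsq, hsq', hdiff]
    have := Real.log_le_sub_one_of_pos (x := (x + 1) / x) (by positivity)
    have h2 : (x + 1) / x ≤ 2 := by rw [div_le_iff₀ hx0]; linarith
    linarith
  have hlow : (x + 1)⁻¹ ≤ s' ^ 2 - s ^ 2 := by
    rw [hsq, hsq', hdiff]
    have := Real.one_sub_inv_le_log_of_pos (x := (x + 1) / x) (by positivity)
    have h2 : 1 - ((x + 1) / x)⁻¹ = (x + 1)⁻¹ := by field_simp; ring
    linarith
  have hs1 : s' ≤ s + 1 := by nlinarith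
  have hprod : 1 ≤ 8 * x * s * (s' - s) := by
    have h3 : 1 ≤ (x + 1) * (s' ^ 2 - s ^ 2) := by
      have := mul_le_mul_of_nonneg_left hlow (by linarith : 0 ≤ x + 1)
      rwa [mul_inv_cancel₀ (by linarith)] at this
    have h4 : (x + 1) * (s' + s) ≤ 2 * x * (4 * s) :=
      mul_le_mul (by linarith) (by linarith) (by linarith) (by linarith)
    have := mul_le_mul_of_nonneg_right h4 (by linarith : 0 ≤ s' - s)
    nlinarith
  have hE : Real.exp (-s) - Real.exp (-s') = Real.exp (-s') * (Real.exp (s' - s) - 1) := by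
    rw [mul_sub, ← Real.exp_add]; ring_nf
  have hr : Real.exp (-s - 1) * (s' - s) ≤ Real.exp (-s) - Real.exp (-s') := by
    rw [hE]
    apply mul_le_mul
    · exact Real.exp_le_exp.mpr (by linarith)
    · linarith [Real.add_one_le_exp (s' - s)]
    · linarith
    · positivity
  have hd : 0 < s' - s := by
    by_contra h
    have : 8 * x * s * (s' - s) ≤ 0 :=
      mul_nonpos_of_nonneg_of_nonpos (by positivity) (by linarith)
    linarith
  have hrpos : 0 < Real.exp (-s) - Real.exp (-s') := lt_of_lt_of_le (by positivity) hr
  refine ⟨h1s, hsq, hss, hrpos, ?_⟩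
  rw [inv_le_iff_one_le_mul₀ hrpos]
  calc (1:ℝ) ≤ 8 * x * s * (s' - s) := hprod
    _ = (8 * Real.exp 1 * x * s * Real.exp s) * (Real.exp (-s - 1) * (s' - s)) := by
      have : Real.exp 1 * Real.exp s * Real.exp (-s - 1) = 1 := by
        rw [← Real.exp_add, ← Real.exp_add, Real.exp_eq_one_iff]; ring
      linear_combination (-(8 * x * s * (s' - s))) * this
    _ ≤ _ := by
      apply mul_le_mul_of_nonneg_left hr; positivity

lemma z_bound (x : ℝ) (hx : 3 ≤ x) : ((x + 1) ^ 3 - x ^ 3) * (x ^ 3)⁻¹ ≤ 7 * x⁻¹ := by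
  have hx0 : 0 < x := by linarith
  rw [← div_eq_mul_inv, ← div_eq_mul_inv, div_le_div_iff₀ (by positivity) hx0]
  have : (x + 1) ^ 3 - x ^ 3 ≤ 7 * x ^ 2 := by nlinarith
  nlinarith

/-- Fix an integer `j₀ ≥ 2`. Then for every `α ∈ [0,1)`,
`sup_{n ≥ 1} p_n r_n^{−1−α} z_n^{−1} < +∞`; moreover
`sup_{n ≥ 1} sup_{t ∈ [a_n, a_{n+1}]} (|t|/(1+|log|t||)) p_n r_n^{−2} z_n^{−1} < +∞`. -/
theorem stmt_18 (j₀ : ℕ) (hj₀ : 2 ≤ j₀) :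
    (∀ α : ℝ, 0 ≤ α → α < 1 →
      ∃ M : ℝ, ∀ n : ℕ, 1 ≤ n →
        pSeq j₀ n * rSeq j₀ n ^ (-(1 + α)) * (zSeq j₀ n)⁻¹ ≤ M) ∧
    (∃ M : ℝ, ∀ n : ℕ, 1 ≤ n →
      ∀ t ∈ Set.Icc (aSeq j₀ n) (aSeq j₀ (n + 1)),
        |t| / (1 + |Real.log (abs t)|) *
          (pSeq j₀ n * rSeq j₀ n ^ (-(2:ℝ)) * (zSeq j₀ n)⁻¹) ≤ M) := by
  have main : ∀ n : ℕ, 1 ≤ n → ∃ x s s' : ℝ, 3 ≤ x ∧ 1 ≤ s ∧ s ^ 2 = Real.log x ∧ s ≤ s' ∧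
      aSeq j₀ n = -Real.exp (-s) ∧ aSeq j₀ (n + 1) = -Real.exp (-s') ∧ 0 < rSeq j₀ n ∧
      (rSeq j₀ n)⁻¹ ≤ 8 * Real.exp 1 * x * s * Real.exp s ∧
      (zSeq j₀ (n + 1) - zSeq j₀ n) * (zSeq j₀ n)⁻¹ ≤ 7 * x⁻¹ := by
    intro n hn
    have hx : (3:ℝ) ≤ (n : ℝ) + (j₀ : ℝ) := by
      have h1 : (1:ℝ) ≤ n := by exact_mod_cast hn
      have h2 : (2:ℝ) ≤ j₀ := by exact_mod_cast hj₀
      linarith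
    have hc : ((n + 1 : ℕ) : ℝ) + (j₀ : ℝ) = (n : ℝ) + (j₀ : ℝ) + 1 := by push_cast; ring
    obtain ⟨h1, h2, h3, h4, h5⟩ := key_bound _ _ _ hx rfl rfl
    have hr : rSeq j₀ n = Real.exp (-Real.sqrt (Real.log ((n : ℝ) + (j₀ : ℝ)))) -
        Real.exp (-Real.sqrt (Real.log ((n : ℝ) + (j₀ : ℝ) + 1))) := by
      unfold rSeq aSeq; rw [hc]; ring
    refine ⟨_, _, _, hx, h1, h2, h3, rfl, ?_, ?_, ?_, ?_⟩
    · unfold aSeq; rw [hc]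
    · rw [hr]; exact h4
    · rw [hr]; exact h5
    · unfold zSeq; rw [hc]; exact z_bound _ hx
  constructor
  · intro α h0 h1
    refine ⟨56 * Real.exp 1 * Real.exp (1 / (1 - α)), fun n hn => ?_⟩
    obtain ⟨x, s, s', hx, hs, hsq, -, -, -, hr, hri, hz⟩ := main n hn
    have hx0 : 0 < x := by linarith
    have hxe : x = Real.exp (s ^ 2) := by rw [hsq, Real.exp_log hx0]
    have e1 : pSeq j₀ n * rSeq j₀ n ^ (-(1 + α)) * (zSeq j₀ n)⁻¹ =
        (zSeq j₀ (n + 1) - zSeq j₀ n) * (zSeq j₀ n)⁻¹ * ((rSeq j₀ n)⁻¹) ^ α := by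
      have : rSeq j₀ n * rSeq j₀ n ^ (-(1 + α)) = ((rSeq j₀ n)⁻¹) ^ α := by
        rw [Real.inv_rpow hr.le, ← Real.rpow_neg hr.le]
        nth_rewrite 1 [← Real.rpow_one (rSeq j₀ n)]
        rw [← Real.rpow_add hr]; ring_nf
      rw [← this]; unfold pSeq; ring
    have hB : (rSeq j₀ n)⁻¹ ≤ (8 * Real.exp 1) * Real.exp (s ^ 2 + 2 * s) := by
      refine hri.trans ?_
      have h2 : s ≤ Real.exp s := by linarith [Real.add_one_le_exp s]
      have h3 : Real.exp (s ^ 2 + 2 * s) = x * Real.exp s * Real.exp s := by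
        rw [hxe, ← Real.exp_add, ← Real.exp_add]; ring_nf
      rw [h3]
      calc 8 * Real.exp 1 * x * s * Real.exp s
          ≤ 8 * Real.exp 1 * x * Real.exp s * Real.exp s := by gcongr
        _ = _ := by ring
    have h8 : 1 ≤ 8 * Real.exp 1 := by linarith [Real.add_one_le_exp (1:ℝ)]
    have hBα : ((rSeq j₀ n)⁻¹) ^ α ≤ (8 * Real.exp 1) * Real.exp ((s ^ 2 + 2 * s) * α) := by
      calc ((rSeq j₀ n)⁻¹) ^ α ≤ ((8 * Real.exp 1) * Real.exp (s ^ 2 + 2 * s)) ^ α :=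
            Real.rpow_le_rpow (by positivity) hB h0
        _ = (8 * Real.exp 1) ^ α * Real.exp ((s ^ 2 + 2 * s) * α) := by
            rw [Real.mul_rpow (by positivity) (by positivity), ← Real.exp_mul]
        _ ≤ _ := by
            apply mul_le_mul_of_nonneg_right _ (by positivity)
            calc (8 * Real.exp 1) ^ α ≤ (8 * Real.exp 1) ^ (1:ℝ) :=
                  Real.rpow_le_rpow_of_exponent_le h8 h1.le
              _ = _ := Real.rpow_one _
    rw [e1]
    calc _ ≤ 7 * x⁻¹ * ((8 * Real.exp 1) * Real.exp ((s ^ 2 + 2 * s) * α)) :=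
          mul_le_mul hz hBα (by positivity) (by positivity)
      _ = 56 * Real.exp 1 * Real.exp (-s ^ 2 + (s ^ 2 + 2 * s) * α) := by
          rw [Real.exp_add, hxe, ← Real.exp_neg]; ring
      _ ≤ _ := by
          apply mul_le_mul_of_nonneg_left _ (by positivity)
          apply Real.exp_le_exp.mpr
          have hα : 0 < 1 - α := by linarith
          rw [le_div_iff₀ hα]
          nlinarith [sq_nonneg ((1 - α) * s - 1), mul_nonneg (mul_nonneg hα.le hα.le) (by linarith : 0 ≤ s)]
  · refine ⟨56 * Real.exp 1, fun n hn t ht => ?_⟩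
    obtain ⟨x, s, s', hx, hs, hsq, hss, ha, ha', hr, hri, hz⟩ := main n hn
    have hx0 : 0 < x := by linarith
    rw [ha, ha'] at ht
    obtain ⟨ht1, ht2⟩ := ht
    have ht0 : t < 0 := lt_of_le_of_lt ht2 (by linarith [Real.exp_pos (-s')])
    have habs : |t| ≤ Real.exp (-s) := by rw [abs_of_neg ht0]; linarith
    have hlog : Real.log |t| ≤ -s := by
      rw [Real.log_le_iff_le_exp (abs_pos.mpr ht0.ne)]; exact habs
    have hden : s ≤ 1 + |Real.log (abs t)| := by
      linarith [neg_le_abs (Real.log |t|)]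
    have hT : |t| / (1 + |Real.log (abs t)|) ≤ Real.exp (-s) / s :=
      div_le_div₀ (by positivity) habs (by linarith) hden
    have e1 : pSeq j₀ n * rSeq j₀ n ^ (-(2:ℝ)) * (zSeq j₀ n)⁻¹ =
        (zSeq j₀ (n + 1) - zSeq j₀ n) * (zSeq j₀ n)⁻¹ * (rSeq j₀ n)⁻¹ := by
      rw [Real.rpow_neg hr.le, Real.rpow_two]; unfold pSeq; field_simp
    have hP : pSeq j₀ n * rSeq j₀ n ^ (-(2:ℝ)) * (zSeq j₀ n)⁻¹ ≤
        7 * x⁻¹ * (8 * Real.exp 1 * x * s * Real.exp s) := by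
      rw [e1]; exact mul_le_mul hz hri (by positivity) (by positivity)
    have hnn : 0 ≤ |t| / (1 + |Real.log (abs t)|) := by positivity
    calc _ ≤ |t| / (1 + |Real.log (abs t)|) * (7 * x⁻¹ * (8 * Real.exp 1 * x * s * Real.exp s)) :=
          mul_le_mul_of_nonneg_left hP hnn
      _ ≤ Real.exp (-s) / s * (7 * x⁻¹ * (8 * Real.exp 1 * x * s * Real.exp s)) :=
          mul_le_mul_of_nonneg_right hT (by positivity)
      _ = 56 * Real.exp 1 := by
          rw [Real.exp_neg]
          have := Real.exp_pos s
          field_simp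
          norm_num
end

section
/- The function μ : [0,1] → [0,1] defined by μ(0) = 0 and μ(s) = s·log(e + 1/s − 1) for s ∈ (0,1] is a modulus of continuity (it is continuous, concave, strictly increasing, with μ(0) = 0 and μ(1) = 1), and it satisfies the Osgood condition ∫₀¹ 1/μ(s) ds = +∞. -/
open Set

lemma aux_pos (s : ℝ) (hs : 0 < s) (h1 : s ≤ 1) :
    Real.exp 1 ≤ Real.exp 1 + 1 / s - 1 := by
  have : 1 ≤ 1 / s := by rw [le_div_iff₀ hs]; linarith
  linarith

lemma aux_log (s : ℝ) (hs : 0 < s) (h1 : s ≤ 1) :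
    1 ≤ Real.log (Real.exp 1 + 1 / s - 1) := by
  rw [Real.le_log_iff_exp_le (lt_of_lt_of_le (Real.exp_pos 1) (aux_pos s hs h1))]
  exact aux_pos s hs h1

lemma aux_e : 1 < Real.exp 1 := by
  have := Real.add_one_lt_exp (x := 1) one_ne_zero
  linarith

lemma aux_eq (s : ℝ) (hs : 0 ≤ s) :
    s * Real.log (Real.exp 1 + 1 / s - 1)
      = s * Real.log (1 + (Real.exp 1 - 1) * s) - s * Real.log s := by
  rcases hs.eq_or_lt with rfl | hs
  · simp
  · have he := aux_e
    have h : Real.exp 1 + 1 / s - 1 = (1 + (Real.exp 1 - 1) * s) / s := by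
      field_simp; ring
    have h2 : 0 < 1 + (Real.exp 1 - 1) * s := by
      have := mul_pos (sub_pos.2 he) hs
      linarith
    rw [h, Real.log_div h2.ne' hs.ne']; ring

lemma aux_cont : ContinuousOn (fun s : ℝ => s * Real.log (Real.exp 1 + 1 / s - 1)) (Icc 0 1) := by
  have : ContinuousOn (fun s : ℝ => s * Real.log (1 + (Real.exp 1 - 1) * s) - s * Real.log s)
      (Icc 0 1) := by
    apply ContinuousOn.sub _ Real.continuous_mul_log.continuousOn
    apply continuousOn_id.mul
    apply ContinuousOn.log (by fun_prop)
    intro x hx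
    have := mul_nonneg (sub_pos.2 aux_e).le hx.1
    linarith
  exact this.congr fun s hs => aux_eq s hs.1

lemma aux_inner (s : ℝ) (hs : s ≠ 0) :
    HasDerivAt (fun s : ℝ => Real.exp 1 + 1 / s - 1) (-(s ^ 2)⁻¹) s := by
  have := ((hasDerivAt_inv hs).const_add (Real.exp 1)).sub_const 1
  simpa [one_div] using this

lemma aux_mono : StrictMonoOn (fun s : ℝ => s * Real.log (Real.exp 1 + 1 / s - 1)) (Icc 0 1) := by
  apply strictMonoOn_of_deriv_pos (convex_Icc 0 1) aux_cont
  intro s hs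
  rw [interior_Icc] at hs
  obtain ⟨h0, h1⟩ := hs
  have hp := lt_of_lt_of_le (Real.exp_pos 1) (aux_pos s h0 h1.le)
  have hd := (hasDerivAt_id s).mul ((aux_inner s h0.ne').log hp.ne')
  have hd' : HasDerivAt (fun s : ℝ => s * Real.log (Real.exp 1 + 1 / s - 1)) _ s := hd
  rw [hd'.deriv]
  have hl := aux_log s h0 h1.le
  have he := mul_pos (sub_pos.2 aux_e) h0
  have : id s * (-(s ^ 2)⁻¹ / (Real.exp 1 + 1 / s - 1))
      = - (1 / (1 + (Real.exp 1 - 1) * s)) := by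
    have h : Real.exp 1 + 1 / s - 1 = (1 + (Real.exp 1 - 1) * s) / s := by
      field_simp; ring
    have h2 : 1 + (Real.exp 1 - 1) * s ≠ 0 := by linarith
    rw [h]; simp only [id]; field_simp
  rw [this]
  have h3 : 1 / (1 + (Real.exp 1 - 1) * s) < 1 := by
    rw [div_lt_one (by linarith)]; linarith
  linarith

lemma aux_zero (b y : ℝ) (hb : 0 ≤ b) (hb1 : b ≤ 1) (hy : 0 ≤ y) :
    b * (y * Real.log (Real.exp 1 + 1 / y - 1))
      ≤ (b * y) * Real.log (Real.exp 1 + 1 / (b * y) - 1) := by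
  rcases hy.eq_or_lt with rfl | hy
  · simp
  rcases hb.eq_or_lt with rfl | hb
  · simp
  have he := aux_e
  have h1 : 0 < 1 / y := by positivity
  have h2 : 1 / y ≤ 1 / (b * y) := by
    apply one_div_le_one_div_of_le (by positivity); nlinarith
  rw [← mul_assoc]
  gcongr
  linarith

lemma aux_concave : ConcaveOn ℝ (Icc 0 1)
    (fun s : ℝ => s * Real.log (Real.exp 1 + 1 / s - 1)) := by
  refine ⟨convex_Icc 0 1, ?_⟩
  intro x hx y hy a b ha hb hab
  simp only [smul_eq_mul]
  rcases hx.1.eq_or_lt with h | hx0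
  · subst h
    simpa using aux_zero b y hb (by linarith) hy.1
  rcases hy.1.eq_or_lt with h | hy0
  · subst h
    simpa using aux_zero a x ha (by linarith) hx.1
  have he := aux_e
  have hz : 0 < a * x + b * y := by
    rcases ha.eq_or_lt with rfl | ha
    · have : b = 1 := by linarith
      subst this; linarith
    · positivity
  have hx' : 0 < Real.exp 1 + 1 / x - 1 := by
    have : 0 < 1 / x := by positivity
    linarith
  have hy' : 0 < Real.exp 1 + 1 / y - 1 := by
    have : 0 < 1 / y := by positivity
    linarith
  have := strictConcaveOn_log_Ioi.concaveOn.2 (mem_Ioi.2 hx') (mem_Ioi.2 hy')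
    (show 0 ≤ a * x / (a * x + b * y) by positivity)
    (show 0 ≤ b * y / (a * x + b * y) by positivity) (by field_simp)
  simp only [smul_eq_mul] at this
  have e : a * x / (a * x + b * y) * (Real.exp 1 + 1 / x - 1)
      + b * y / (a * x + b * y) * (Real.exp 1 + 1 / y - 1)
      = Real.exp 1 + 1 / (a * x + b * y) - 1 := by
    have : b = 1 - a := by linarith
    subst this
    field_simp; ring
  rw [e] at this
  calc _ = (a * x + b * y) * (a * x / (a * x + b * y) * Real.log (Real.exp 1 + 1 / x - 1)
      + b * y / (a * x + b * y) * Real.log (Real.exp 1 + 1 / y - 1)) := by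
        field_simp
    _ ≤ _ := mul_le_mul_of_nonneg_left this hz.le

open Filter Topology in
lemma aux_nonint : ¬ MeasureTheory.IntegrableOn
    (fun s : ℝ => 1 / (s * Real.log (Real.exp 1 + 1 / s - 1))) (Ioc 0 1) := by
  have hmem : Ioc (0:ℝ) 1 ∈ 𝓝[>] (0:ℝ) := Ioc_mem_nhdsGT one_pos
  have hd : ∀ s ∈ Ioc (0:ℝ) 1, HasDerivAt
      (fun s : ℝ => Real.log (Real.log (Real.exp 1 + 1 / s - 1)))
      (-(s ^ 2)⁻¹ / (Real.exp 1 + 1 / s - 1) / Real.log (Real.exp 1 + 1 / s - 1)) s := by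
    intro s hs
    have hp := lt_of_lt_of_le (Real.exp_pos 1) (aux_pos s hs.1 hs.2)
    have hl := aux_log s hs.1 hs.2
    exact ((aux_inner s hs.1.ne').log hp.ne').log (by linarith)
  apply not_integrableOn_of_tendsto_norm_atTop_of_deriv_isBigO_filter (𝓝[>] (0:ℝ)) hmem
    (f := fun s : ℝ => Real.log (Real.log (Real.exp 1 + 1 / s - 1)))
  · filter_upwards [hmem] with s hs
    exact (hd s hs).differentiableAt
  · apply tendsto_norm_atTop_atTop.comp
    apply Real.tendsto_log_atTop.comp
    apply Real.tendsto_log_atTop.comp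
    have : Tendsto (fun s : ℝ => s⁻¹ + (Real.exp 1 - 1)) (𝓝[>] 0) atTop :=
      tendsto_atTop_add_const_right _ _ tendsto_inv_nhdsGT_zero
    refine this.congr fun s => ?_
    rw [one_div]; ring
  · apply Asymptotics.IsBigO.of_bound 1
    filter_upwards [hmem] with s hs
    rw [(hd s hs).deriv]
    have hl := aux_log s hs.1 hs.2
    have h0 := hs.1
    have he := mul_pos (sub_pos.2 aux_e) h0
    have h : Real.exp 1 + 1 / s - 1 = (1 + (Real.exp 1 - 1) * s) / s := by
      field_simp; ring
    have : -(s ^ 2)⁻¹ / (Real.exp 1 + 1 / s - 1) / Real.log (Real.exp 1 + 1 / s - 1)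
      = - (1 / (1 + (Real.exp 1 - 1) * s) *
        (1 / (s * Real.log (Real.exp 1 + 1 / s - 1)))) := by
      generalize Real.log (Real.exp 1 + 1 / s - 1) = L at *
      have h2 : 1 + (Real.exp 1 - 1) * s ≠ 0 := by linarith
      have h3 : L ≠ 0 := by linarith
      rw [h]; field_simp
    rw [this, norm_neg, norm_mul]
    gcongr
    rw [Real.norm_of_nonneg (by positivity), div_le_one (by linarith)]
    linarith

/-- The function `μ : [0,1] → [0,1]` defined by `μ 0 = 0` and
`μ s = s · log(e + 1/s − 1)` for `s ∈ (0,1]` is a modulus of continuity (continuous,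
concave, strictly increasing on `[0,1]`, with `μ 0 = 0`, `μ 1 = 1`, mapping `[0,1]`
into `[0,1]`), and it satisfies the Osgood condition `∫₀¹ 1/μ(s) ds = +∞`.
(Note: with Lean's convention `1/0 = 0`, the formula also gives `μ 0 = 0`.) -/
theorem stmt_19 :
    ∀ μ : ℝ → ℝ, (μ = fun s => s * Real.log (Real.exp 1 + 1 / s - 1)) →
      μ 0 = 0 ∧ μ 1 = 1 ∧
      ContinuousOn μ (Icc 0 1) ∧
      ConcaveOn ℝ (Icc 0 1) μ ∧
      StrictMonoOn μ (Icc 0 1) ∧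
      MapsTo μ (Icc 0 1) (Icc 0 1) ∧
      (∫⁻ s in Ioc (0:ℝ) 1, ENNReal.ofReal (1 / μ s)) = ⊤ := by
  rintro μ hμ
  have h0 : μ 0 = 0 := by simp [hμ]
  have h1 : μ 1 = 1 := by simp [hμ]
  have hm : StrictMonoOn μ (Icc 0 1) := hμ ▸ aux_mono
  refine ⟨h0, h1, hμ ▸ aux_cont, hμ ▸ aux_concave, hm, ?_, ?_⟩
  · intro x hx
    have ha := hm.monotoneOn (left_mem_Icc.2 zero_le_one) hx hx.1
    have hb := hm.monotoneOn hx (right_mem_Icc.2 zero_le_one) hx.2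
    rw [h0] at ha
    rw [h1] at hb
    exact ⟨ha, hb⟩
  · by_contra hne
    apply aux_nonint
    have hmeas : Measurable (fun s : ℝ => 1 / μ s) := by
      rw [hμ]; fun_prop
    have : MeasureTheory.IntegrableOn (fun s : ℝ => 1 / μ s) (Ioc 0 1) := by
      refine ⟨hmeas.aestronglyMeasurable, ?_⟩
      rw [MeasureTheory.hasFiniteIntegral_iff_ofReal]
      · exact lt_top_iff_ne_top.2 hne
      · filter_upwards [MeasureTheory.ae_restrict_mem measurableSet_Ioc] with s hs
        have hl := aux_log s hs.1 hs.2
        have := hs.1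
        simp only [hμ, Pi.zero_apply]
        positivity
    simpa only [hμ] using this
end
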